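/- There exist absolute constants L > 0 and C > 0 such that for every prime D > 3 with D ≡ 3 (mod 4) and every ideal class 𝒞 of the imaginary quadratic field K = ℚ(√−D), there exists a prime ideal 𝔭 of the ring of integers O_K lying in the class 𝒞 whose absolute norm N𝔭 is a rational prime different from D (i.e. 𝔭 is a split prime) and satisfies N𝔭 ≤ C · D^L. -/

import Mathlib

open NumberField
open scoped Classical

/-- The ideal class of a nonzero integral ideal (junk value `1` for the zero ideal). -/
noncomputable def idealClass (K : Type) [Field K] [NumberField K] (I : Ideal (𝓞 K)) :
    ClassGroup (𝓞 K) :=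
  if h : I ∈ nonZeroDivisors (Ideal (𝓞 K)) then ClassGroup.mk0 ⟨I, h⟩ else 1

/-- The density `∏ (1 - 1/N p)` of elements surviving a sieve by the primes of `T`. -/
noncomputable def siftDensity {P : Type} (N : P → ℝ) (T : Finset P) : ℝ := ∏ p ∈ T, (1 - 1 / N p)

lemma siftDensity_pos {P : Type} {N : P → ℝ} (hN : ∀ p, 2 ≤ N p) (T : Finset P) :
    0 < siftDensity N T := by
  refine Finset.prod_pos fun p _ => ?_
  have := hN p
  have : 1 / N p ≤ 1 / 2 := one_div_le_one_div_of_le (by norm_num) this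
  linarith

lemma exp_neg_two_mul_le {t : ℝ} (h0 : 0 ≤ t) (h1 : t ≤ 1 / 2) : Real.exp (-(2 * t)) ≤ 1 - t := by
  have h2 : 1 + 2 * t ≤ Real.exp (2 * t) := by linarith [Real.add_one_le_exp (2 * t)]
  rw [Real.exp_neg, inv_le_comm₀ (Real.exp_pos _) (by linarith)]
  refine le_trans ?_ h2
  rw [inv_le_iff_one_le_mul₀ (by linarith)]
  nlinarith

lemma siftDensity_le_exp_mul {P : Type} {N : P → ℝ} (hN : ∀ p, 2 ≤ N p) {T T' : Finset P}
    (h : T ⊆ T') {c : ℝ} (hc : ∑ p ∈ T' \ T, 1 / N p ≤ c) :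
    siftDensity N T ≤ Real.exp (2 * c) * siftDensity N T' := by
  have h1 : siftDensity N T' = siftDensity N (T' \ T) * siftDensity N T := by
    unfold siftDensity
    rw [Finset.prod_sdiff h]
  have h2 : Real.exp (-(2 * c)) ≤ siftDensity N (T' \ T) := by
    calc Real.exp (-(2 * c)) ≤ Real.exp (∑ p ∈ T' \ T, -(2 * (1 / N p))) := by
          rw [Finset.sum_neg_distrib, ← Finset.mul_sum]
          gcongr
      _ = ∏ p ∈ T' \ T, Real.exp (-(2 * (1 / N p))) := Real.exp_sum _ _
      _ ≤ _ := by
          refine Finset.prod_le_prod (fun p _ => (Real.exp_pos _).le) fun p _ => ?_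
          have := hN p
          exact exp_neg_two_mul_le (by positivity) (one_div_le_one_div_of_le (by norm_num) this)
  have h3 := siftDensity_pos hN T
  rw [h1, ← mul_assoc]
  have : 1 ≤ Real.exp (2 * c) * siftDensity N (T' \ T) := by
    rw [Real.exp_neg] at h2
    have h4 := Real.exp_pos (2 * c)
    rw [inv_le_iff_one_le_mul₀ h4] at h2
    linarith
  nlinarith

/-- The sum of `1 / (N p log N p)` over the primes of `U` outside `T`. -/
noncomputable def logTail {P : Type} (N : P → ℝ) (U T : Finset P) : ℝ :=
  ∑ p ∈ U \ T, 1 / (N p * Real.log (N p))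

lemma logTail_nonneg {P : Type} {N : P → ℝ} (hN : ∀ p, 2 ≤ N p) (U T : Finset P) :
    0 ≤ logTail N U T := by
  refine Finset.sum_nonneg fun p _ => ?_
  have := hN p
  have := Real.log_nonneg (by linarith : 1 ≤ N p)
  positivity

lemma sum_one_div_le_of_tail {P : Type} {N : P → ℝ} (hN : ∀ p, 2 ≤ N p) {Ct : ℝ}
    (hCt : ∀ (F : Finset P) (v : ℝ), 2 ≤ v → (∀ p ∈ F, v ≤ N p) →
      ∑ p ∈ F, 1 / (N p * Real.log (N p)) ≤ Ct / Real.log v)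
    (F : Finset P) {v y : ℝ} (hv : 2 ≤ v) (hF : ∀ p ∈ F, v ≤ N p ∧ N p ≤ y) (hy : 1 ≤ y) :
    ∑ p ∈ F, 1 / N p ≤ Real.log y * (Ct / Real.log v) := by
  calc ∑ p ∈ F, 1 / N p ≤ ∑ p ∈ F, Real.log y * (1 / (N p * Real.log (N p))) := by
        refine Finset.sum_le_sum fun p hp => ?_
        have h2 := hN p
        have h1 : 0 < Real.log (N p) := Real.log_pos (by linarith)
        have h3 : Real.log (N p) ≤ Real.log y := Real.log_le_log (by linarith) (hF p hp).2
        rw [mul_one_div, div_le_div_iff₀ (by linarith) (by positivity)]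
        nlinarith
    _ = Real.log y * ∑ p ∈ F, (1 / (N p * Real.log (N p))) := by rw [Finset.mul_sum]
    _ ≤ _ := by
        have := hCt F v hv fun p hp => (hF p hp).1
        have h1 := Real.log_nonneg hy
        gcongr

set_option maxHeartbeats 1000000 in
/-- Abstract beta-sieve: a family `s T L g` obeying the inclusion-exclusion recursion of a sieve
of bounded dimension is close to the density of `T`. -/
theorem fundamental_lemma_sieve {P G : Type} [AddCommGroup G] (N : P → ℝ) (cl : P → G)
    (hN : ∀ p, 2 ≤ N p) (hfin : ∀ y, {p | N p < y}.Finite) {Ct : ℝ} (hCt0 : 0 ≤ Ct)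
    (hCt : ∀ (F : Finset P) (v : ℝ), 2 ≤ v → (∀ p ∈ F, v ≤ N p) →
      ∑ p ∈ F, 1 / (N p * Real.log (N p)) ≤ Ct / Real.log v)
    (s : Finset P → ℝ → G → ℝ) (hs0 : ∀ T L g, 0 ≤ s T L g)
    (hsmono : ∀ T T' L g, T ⊆ T' → s T' L g ≤ s T L g)
    (hrec : ∀ T p L g, p ∉ T →
      s (insert p T) L g = s T L g - 1 / N p * s T (L - Real.log (N p)) (g - cl p))
    (hbase : ∀ L g, 0 ≤ L → |s ∅ L g - 1| ≤ Real.exp (-(L / 2)))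
    (U T : Finset P) (hTU : T ⊆ U) (y : ℝ) (hy : 2 ≤ y) (hT1 : ∀ p, N p < y → p ∈ T)
    (hT2 : ∀ p ∈ T, N p ≤ y) (L : ℝ) (g : G) (hL : (4 + 50 * Ct) * Real.log y ≤ L) :
    |s T L g - siftDensity N T| ≤ siftDensity N T * (4 * Real.exp (1 / 2 + 15 * Ct) *
      Real.exp (-(L * (1 / 10 / Real.log y + 4 / (5 + 50 * Ct) * logTail N U T)))) := by
  induction hn : T.card using Nat.strong_induction_on generalizing T y L g with
  | _ n ih =>
  have hlogy : 0 < Real.log y := Real.log_pos (by linarith)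
  have hlog2 : (0.6931471803 : ℝ) < Real.log 2 := Real.log_two_gt_d9
  have hlog2' : Real.log 2 < 0.6931471808 := Real.log_two_lt_d9
  have hL0 : 0 ≤ L := le_trans (by positivity) hL
  set β : ℝ := 5 + 50 * Ct with hβ
  have hβ0 : 0 < β := by positivity
  have hbC : 4 / β * Ct ≤ 2 / 25 := by
    rw [div_mul_eq_mul_div, div_le_div_iff₀ hβ0 (by norm_num)]
    linarith
  have hb0 : 0 < 4 / β := by positivity
  set Q : ℝ := 4 * Real.exp (1 / 2 + 15 * Ct) with hQ
  have hQ4 : 4 ≤ Q := by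
    have := Real.one_le_exp (show 0 ≤ 1 / 2 + 15 * Ct by positivity)
    linarith
  rcases T.eq_empty_or_nonempty with rfl | hne
  · have h1 : logTail N U ∅ ≤ Ct / Real.log 2 := hCt _ 2 le_rfl fun p _ => hN p
    have h2 : 1 / 10 / Real.log y ≤ 1 / 10 / Real.log 2 := by gcongr
    have h3 : 1 / 10 / Real.log y + 4 / β * logTail N U ∅ ≤ 1 / 2 := by
      calc _ ≤ 1 / 10 / Real.log 2 + 4 / β * (Ct / Real.log 2) := by gcongr
        _ = (1 / 10 + 4 / β * Ct) / Real.log 2 := by ring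
        _ ≤ _ := by
            rw [div_le_iff₀ (by linarith)]
            linarith
    have h4 := hbase L g hL0
    have h5 : siftDensity N ∅ = 1 := by simp [siftDensity]
    rw [h5, one_mul]
    refine h4.trans ?_
    have h6 : Real.exp (-(L / 2)) ≤
        Real.exp (-(L * (1 / 10 / Real.log y + 4 / β * logTail N U ∅))) := by
      gcongr
      nlinarith
    have := Real.exp_pos (-(L * (1 / 10 / Real.log y + 4 / β * logTail N U ∅)))
    nlinarith
  obtain ⟨p, hpT, hpmax⟩ := T.exists_max_image N hne
  set y₀ := N p with hy₀
  have hy₀2 : 2 ≤ y₀ := hN p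
  have hy₀y : y₀ ≤ y := hT2 p hpT
  have hl0 : 0 < Real.log y₀ := Real.log_pos (by linarith)
  have hly : Real.log y₀ ≤ Real.log y := Real.log_le_log (by linarith) hy₀y
  have hL' : (4 + 50 * Ct) * Real.log y₀ ≤ L := le_trans (by gcongr) hL
  have hVT := siftDensity_pos hN T
  suffices h : |s T L g - siftDensity N T| ≤ siftDensity N T * (Q *
      Real.exp (-(L * (1 / 10 / Real.log y₀ + 4 / β * logTail N U T)))) by
    refine h.trans ?_
    gcongr
  set T₀ := T.erase p with hT₀
  have hpT₀ : p ∉ T₀ := Finset.notMem_erase p T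
  have hins : insert p T₀ = T := Finset.insert_erase hpT
  have hT₀U : T₀ ⊆ U := (Finset.erase_subset _ _).trans hTU
  have hcard : T₀.card < n := by
    rw [← hn]; exact Finset.card_erase_lt_of_mem hpT
  have hT₀1 : ∀ q, N q < y₀ → q ∈ T₀ := fun q hq => by
    refine Finset.mem_erase.2 ⟨?_, hT1 q (by linarith)⟩
    rintro rfl
    exact lt_irrefl _ hq
  have hT₀2 : ∀ q ∈ T₀, N q ≤ y₀ := fun q hq => hpmax q (Finset.mem_of_mem_erase hq)
  have hVrec : siftDensity N T = (1 - 1 / y₀) * siftDensity N T₀ := by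
    rw [← hins]; unfold siftDensity; rw [Finset.prod_insert hpT₀]
  have hV₀ := siftDensity_pos hN T₀
  have hτrec : logTail N U T₀ = logTail N U T + 1 / (y₀ * Real.log y₀) := by
    unfold logTail
    have : U \ T₀ = insert p (U \ T) := by
      ext q
      simp only [hT₀, Finset.mem_sdiff, Finset.mem_erase, Finset.mem_insert, not_and]
      constructor
      · rintro ⟨h1, h2⟩
        by_cases h : q = p
        · exact Or.inl h
        · exact Or.inr ⟨h1, h2 h⟩
      · rintro (rfl | ⟨h1, h2⟩)
        · exact ⟨hTU hpT, fun h => absurd rfl h⟩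
        · exact ⟨h1, fun _ => h2⟩
    rw [this, Finset.sum_insert (by simp [hpT])]
    ring
  have hτ0 := logTail_nonneg hN U T
  have hτ₀ : logTail N U T₀ ≤ Ct / Real.log y₀ := by
    refine hCt _ y₀ hy₀2 fun q hq => ?_
    by_contra h
    exact (Finset.mem_sdiff.1 hq).2 (hT₀1 q (not_le.1 h))
  have hpos : 0 < 1 / (y₀ * Real.log y₀) := by positivity
  have hτ : logTail N U T ≤ Ct / Real.log y₀ := by linarith
  set lam : ℝ := 1 / 10 / Real.log y₀ + 4 / β * logTail N U T with hlam
  have hlam0 : 0 ≤ lam := by positivity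
  have hlamlog : lam * Real.log y₀ ≤ 1 / 10 + 4 / β * Ct := by
    calc lam * Real.log y₀ ≤ (1 / 10 / Real.log y₀ + 4 / β * (Ct / Real.log y₀)) * Real.log y₀ := by
          rw [hlam]; gcongr
      _ = _ := by field_simp
  have hlamlog₀ : (1 / 10 / Real.log y₀ + 4 / β * logTail N U T₀) * Real.log y₀
      ≤ 1 / 10 + 4 / β * Ct := by
    calc _ ≤ (1 / 10 / Real.log y₀ + 4 / β * (Ct / Real.log y₀)) * Real.log y₀ := by
          gcongr
      _ = _ := by field_simp
  rcases le_or_gt (β * Real.log y₀) L with hcase | hcase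
  · -- the recursion applies to both terms
    have ih1 := ih _ hcard T₀ hT₀U y₀ hy₀2 hT₀1 hT₀2 L g hL' rfl
    have ih2 := ih _ hcard T₀ hT₀U y₀ hy₀2 hT₀1 hT₀2 (L - Real.log y₀) (g - cl p)
      (by rw [hβ] at hcase; linarith) rfl
    set lam0 : ℝ := 1 / 10 / Real.log y₀ + 4 / β * logTail N U T₀ with hlam0'
    have hlam01 : lam0 = lam + 4 / β * (1 / (y₀ * Real.log y₀)) := by
      rw [hlam0', hlam, hτrec]; ring
    have e1 : Real.exp (-(L * lam0)) ≤ Real.exp (-(L * lam)) * Real.exp (-(4 * (1 / y₀))) := by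
      rw [← Real.exp_add]
      gcongr
      have : 4 * (1 / y₀) ≤ L * (4 / β * (1 / (y₀ * Real.log y₀))) := by
        calc 4 * (1 / y₀) = (β * Real.log y₀) * (4 / β * (1 / (y₀ * Real.log y₀))) := by
              field_simp
          _ ≤ _ := by gcongr
      rw [hlam01]; linarith
    have e2 : Real.exp (-((L - Real.log y₀) * lam0)) ≤ 2 * Real.exp (-(L * lam0)) := by
      have h3 : Real.exp (lam0 * Real.log y₀) ≤ 2 := by
        calc Real.exp (lam0 * Real.log y₀) ≤ Real.exp (Real.log 2) := by
              gcongr; linarith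
          _ = 2 := Real.exp_log (by norm_num)
      have : -((L - Real.log y₀) * lam0) = lam0 * Real.log y₀ + -(L * lam0) := by ring
      rw [this, Real.exp_add]
      gcongr
    have ht : 1 / y₀ ≤ 1 / 2 := one_div_le_one_div_of_le (by norm_num) hy₀2
    have ht0 : 0 < 1 / y₀ := by positivity
    have e3 : Real.exp (-(4 * (1 / y₀))) * (1 + 2 * (1 / y₀)) ≤ 1 - 1 / y₀ := by
      have h1 := Real.add_one_le_exp (2 * (1 / y₀))
      calc Real.exp (-(4 * (1 / y₀))) * (1 + 2 * (1 / y₀))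
          ≤ Real.exp (-(4 * (1 / y₀))) * Real.exp (2 * (1 / y₀)) := by gcongr; linarith
        _ = Real.exp (-(2 * (1 / y₀))) := by rw [← Real.exp_add]; congr 1; ring
        _ ≤ _ := exp_neg_two_mul_le ht0.le ht
    have hr := hrec T₀ p L g hpT₀
    rw [hins] at hr
    rw [hr, hVrec]
    have hsplit : s T₀ L g - 1 / y₀ * s T₀ (L - Real.log y₀) (g - cl p)
        - (1 - 1 / y₀) * siftDensity N T₀ = (s T₀ L g - siftDensity N T₀)
        - 1 / y₀ * (s T₀ (L - Real.log y₀) (g - cl p) - siftDensity N T₀) := by ring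
    rw [hsplit]
    calc |(s T₀ L g - siftDensity N T₀)
        - 1 / y₀ * (s T₀ (L - Real.log y₀) (g - cl p) - siftDensity N T₀)|
        ≤ |s T₀ L g - siftDensity N T₀|
          + 1 / y₀ * |s T₀ (L - Real.log y₀) (g - cl p) - siftDensity N T₀| := by
          refine (abs_sub _ _).trans ?_
          rw [abs_mul, abs_of_pos ht0]
      _ ≤ siftDensity N T₀ * (Q * Real.exp (-(L * lam0)))
          + 1 / y₀ * (siftDensity N T₀ * (Q * (2 * Real.exp (-(L * lam0))))) := by
          refine add_le_add ih1 (mul_le_mul_of_nonneg_left (ih2.trans ?_) ht0.le)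
          gcongr
      _ = siftDensity N T₀ * Q * Real.exp (-(L * lam0)) * (1 + 2 * (1 / y₀)) := by ring
      _ ≤ siftDensity N T₀ * Q * (Real.exp (-(L * lam)) * Real.exp (-(4 * (1 / y₀))))
            * (1 + 2 * (1 / y₀)) := by gcongr
      _ = siftDensity N T₀ * Q * Real.exp (-(L * lam)) *
            (Real.exp (-(4 * (1 / y₀))) * (1 + 2 * (1 / y₀))) := by ring
      _ ≤ siftDensity N T₀ * Q * Real.exp (-(L * lam)) * (1 - 1 / y₀) := by gcongr
      _ = _ := by ring
  · -- few primes can be removed: compare with a much smaller sifting range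
    have hQe : 4 * Real.exp (10 * Ct) * Real.exp (-(4 * Ct)) ≤ Q * Real.exp (-(L * lam)) := by
      have : L * lam ≤ 1 / 10 * β + 4 * Ct := by
        calc L * lam ≤ (β * Real.log y₀) * lam := by gcongr
          _ = β * (lam * Real.log y₀) := by ring
          _ ≤ β * (1 / 10 + 4 / β * Ct) := by gcongr
          _ = _ := by field_simp
      have h1 : Real.exp (-(1 / 10 * β + 4 * Ct)) ≤ Real.exp (-(L * lam)) := by gcongr
      calc _ = Q * Real.exp (-(1 / 10 * β + 4 * Ct)) := by
            rw [hQ, mul_assoc, mul_assoc, ← Real.exp_add, ← Real.exp_add]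
            congr 2; rw [hβ]; ring
        _ ≤ _ := by gcongr
    have hQe' : 4 * Real.exp (6 * Ct) ≤ Q * Real.exp (-(L * lam)) := by
      refine le_trans (le_of_eq ?_) hQe
      rw [mul_assoc, ← Real.exp_add]; congr 2; ring
    have key : s T L g ≤ siftDensity N T * (Q * Real.exp (-(L * lam))) := by
      rcases lt_or_ge y₀ 8 with h8 | h8
      · have h1 : s T L g ≤ s ∅ L g := hsmono _ _ _ _ (Finset.empty_subset _)
        have h2 := (abs_le.1 (hbase L g hL0)).2
        have h3 : Real.exp (-(L / 2)) ≤ 1 := Real.exp_le_one_iff.2 (by linarith)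
        have h4 : siftDensity N ∅ ≤ Real.exp (2 * (3 * Ct)) * siftDensity N T := by
          refine siftDensity_le_exp_mul hN (Finset.empty_subset _) ?_
          have h5 := sum_one_div_le_of_tail hN hCt (T \ ∅) (v := 2) (y := 8) le_rfl
            (fun q hq => ⟨hN q, (hpmax q (by simpa using hq)).trans h8.le⟩) (by norm_num)
          refine h5.trans (le_of_eq ?_)
          rw [show (8 : ℝ) = 2 ^ 3 by norm_num, Real.log_pow]
          field_simp
          ring
        have h5 : siftDensity N ∅ = 1 := by simp [siftDensity]
        rw [h5] at h4
        have h6 : Real.exp (2 * (3 * Ct)) = Real.exp (6 * Ct) := by congr 1; ring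
        rw [h6] at h4
        calc s T L g ≤ 4 * (Real.exp (6 * Ct) * siftDensity N T) := by linarith
          _ = siftDensity N T * (4 * Real.exp (6 * Ct)) := by ring
          _ ≤ _ := by gcongr
      · set w : ℝ := y₀ ^ (1 / 3 : ℝ) with hw
        have hw2 : 2 ≤ w := by
          calc (2 : ℝ) = (8 : ℝ) ^ (1 / 3 : ℝ) := by
                rw [show (8 : ℝ) = 2 ^ (3 : ℝ) by norm_num, ← Real.rpow_mul (by norm_num)]
                norm_num
            _ ≤ w := Real.rpow_le_rpow (by norm_num) h8 (by norm_num)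
        have hlw : Real.log w = Real.log y₀ / 3 := by
          rw [hw, Real.log_rpow (by linarith)]; ring
        have hwy : w ≤ y₀ := by
          calc w ≤ y₀ ^ (1 : ℝ) := Real.rpow_le_rpow_of_exponent_le (by linarith) (by norm_num)
            _ = y₀ := Real.rpow_one _
        set Tw : Finset P := (hfin w).toFinset with hTw
        have hTwT : Tw ⊆ T₀ := fun q hq => by
          have : N q < w := by simpa [hTw] using hq
          exact hT₀1 q (by linarith)
        have ih3 := ih Tw.card ((Finset.card_le_card hTwT).trans_lt hcard) Tw
          (hTwT.trans hT₀U) w hw2 (fun q hq => by simpa [hTw] using hq)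
          (fun q hq => by
            have : N q < w := by simpa [hTw] using hq
            exact this.le) L g (by
              rw [hlw]
              refine le_trans ?_ hL'
              have : 0 ≤ (4 + 50 * Ct) * Real.log y₀ := by positivity
              linarith) rfl
        have h1 : s T L g ≤ s Tw L g :=
          hsmono _ _ _ _ (hTwT.trans (Finset.erase_subset _ _))
        have h2 := (abs_le.1 ih3).2
        have hVw := siftDensity_pos hN Tw
        have h4 : siftDensity N Tw ≤ Real.exp (2 * (3 * Ct)) * siftDensity N T := by
          refine siftDensity_le_exp_mul hN (hTwT.trans (Finset.erase_subset _ _)) ?_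
          have h5 := sum_one_div_le_of_tail hN hCt (T \ Tw) (v := w) (y := y₀) hw2
            (fun q hq => ⟨by
              by_contra h
              exact (Finset.mem_sdiff.1 hq).2 (by simpa [hTw] using h),
              hpmax q (Finset.mem_sdiff.1 hq).1⟩) (by linarith)
          refine h5.trans (le_of_eq ?_)
          rw [hlw]
          field_simp
        have h6 : Real.exp (2 * (3 * Ct)) = Real.exp (6 * Ct) := by congr 1; ring
        rw [h6] at h4
        have h7 : Real.exp (-(L * (1 / 10 / Real.log w + 4 / β * logTail N U Tw)))
            ≤ Real.exp (-(3 / 10 * (β - 1))) := by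
          refine Real.exp_le_exp.2 (neg_le_neg ?_)
          have := logTail_nonneg hN U Tw
          calc 3 / 10 * (β - 1) = ((4 + 50 * Ct) * Real.log y₀) * (1 / 10 / Real.log w) := by
                rw [hlw, hβ]; field_simp; ring
            _ ≤ L * (1 / 10 / Real.log w) :=
                mul_le_mul_of_nonneg_right hL' (by rw [hlw]; positivity)
            _ ≤ _ := by
                gcongr
                nlinarith [mul_nonneg hb0.le this]
        have h8' : Real.exp (6 * Ct) * (Q * Real.exp (-(3 / 10 * (β - 1)))) ≤
            1 / 2 * (Q * Real.exp (-(L * lam))) := by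
          have h9 : L * lam ≤ 1 / 10 * β + 4 * Ct := by
            calc L * lam ≤ (β * Real.log y₀) * lam := by gcongr
              _ = β * (lam * Real.log y₀) := by ring
              _ ≤ β * (1 / 10 + 4 / β * Ct) := by gcongr
              _ = _ := by field_simp
          have h10 : Real.exp (6 * Ct) * Real.exp (-(3 / 10 * (β - 1))) * 2
              ≤ Real.exp (-(L * lam)) := by
            calc _ = Real.exp (6 * Ct) * Real.exp (-(3 / 10 * (β - 1))) * Real.exp (Real.log 2) := by
                  rw [Real.exp_log (by norm_num)]
              _ = Real.exp (6 * Ct + -(3 / 10 * (β - 1)) + Real.log 2) := by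
                  rw [Real.exp_add, Real.exp_add]
              _ ≤ _ := by
                  gcongr
                  rw [hβ] at h9 ⊢
                  linarith
          calc Real.exp (6 * Ct) * (Q * Real.exp (-(3 / 10 * (β - 1))))
              = 1 / 2 * (Q * (Real.exp (6 * Ct) * Real.exp (-(3 / 10 * (β - 1))) * 2)) := by ring
            _ ≤ _ := by gcongr
        calc s T L g ≤ siftDensity N Tw * (1 + Q * Real.exp (-(3 / 10 * (β - 1)))) := by
              have : siftDensity N Tw * (Q *
                Real.exp (-(L * (1 / 10 / Real.log w + 4 / β * logTail N U Tw)))) ≤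
                siftDensity N Tw * (Q * Real.exp (-(3 / 10 * (β - 1)))) := by gcongr
              linarith
          _ ≤ (Real.exp (6 * Ct) * siftDensity N T) *
              (1 + Q * Real.exp (-(3 / 10 * (β - 1)))) := by gcongr
          _ = siftDensity N T * (Real.exp (6 * Ct) +
              Real.exp (6 * Ct) * (Q * Real.exp (-(3 / 10 * (β - 1))))) := by ring
          _ ≤ _ := by
              gcongr
              linarith [Real.exp_pos (6 * Ct)]
    have h1 : 1 ≤ Q * Real.exp (-(L * lam)) := by
      have := Real.one_le_exp (show 0 ≤ 6 * Ct by positivity)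
      linarith
    rw [abs_le]
    constructor
    · have := hs0 T L g
      nlinarith
    · linarith

open MeasureTheory Set in
/-- Partial summation against a counting function, in integral form. -/
lemma abs_tsum_sub_integral_le {ι : Type} (W : ι → ℝ) (hW : ∀ i, 1 ≤ W i)
    (hfin : ∀ u, {i | W i ≤ u}.Finite) (φ Φ M E : ℝ → ℝ) (hφm : Measurable φ)
    (hφ0 : ∀ u, 1 ≤ u → 0 ≤ φ u) (hφ : IntegrableOn φ (Ioi 1))
    (hΦ : ∀ w, 1 ≤ w → ∫ u in Ioi w, φ u = Φ w)
    (hn : ∀ u, 1 ≤ u → |(({i | W i ≤ u}.ncard : ℕ) : ℝ) - M u| ≤ E u)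
    (hM : IntegrableOn (fun u => φ u * M u) (Ioi 1))
    (hE : IntegrableOn (fun u => φ u * E u) (Ioi 1)) :
    Summable (fun i => Φ (W i)) ∧
      |∑' i, Φ (W i) - ∫ u in Ioi 1, φ u * M u| ≤ ∫ u in Ioi 1, φ u * E u := by
  have hcount : Countable ι := by
    have : (⋃ n : ℕ, {i | W i ≤ n}).Countable := Set.countable_iUnion fun n => (hfin n).countable
    have h2 : (⋃ n : ℕ, {i | W i ≤ n}) = Set.univ := by
      ext i
      simp only [Set.mem_iUnion, Set.mem_ofPred_eq, Set.mem_univ, iff_true]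
      exact exists_nat_ge (W i)
    rw [h2] at this
    exact Set.countable_univ_iff.1 this
  set n : ℝ → ℝ := fun u => (({i | W i ≤ u}.ncard : ℕ) : ℝ) with hndef
  have hnmono : Monotone n := fun a b hab => by
    simp only [hndef]
    exact_mod_cast Set.ncard_le_ncard (fun i (hi : W i ≤ a) => le_trans hi hab) (hfin b)
  set F : ι → ℝ → ℝ := fun i => (Ici (W i)).indicator φ with hF
  have hF0 : ∀ i u, 1 ≤ u → 0 ≤ F i u := fun i u hu => by
    simp only [hF, Set.indicator]
    split_ifs
    · exact hφ0 u hu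
    · exact le_rfl
  have hFint : ∀ i, Integrable (F i) (volume.restrict (Ioi 1)) := fun i =>
    hφ.indicator measurableSet_Ici
  have hFval : ∀ i, ∫ u in Ioi 1, F i u = Φ (W i) := fun i => by
    rw [← hΦ _ (hW i), integral_indicator measurableSet_Ici, Measure.restrict_restrict
      measurableSet_Ici, ← integral_Ici_eq_integral_Ioi]
    rw [Measure.restrict_congr_set (s := Ici (W i) ∩ Ioi 1) (t := Ici (W i))]
    have h1 : (Ici (W i) ∩ Ioi 1 : Set ℝ) =ᵐ[volume] (Ici (W i) ∩ Ici 1 : Set ℝ) :=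
      (ae_eq_refl _).inter Ioi_ae_eq_Ici
    have h2 : (Ici (W i) ∩ Ici 1 : Set ℝ) = Ici (W i) :=
      Set.inter_eq_left.2 (Set.Ici_subset_Ici.2 (hW i))
    rwa [h2] at h1
  have hsumF : ∀ (s : Finset ι) u, 1 ≤ u → ∑ i ∈ s, F i u ≤ n u * φ u := fun s u hu => by
    have : ∑ i ∈ s, F i u = ((s.filter fun i => W i ≤ u).card : ℝ) * φ u := by
      rw [← nsmul_eq_mul, ← Finset.sum_const, Finset.sum_filter]
      rfl
    rw [this]
    refine mul_le_mul_of_nonneg_right ?_ (hφ0 u hu)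
    simp only [hndef]
    rw [← Set.ncard_coe_finset]
    refine Nat.cast_le.2 (Set.ncard_le_ncard (fun i hi => ?_) (hfin u))
    simpa using (Finset.mem_filter.1 (Finset.mem_coe.1 hi)).2
  have htsumF : ∀ u, ∑' i, F i u = n u * φ u := fun u => by
    rw [tsum_eq_sum (s := (hfin u).toFinset)]
    · have : ∀ i ∈ (hfin u).toFinset, F i u = φ u := fun i hi => by
        have : W i ≤ u := by simpa using hi
        simp [hF, this]
      rw [Finset.sum_congr rfl this, Finset.sum_const, nsmul_eq_mul]
      simp only [hndef]
      rw [Set.ncard_eq_toFinset_card _ (hfin u)]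
    · intro i hi
      have : ¬ W i ≤ u := by simpa using hi
      simp [hF, this]
  have hnle : ∀ u, 1 ≤ u → n u * φ u ≤ φ u * M u + φ u * E u := fun u hu => by
    have := (abs_le.1 (hn u hu)).2
    have h0 := hφ0 u hu
    simp only [hndef]
    nlinarith
  have hae : ∀ {p : ℝ → Prop}, (∀ u, 1 ≤ u → p u) → ∀ᵐ u ∂(volume.restrict (Ioi (1 : ℝ))), p u :=
    fun h => (ae_restrict_iff' measurableSet_Ioi).2 (Filter.Eventually.of_forall
      fun u hu => h u (le_of_lt hu))
  have hΦ0 : ∀ i, 0 ≤ Φ (W i) := fun i => by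
    rw [← hFval]
    exact integral_nonneg_of_ae (hae fun u hu => hF0 i u hu)
  have hsum : Summable (fun i => Φ (W i)) := by
    refine summable_of_sum_le (c := ∫ u in Ioi 1, (φ u * M u + φ u * E u)) hΦ0 fun s => ?_
    simp_rw [← hFval]
    rw [← integral_finsetSum _ fun i _ => hFint i]
    refine integral_mono_ae (integrable_finsetSum _ fun i _ => hFint i) (hM.add hE)
      (hae fun u hu => ?_)
    exact (hsumF s u hu).trans (hnle u hu)
  refine ⟨hsum, ?_⟩
  have hnint : Integrable (fun u => n u * φ u) (volume.restrict (Ioi 1)) := by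
    refine Integrable.mono' (hM.add hE) (hnmono.measurable.mul hφm).aestronglyMeasurable
      (hae fun u hu => ?_)
    rw [Real.norm_eq_abs, abs_of_nonneg (mul_nonneg (Nat.cast_nonneg _) (hφ0 u hu))]
    exact hnle u hu
  have hs := hasSum_integral_of_summable_integral_norm hFint (by
    refine hsum.congr fun i => ?_
    rw [← hFval]
    refine integral_congr_ae (hae fun u hu => ?_)
    show F i u = ‖F i u‖
    rw [Real.norm_eq_abs, abs_of_nonneg (hF0 i u hu)])
  simp_rw [hFval, htsumF] at hs
  rw [hs.tsum_eq, ← integral_sub hnint hM, ← Real.norm_eq_abs]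
  refine norm_integral_le_of_norm_le hE (hae fun u hu => ?_)
  rw [mul_comm (n u), ← mul_sub, Real.norm_eq_abs, abs_mul, abs_of_nonneg (hφ0 u hu)]
  exact mul_le_mul_of_nonneg_left (hn u hu) (hφ0 u hu)

open MeasureTheory Set Filter Topology in
lemma integral_exp_linear (lam a w : ℝ) (ha : 0 < a) :
    IntegrableOn (fun u => (lam * u - 1) * Real.exp (-(a * u))) (Ioi w) ∧
    ∫ u in Ioi w, (lam * u - 1) * Real.exp (-(a * u)) =
      Real.exp (-(a * w)) * (lam * (w / a + 1 / a ^ 2) - 1 / a) := by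
  have hlim0 : Tendsto (fun u : ℝ => Real.exp (-(a * u))) atTop (𝓝 0) :=
    Real.tendsto_exp_neg_atTop_nhds_zero.comp (tendsto_id.const_mul_atTop ha)
  have hlim1 : Tendsto (fun u : ℝ => u * Real.exp (-(a * u))) atTop (𝓝 0) := by
    have h := (Real.tendsto_pow_mul_exp_neg_atTop_nhds_zero 1).comp (tendsto_id.const_mul_atTop ha)
    have h2 := h.const_mul (1 / a)
    rw [mul_zero] at h2
    refine h2.congr fun u => ?_
    simp only [Function.comp, pow_one, id]
    field_simp
  have hd : ∀ u : ℝ, HasDerivAt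
      (fun u => -(Real.exp (-(a * u)) * (lam * (u / a + 1 / a ^ 2) - 1 / a)))
      ((lam * u - 1) * Real.exp (-(a * u))) u := by
    intro u
    have h1 : HasDerivAt (fun u : ℝ => Real.exp (-(a * u))) (Real.exp (-(a * u)) * (-(a * 1))) u :=
      (((hasDerivAt_id u).const_mul a).neg).exp
    have h2 : HasDerivAt (fun u : ℝ => lam * (u / a + 1 / a ^ 2) - 1 / a) (lam * (1 / a)) u :=
      ((((hasDerivAt_id u).div_const a).add_const _).const_mul lam).sub_const _
    refine (h1.mul h2).neg.congr_deriv ?_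
    field_simp
    ring
  have hlim : Tendsto (fun u => -(Real.exp (-(a * u)) * (lam * (u / a + 1 / a ^ 2) - 1 / a)))
      atTop (𝓝 0) := by
    have h := (hlim1.const_mul (-(lam / a))).add (hlim0.const_mul (-(lam / a ^ 2 - 1 / a)))
    rw [mul_zero, mul_zero, add_zero] at h
    refine h.congr fun u => ?_
    ring
  have e0 : IntegrableOn (fun u => Real.exp (-(a * u))) (Ioi w) := by
    simpa [neg_mul] using integrableOn_exp_mul_Ioi (neg_lt_zero.2 ha) w
  have hInt : IntegrableOn (fun u => (lam * u - 1) * Real.exp (-(a * u))) (Ioi w) := by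
    have h2 : IntegrableOn (fun u => u * Real.exp (-(a * u))) (Ioi w) := by
      refine integrable_of_isBigO_exp_neg (b := a / 2) (by positivity) (by fun_prop) ?_
      have hb : Tendsto (fun u : ℝ => u * Real.exp (-(a / 2 * u))) atTop (𝓝 0) := by
        have h := (Real.tendsto_pow_mul_exp_neg_atTop_nhds_zero 1).comp
          (tendsto_id.const_mul_atTop (half_pos ha))
        have h2 := h.const_mul (1 / (a / 2))
        rw [mul_zero] at h2
        refine h2.congr fun u => ?_
        simp only [Function.comp, pow_one, id]
        field_simp
      have h3 := (hb.isBigO_one ℝ).mul (Asymptotics.isBigO_refl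
        (fun u : ℝ => Real.exp (-(a / 2) * u)) atTop)
      refine (h3.congr (fun u => ?_) fun u => ?_)
      · rw [mul_assoc, ← Real.exp_add]; congr 2; ring
      · simp
    refine Integrable.congr ((Integrable.const_mul h2 lam).sub e0)
      (Filter.Eventually.of_forall fun u => ?_)
    simp only [Pi.sub_apply]
    ring
  refine ⟨hInt, ?_⟩
  rw [integral_Ioi_of_hasDerivAt_of_tendsto (m := 0)
    (hd w).continuousAt.continuousWithinAt (fun u _ => hd u) hInt hlim]
  ring

open MeasureTheory Set in
lemma integral_exp_const (lam a w : ℝ) (ha : 0 < a) :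
    IntegrableOn (fun u => lam * Real.exp (-(a * u))) (Ioi w) ∧
    ∫ u in Ioi w, lam * Real.exp (-(a * u)) = lam * (Real.exp (-(a * w)) / a) := by
  constructor
  · have : IntegrableOn (fun u => Real.exp (-(a * u))) (Ioi w) := by
      simpa [neg_mul] using integrableOn_exp_mul_Ioi (neg_lt_zero.2 ha) w
    exact Integrable.const_mul this lam
  · rw [integral_const_mul]
    have := integral_exp_mul_Ioi (neg_lt_zero.2 ha) w
    simp only [neg_mul, neg_div_neg_eq] at this
    rw [this]

open MeasureTheory Set in
lemma tsum_exp_estimates {ι : Type} (W : ι → ℝ) (hW : ∀ i, 1 ≤ W i)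
    (hfin : ∀ u, {i | W i ≤ u}.Finite) {l v C α : ℝ} (hl : 1 ≤ l) (hv : 0 < v) (hC : 0 ≤ C)
    (hα : 0 < α)
    (hn : ∀ u, 1 ≤ u → |(({i | W i ≤ u}.ncard : ℕ) : ℝ) - v * Real.exp (l * u)|
      ≤ C * v * Real.exp ((l - α) * u)) {s : ℝ} (hs : 0 < s) :
    Summable (fun i => Real.exp (-((l + s) * W i))) ∧
    Summable (fun i => W i * Real.exp (-((l + s) * W i))) ∧
    |∑' i, Real.exp (-((l + s) * W i)) - v * (l + s) / s| ≤ v * (l + s) * (1 + C / α) ∧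
    |∑' i, W i * Real.exp (-((l + s) * W i)) - v * ((l + s) / s ^ 2 - 1 / s)| ≤
      v * (l + s) * (2 + C * (1 / α + 1 / α ^ 2)) := by
  set lam := l + s with hlam
  have hlam1 : 1 ≤ lam := by linarith
  have hlam0 : 0 < lam := by linarith
  have hsα : 0 < s + α := by linarith
  have hexp1 : Real.exp (-(s + α)) ≤ 1 := Real.exp_le_one_iff.2 (by linarith)
  have hes : Real.exp (-s) ≤ 1 := Real.exp_le_one_iff.2 (by linarith)
  have hes' : 1 - s ≤ Real.exp (-s) := by linarith [Real.add_one_le_exp (-s)]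
  have hs2 : 0 < s ^ 2 := by positivity
  have m0 : ∀ u, lam * Real.exp (-(lam * u)) * (v * Real.exp (l * u)) =
      (v * lam) * Real.exp (-(s * u)) := fun u => by
    have : Real.exp (-(s * u)) = Real.exp (-(lam * u)) * Real.exp (l * u) := by
      rw [← Real.exp_add]; congr 1; rw [hlam]; ring
    rw [this]; ring
  have m1 : ∀ u, lam * Real.exp (-(lam * u)) * (C * v * Real.exp ((l - α) * u)) =
      (C * v * lam) * Real.exp (-((s + α) * u)) := fun u => by
    have : Real.exp (-((s + α) * u)) = Real.exp (-(lam * u)) * Real.exp ((l - α) * u) := by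
      rw [← Real.exp_add]; congr 1; rw [hlam]; ring
    rw [this]; ring
  have m2 : ∀ u, (lam * u - 1) * Real.exp (-(lam * u)) * (v * Real.exp (l * u)) =
      v * ((lam * u - 1) * Real.exp (-(s * u))) := fun u => by
    have : Real.exp (-(s * u)) = Real.exp (-(lam * u)) * Real.exp (l * u) := by
      rw [← Real.exp_add]; congr 1; rw [hlam]; ring
    rw [this]; ring
  have m3 : ∀ u, (lam * u - 1) * Real.exp (-(lam * u)) * (C * v * Real.exp ((l - α) * u)) =
      (C * v) * ((lam * u - 1) * Real.exp (-((s + α) * u))) := fun u => by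
    have : Real.exp (-((s + α) * u)) = Real.exp (-(lam * u)) * Real.exp ((l - α) * u) := by
      rw [← Real.exp_add]; congr 1; rw [hlam]; ring
    rw [this]; ring
  obtain ⟨A1, A2⟩ := abs_tsum_sub_integral_le W hW hfin (fun u => lam * Real.exp (-(lam * u)))
    (fun w => Real.exp (-(lam * w))) (fun u => v * Real.exp (l * u))
    (fun u => C * v * Real.exp ((l - α) * u)) (by fun_prop) (fun u _ => by positivity)
    (integral_exp_const lam lam 1 hlam0).1
    (fun w _ => by rw [(integral_exp_const lam lam w hlam0).2]; field_simp) hn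
    (by simp_rw [m0]; exact (integral_exp_const _ s 1 hs).1)
    (by simp_rw [m1]; exact (integral_exp_const _ _ 1 hsα).1)
  obtain ⟨B1, B2⟩ := abs_tsum_sub_integral_le W hW hfin
    (fun u => (lam * u - 1) * Real.exp (-(lam * u)))
    (fun w => w * Real.exp (-(lam * w))) (fun u => v * Real.exp (l * u))
    (fun u => C * v * Real.exp ((l - α) * u)) (by fun_prop)
    (fun u hu => mul_nonneg (by nlinarith) (Real.exp_pos _).le)
    (integral_exp_linear lam lam 1 hlam0).1
    (fun w _ => by rw [(integral_exp_linear lam lam w hlam0).2]; field_simp; ring) hn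
    (by simp_rw [m2]; exact (integral_exp_linear _ s 1 hs).1.const_mul v)
    (by simp_rw [m3]; exact (integral_exp_linear _ _ 1 hsα).1.const_mul _)
  refine ⟨A1, B1, ?_, ?_⟩
  · simp_rw [m0, m1, (integral_exp_const _ s 1 hs).2, (integral_exp_const _ _ 1 hsα).2,
      mul_one] at A2
    have h1 : |v * lam * (Real.exp (-s) / s) - v * lam / s| ≤ v * lam := by
      have : v * lam * (Real.exp (-s) / s) - v * lam / s = v * lam * ((Real.exp (-s) - 1) / s) := by
        ring
      rw [this, abs_mul, abs_of_pos (by positivity : 0 < v * lam)]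
      refine mul_le_of_le_one_right (by positivity) ?_
      rw [abs_le, le_div_iff₀ hs, div_le_iff₀ hs]
      constructor <;> linarith
    have h2 : C * v * lam * (Real.exp (-(s + α)) / (s + α)) ≤ v * lam * (C / α) := by
      calc _ ≤ C * v * lam * (1 / α) := by gcongr; linarith
        _ = _ := by ring
    calc _ ≤ _ + _ := abs_sub_le _ (v * lam * (Real.exp (-s) / s)) _
      _ ≤ v * lam * (C / α) + v * lam := add_le_add (A2.trans h2) h1
      _ = _ := by ring
  · simp_rw [m2, m3, integral_const_mul, (integral_exp_linear _ s 1 hs).2,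
      (integral_exp_linear _ _ 1 hsα).2, mul_one] at B2
    have h1 : |v * (Real.exp (-s) * (lam * (1 / s + 1 / s ^ 2) - 1 / s)) -
        v * (lam / s ^ 2 - 1 / s)| ≤ v * lam * 2 := by
      have e : v * (Real.exp (-s) * (lam * (1 / s + 1 / s ^ 2) - 1 / s)) -
        v * (lam / s ^ 2 - 1 / s) = v * (lam * ((Real.exp (-s) * (1 + s) - 1) / s ^ 2) +
          (1 - Real.exp (-s)) / s) := by
        field_simp; ring
      have b1 : |(Real.exp (-s) * (1 + s) - 1) / s ^ 2| ≤ 1 := by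
        have h3 : Real.exp (-s) * (1 + s) ≤ 1 := by
          rw [Real.exp_neg, inv_mul_le_one₀ (Real.exp_pos _)]
          linarith [Real.add_one_le_exp s]
        rw [abs_le, le_div_iff₀ hs2, div_le_iff₀ hs2]
        constructor <;> nlinarith
      have b2 : |(1 - Real.exp (-s)) / s| ≤ 1 := by
        rw [abs_le, le_div_iff₀ hs, div_le_iff₀ hs]
        constructor <;> linarith
      rw [e, abs_mul, abs_of_pos hv, mul_assoc]
      refine mul_le_mul_of_nonneg_left ?_ hv.le
      refine (abs_add_le _ _).trans ?_
      rw [abs_mul, abs_of_pos hlam0]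
      nlinarith
    have h2 : C * v * (Real.exp (-(s + α)) * (lam * (1 / (s + α) + 1 / (s + α) ^ 2) -
        1 / (s + α))) ≤ v * lam * (C * (1 / α + 1 / α ^ 2)) := by
      have : Real.exp (-(s + α)) * (lam * (1 / (s + α) + 1 / (s + α) ^ 2) - 1 / (s + α)) ≤
          1 * (lam * (1 / α + 1 / α ^ 2)) := by
        have p1 : 1 / (s + α) ≤ 1 / α := by gcongr; linarith
        have p2 : 1 / (s + α) ^ 2 ≤ 1 / α ^ 2 := by gcongr; linarith
        have p3 : 0 < 1 / (s + α) := by positivity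
        have p4 : 0 < 1 / (s + α) ^ 2 := by positivity
        refine mul_le_mul hexp1 ?_ ?_ zero_le_one
        · nlinarith
        · nlinarith
      calc _ ≤ C * v * (1 * (lam * (1 / α + 1 / α ^ 2))) := by gcongr
        _ = _ := by ring
    calc _ ≤ _ + _ := abs_sub_le _ _ _
      _ ≤ v * lam * (C * (1 / α + 1 / α ^ 2)) + v * lam * 2 := add_le_add (B2.trans h2) h1
      _ = _ := by ring

/-- The completely multiplicative extension of `f` restricted to multisets avoiding `T`. -/
noncomputable def siftedProd {P : Type} (f : P → ℂ) (T : Finset P) (m : Multiset P) : ℂ :=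
  if ∀ p ∈ T, p ∉ m then (m.map f).prod else 0

lemma norm_siftedProd_le {P : Type} (f : P → ℂ) (T : Finset P) (m : Multiset P) :
    ‖siftedProd f T m‖ ≤ ‖(m.map f).prod‖ := by
  unfold siftedProd
  split_ifs
  · exact le_rfl
  · simp

lemma summable_siftedProd {P : Type} {f : P → ℂ}
    (hf : Summable fun m : Multiset P => ‖(m.map f).prod‖) (T : Finset P) :
    Summable (siftedProd f T) :=
  Summable.of_norm_bounded hf (norm_siftedProd_le f T)

lemma tsum_siftedProd {P : Type} {f : P → ℂ}
    (hf : Summable fun m : Multiset P => ‖(m.map f).prod‖) (T : Finset P) :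
    ∑' m, siftedProd f T m = (∏ p ∈ T, (1 - f p)) * ∑' m : Multiset P, (m.map f).prod := by
  induction T using Finset.induction_on with
  | empty => simp [siftedProd]
  | insert p T hp ih =>
    rw [Finset.prod_insert hp, mul_assoc, ← ih, sub_mul, one_mul, eq_sub_iff_add_eq]
    have hinj : Function.Injective (fun m : Multiset P => p ::ₘ m) :=
      fun _ _ h => Multiset.cons_inj_right p |>.1 h
    have h1 : ∀ m, siftedProd f T (p ::ₘ m) - siftedProd f (insert p T) (p ::ₘ m)
        = f p * siftedProd f T m := by
      intro m
      have e1 : siftedProd f (insert p T) (p ::ₘ m) = 0 := by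
        unfold siftedProd
        rw [if_neg]
        push Not
        exact ⟨p, Finset.mem_insert_self _ _, Multiset.mem_cons_self _ _⟩
      rw [e1, sub_zero]
      unfold siftedProd
      have e2 : (∀ q ∈ T, q ∉ p ::ₘ m) ↔ ∀ q ∈ T, q ∉ m := by
        refine forall₂_congr fun q hq => ?_
        have : q ≠ p := fun h => hp (h ▸ hq)
        simp [this]
      simp only [e2, Multiset.map_cons, Multiset.prod_cons, mul_ite, mul_zero]
    have h2 : ∑' m, (siftedProd f T m - siftedProd f (insert p T) m) =
        f p * ∑' m, siftedProd f T m := by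
      rw [← tsum_mul_left, ← hinj.tsum_eq (f := fun m => siftedProd f T m -
        siftedProd f (insert p T) m)]
      · exact tsum_congr h1
      · intro m hm
        by_contra hmp
        refine hm ?_
        have hpm : p ∉ m := fun h => hmp ⟨m.erase p, Multiset.cons_erase h⟩
        unfold siftedProd
        simp [hpm]
    rw [← h2, (summable_siftedProd hf T).tsum_sub (summable_siftedProd hf _)]
    ring

open Filter Topology in
lemma tendsto_prod_mul_tsum {P : Type} {f : P → ℂ}
    (hf : Summable fun m : Multiset P => ‖(m.map f).prod‖) :
    Tendsto (fun T : Finset P => (∏ p ∈ T, (1 - f p)) * ∑' m : Multiset P, (m.map f).prod)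
      atTop (𝓝 1) := by
  simp_rw [← tsum_siftedProd hf]
  have h : ∑' m : Multiset P, (if m = 0 then (1 : ℂ) else 0) = 1 := by
    rw [tsum_ite_eq]
  rw [← h]
  refine tendsto_tsum_of_dominated_convergence hf (fun m => ?_)
    (Eventually.of_forall fun T m => norm_siftedProd_le f T m)
  rcases eq_or_ne m 0 with rfl | hm
  · refine tendsto_const_nhds.congr fun T => ?_
    simp [siftedProd]
  · obtain ⟨p, hp⟩ := Multiset.exists_mem_of_ne_zero hm
    refine tendsto_const_nhds.congr' ?_
    filter_upwards [eventually_ge_atTop {p}] with T hT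
    rw [if_neg hm]
    unfold siftedProd
    rw [if_neg]
    push Not
    exact ⟨p, hT (Finset.mem_singleton_self p), hp⟩

lemma hasSum_count_mul {P : Type} (w : P → ℝ) (m : Multiset P) (c : ℂ) :
    HasSum (fun q : P × ℕ => if q.2 < m.count q.1 then (w q.1 : ℂ) * c else 0)
      (((m.map w).sum : ℝ) * c) := by
  set S : Finset (P × ℕ) := m.toFinset.sigma (fun p => Finset.range (m.count p)) |>.map
    (Equiv.sigmaEquivProd P ℕ).toEmbedding with hS
  have h := hasSum_sum_of_ne_finset_zero (L := .unconditional _) (s := S)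
    (f := fun q : P × ℕ => if q.2 < m.count q.1 then (w q.1 : ℂ) * c else 0) (by
      rintro ⟨p, k⟩ hq
      rw [if_neg]
      intro hlt
      refine hq ?_
      simp only [hS, Finset.mem_map_equiv, Finset.mem_sigma, Multiset.mem_toFinset,
        Finset.mem_range]
      exact ⟨Multiset.count_pos.1 (Nat.zero_lt_of_lt hlt), hlt⟩)
  convert h using 1
  rw [hS, Finset.sum_map, Finset.sum_sigma, Finset.sum_multiset_map_count]
  push_cast
  rw [Finset.sum_mul]
  refine Finset.sum_congr rfl fun p _ => ?_
  have : ∀ k ∈ Finset.range (m.count p), (if k < m.count p then (w p : ℂ) * c else 0)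
      = (w p : ℂ) * c := fun k hk => if_pos (Finset.mem_range.1 hk)
  simp only [Equiv.coe_toEmbedding, Equiv.sigmaEquivProd_apply]
  rw [Finset.sum_congr rfl this, Finset.sum_const, Finset.card_range]
  simp [mul_assoc]

lemma summable_prime_powers {P : Type} {f : P → ℂ} {w : P → ℝ} (hw : ∀ p, 0 ≤ w p)
    (hf : Summable fun m : Multiset P => (m.map w).sum * ‖(m.map f).prod‖) :
    Summable fun q : P × ℕ => w q.1 * ‖f q.1‖ ^ (q.2 + 1) := by
  have hinj : Function.Injective (fun q : P × ℕ => Multiset.replicate (q.2 + 1) q.1) := by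
    rintro ⟨p, k⟩ ⟨q, l⟩ h
    have h1 : k = l := by simpa using congrArg Multiset.card h
    have h2 : p ∈ Multiset.replicate (l + 1) q := by
      have h3 : p ∈ Multiset.replicate (k + 1) p := Multiset.mem_replicate.2 ⟨by omega, rfl⟩
      exact (show Multiset.replicate (k + 1) p = Multiset.replicate (l + 1) q from h) ▸ h3
    rw [h1, Multiset.eq_of_mem_replicate h2]
  refine Summable.of_nonneg_of_le (fun q => mul_nonneg (hw _) (by positivity)) (fun q => ?_)
    (hf.comp_injective hinj)
  simp only [Function.comp, Multiset.map_replicate, Multiset.sum_replicate,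
    Multiset.prod_replicate, norm_pow, nsmul_eq_mul]
  refine mul_le_mul_of_nonneg_right ?_ (by positivity)
  refine le_mul_of_one_le_left (hw _) ?_
  push_cast
  linarith [(Nat.cast_nonneg q.2 : (0 : ℝ) ≤ q.2)]

/-- The logarithmic derivative identity `∑ W(m) f(m) = (∑ w(p) f(p) ^ k) * ∑ f(m)`. -/
lemma tsum_weight_mul {P : Type} {f : P → ℂ} {w : P → ℝ} (hw : ∀ p, 0 ≤ w p)
    (hf : Summable fun m : Multiset P => (m.map w).sum * ‖(m.map f).prod‖) :
    ∑' m : Multiset P, (((m.map w).sum : ℝ) : ℂ) * (m.map f).prod =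
      (∑' q : P × ℕ, (w q.1 : ℂ) * f q.1 ^ (q.2 + 1)) * ∑' m : Multiset P, (m.map f).prod := by
  set H : Multiset P → P × ℕ → ℂ := fun m q =>
    if q.2 < m.count q.1 then (w q.1 : ℂ) * (m.map f).prod else 0 with hH
  have hHs : ∀ m, HasSum (H m) (((m.map w).sum : ℝ) * (m.map f).prod) := fun m =>
    hasSum_count_mul w m _
  have hHn : ∀ m, HasSum (fun q => ‖H m q‖) ((m.map w).sum * ‖(m.map f).prod‖) := fun m => by
    have h := hasSum_count_mul w m (‖(m.map f).prod‖ : ℂ)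
    have e : (fun q : P × ℕ => if q.2 < m.count q.1 then (w q.1 : ℂ) * (‖(m.map f).prod‖ : ℂ)
        else 0) = fun q => ((‖H m q‖ : ℝ) : ℂ) := by
      funext q
      simp only [hH]
      split_ifs
      · rw [norm_mul, Complex.norm_real, Real.norm_eq_abs, abs_of_nonneg (hw _)]
        push_cast
        rfl
      · simp
    rw [e] at h
    exact_mod_cast h
  have hsum : Summable (Function.uncurry H) := by
    refine Summable.of_norm ?_
    rw [summable_prod_of_nonneg fun _ => norm_nonneg _]
    refine ⟨fun m => (hHn m).summable, ?_⟩
    exact hf.congr fun m => (hHn m).tsum_eq.symm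
  calc _ = ∑' m, ∑' q, H m q := tsum_congr fun m => (hHs m).tsum_eq.symm
    _ = ∑' q, ∑' m, H m q := by
        rw [Summable.tsum_comm hsum]
    _ = ∑' q : P × ℕ, ((w q.1 : ℂ) * f q.1 ^ (q.2 + 1)) * ∑' m : Multiset P, (m.map f).prod := by
        refine tsum_congr fun q => ?_
        obtain ⟨p, k⟩ := q
        have hinj : Function.Injective (fun m : Multiset P => m + Multiset.replicate (k + 1) p) :=
          fun _ _ h => add_right_cancel h
        rw [← hinj.tsum_eq (f := fun m => H m (p, k)), ← tsum_mul_left]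
        · refine tsum_congr fun m => ?_
          simp only [hH]
          rw [if_pos (by simp)]
          simp only [Multiset.map_add, Multiset.prod_add, Multiset.map_replicate,
            Multiset.prod_replicate]
          ring
        · intro m hm
          have hk : k < m.count p := by
            by_contra h
            exact hm (if_neg h)
          exact ⟨m - Multiset.replicate (k + 1) p,
            tsub_add_cancel_of_le (Multiset.le_count_iff_replicate_le.1 hk)⟩
    _ = _ := tsum_mul_right

/-- Fourier transform of a real function on a finite abelian group. -/
noncomputable def hatSum {G : Type} [AddCommGroup G] [Fintype G] (f : G → ℝ) (χ : AddChar G ℂ) : ℂ :=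
  ∑ a, (f a : ℂ) * χ a

lemma hatSum_inversion {G : Type} [AddCommGroup G] [Fintype G] (f : G → ℝ) (g : G) :
    ∑ χ : AddChar G ℂ, hatSum f χ * χ (-g) = Fintype.card G * f g := by
  unfold hatSum
  simp_rw [Finset.sum_mul]
  rw [Finset.sum_comm]
  have : ∀ a, ∑ χ : AddChar G ℂ, (f a : ℂ) * χ a * χ (-g) =
      if a = g then (Fintype.card G : ℂ) * f a else 0 := fun a => by
    have h1 : ∀ χ : AddChar G ℂ, (f a : ℂ) * χ a * χ (-g) = f a * χ (a - g) := fun χ => by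
      rw [mul_assoc, ← AddChar.map_add_eq_mul, sub_eq_add_neg]
    simp_rw [h1]
    rw [← Finset.mul_sum, AddChar.sum_apply_eq_ite]
    simp only [sub_eq_zero]
    split_ifs <;> ring
  simp_rw [this]
  simp

lemma sum_norm_hatSum_sq {G : Type} [AddCommGroup G] [Fintype G] (f : G → ℝ) :
    ∑ χ : AddChar G ℂ, ‖hatSum f χ‖ ^ 2 = Fintype.card G * ∑ a, f a ^ 2 := by
  have h : ((∑ χ : AddChar G ℂ, ‖hatSum f χ‖ ^ 2 : ℝ) : ℂ) =
      ((Fintype.card G * ∑ a, f a ^ 2 : ℝ) : ℂ) := by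
    push_cast
    have h1 : ∀ χ : AddChar G ℂ, (‖hatSum f χ‖ : ℂ) ^ 2 =
        ∑ g, (f g : ℂ) * (hatSum f χ * χ (-g)) := fun χ => by
      rw [← Complex.mul_conj']
      nth_rw 2 [hatSum]
      rw [map_sum, Finset.mul_sum]
      refine Finset.sum_congr rfl fun g _ => ?_
      rw [map_mul, Complex.conj_ofReal, AddChar.map_neg_eq_conj]
      ring
    simp_rw [h1]
    rw [Finset.sum_comm, Finset.mul_sum]
    refine Finset.sum_congr rfl fun g _ => ?_
    rw [← Finset.mul_sum, hatSum_inversion]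
    ring
  exact_mod_cast h

lemma hatSum_sub_const {G : Type} [AddCommGroup G] [Fintype G] (f : G → ℝ) (c : ℝ)
    {χ : AddChar G ℂ} (hχ : χ ≠ 0) : hatSum (fun a => f a - c) χ = hatSum f χ := by
  unfold hatSum
  push_cast
  simp_rw [sub_mul]
  rw [Finset.sum_sub_distrib, ← Finset.mul_sum, AddChar.sum_eq_zero_iff_ne_zero.2 hχ]
  simp

lemma sum_norm_hatSum_sq_le {G : Type} [AddCommGroup G] [Fintype G] (f : G → ℝ) {c e : ℝ}
    (hf : ∀ a, |f a - c| ≤ e) :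
    ∑ χ : AddChar G ℂ with χ ≠ 0, ‖hatSum f χ‖ ^ 2 ≤ (Fintype.card G * e) ^ 2 := by
  calc _ = ∑ χ : AddChar G ℂ with χ ≠ 0, ‖hatSum (fun a => f a - c) χ‖ ^ 2 := by
        refine Finset.sum_congr rfl fun χ hχ => ?_
        rw [hatSum_sub_const f c (Finset.mem_filter.1 hχ).2]
    _ ≤ ∑ χ : AddChar G ℂ, ‖hatSum (fun a => f a - c) χ‖ ^ 2 :=
        Finset.sum_le_sum_of_subset_of_nonneg (Finset.filter_subset _ _)
          fun _ _ _ => by positivity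
    _ = Fintype.card G * ∑ a, (f a - c) ^ 2 := sum_norm_hatSum_sq _
    _ ≤ Fintype.card G * ∑ _a : G, e ^ 2 := by
        refine mul_le_mul_of_nonneg_left (Finset.sum_le_sum fun a _ => ?_) (Nat.cast_nonneg _)
        exact sq_le_sq.2 ((hf a).trans (le_abs_self e))
    _ = _ := by
        rw [Finset.sum_const, Finset.card_univ, nsmul_eq_mul]
        ring

/-- If `L^ = F^ (1 + R^)` with `R`, `L` nearly constant and `1 + R^` bounded below off the trivial
character, then `F` is nearly constant. -/
lemma abs_card_mul_sub_le {G : Type} [AddCommGroup G] [Fintype G] (R L F : G → ℝ)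
    {r₀ e₁ l₀ e₂ M : ℝ} (hM : 0 ≤ M) (hR : ∀ a, |R a - r₀| ≤ e₁) (hL : ∀ a, |L a - l₀| ≤ e₂)
    (hF : ∀ χ, hatSum L χ = hatSum F χ * (1 + hatSum R χ))
    (hne : ∀ χ, χ ≠ 0 → 1 ≤ M * ‖1 + hatSum R χ‖) (g : G) :
    |Fintype.card G * F g - ∑ a, F a| ≤
      2 * (Fintype.card G * e₂) + M * ((Fintype.card G * e₁) * (Fintype.card G * e₂)) := by
  set h : ℝ := (Fintype.card G : ℝ) with hh
  have he₁ : 0 ≤ e₁ := (abs_nonneg _).trans (hR 0)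
  have he₂ : 0 ≤ e₂ := (abs_nonneg _).trans (hL 0)
  have hh0 : 0 ≤ h := Nat.cast_nonneg _
  have key : ∀ χ : AddChar G ℂ, χ ≠ 0 → hatSum F χ =
      hatSum L χ - hatSum L χ * hatSum R χ / (1 + hatSum R χ) := fun χ hχ => by
    have h0 : 1 + hatSum R χ ≠ 0 := fun h0 => by
      have := hne χ hχ
      rw [h0, norm_zero, mul_zero] at this
      linarith
    rw [hF χ]
    field_simp
    ring
  have hsplit : ∀ f : G → ℝ, (h : ℂ) * f g - ∑ a, (f a : ℂ) =
      ∑ χ : AddChar G ℂ with χ ≠ 0, hatSum f χ * χ (-g) := fun f => by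
    have h1 := hatSum_inversion f g
    rw [← Finset.sum_filter_add_sum_filter_not Finset.univ (fun χ : AddChar G ℂ => χ ≠ 0)] at h1
    simp only [not_not, Finset.filter_eq', Finset.mem_univ, if_true, Finset.sum_singleton,
      AddChar.zero_apply, mul_one] at h1
    have h2 : hatSum f 0 = ∑ a, (f a : ℂ) := by simp [hatSum]
    rw [h2] at h1
    rw [hh]
    push_cast
    rw [← h1]
    ring
  have e1 : (h : ℂ) * F g - ∑ a, (F a : ℂ) = ((h : ℂ) * L g - ∑ a, (L a : ℂ)) -
      ∑ χ : AddChar G ℂ with χ ≠ 0, hatSum L χ * hatSum R χ / (1 + hatSum R χ) * χ (-g) := by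
    rw [hsplit F, hsplit L, ← Finset.sum_sub_distrib]
    refine Finset.sum_congr rfl fun χ hχ => ?_
    rw [key χ (Finset.mem_filter.1 hχ).2]
    ring
  have e2 : ‖(h : ℂ) * L g - ∑ a, (L a : ℂ)‖ ≤ 2 * (h * e₂) := by
    have : (h : ℂ) * L g - ∑ a, (L a : ℂ) = ((h * (L g - l₀) - ∑ a, (L a - l₀) : ℝ) : ℂ) := by
      rw [Finset.sum_sub_distrib, Finset.sum_const, Finset.card_univ, nsmul_eq_mul, ← hh]
      push_cast
      ring
    rw [this, Complex.norm_real, Real.norm_eq_abs]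
    have b1 : |∑ a, (L a - l₀)| ≤ h * e₂ := by
      refine (Finset.abs_sum_le_sum_abs _ _).trans ((Finset.sum_le_sum fun a _ => hL a).trans ?_)
      rw [Finset.sum_const, Finset.card_univ, nsmul_eq_mul]
    have b2 : |h * (L g - l₀)| ≤ h * e₂ := by
      rw [abs_mul, abs_of_nonneg hh0]
      exact mul_le_mul_of_nonneg_left (hL g) hh0
    linarith [abs_sub (h * (L g - l₀)) (∑ a, (L a - l₀))]
  have e3 : ‖∑ χ : AddChar G ℂ with χ ≠ 0,
      hatSum L χ * hatSum R χ / (1 + hatSum R χ) * χ (-g)‖ ≤ M * ((h * e₁) * (h * e₂)) := by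
    have b1 : ∀ χ ∈ (Finset.univ.filter fun χ : AddChar G ℂ => χ ≠ 0),
        ‖hatSum L χ * hatSum R χ / (1 + hatSum R χ) * χ (-g)‖ ≤
          M * (‖hatSum L χ‖ * ‖hatSum R χ‖) := fun χ hχ => by
      have hz := hne χ (Finset.mem_filter.1 hχ).2
      have hz0 : 0 < ‖1 + hatSum R χ‖ := by
        by_contra h0
        have : ‖1 + hatSum R χ‖ = 0 := le_antisymm (not_lt.1 h0) (norm_nonneg _)
        rw [this, mul_zero] at hz
        linarith
      rw [norm_mul, AddChar.norm_apply, mul_one, norm_div, norm_mul, div_le_iff₀ hz0]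
      have : 0 ≤ ‖hatSum L χ‖ * ‖hatSum R χ‖ := by positivity
      nlinarith
    refine (norm_sum_le _ _).trans ((Finset.sum_le_sum b1).trans ?_)
    rw [← Finset.mul_sum]
    refine mul_le_mul_of_nonneg_left ?_ hM
    refine (Real.sum_mul_le_sqrt_mul_sqrt _ _ _).trans ?_
    have c1 := sum_norm_hatSum_sq_le L hL
    have c2 := sum_norm_hatSum_sq_le R hR
    rw [mul_comm]
    refine mul_le_mul (Real.sqrt_le_iff.2 ⟨by positivity, c2⟩)
      (Real.sqrt_le_iff.2 ⟨by positivity, c1⟩) (Real.sqrt_nonneg _) (by positivity)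
  have e4 : ((h * F g - ∑ a, F a : ℝ) : ℂ) = (h : ℂ) * F g - ∑ a, (F a : ℂ) := by
    push_cast; rfl
  rw [← Real.norm_eq_abs, ← Complex.norm_real, e4, e1]
  exact (norm_sub_le _ _).trans (add_le_add e2 e3)

lemma AddChar.add_self_ne_zero {G : Type} [AddCommGroup G] [Fintype G]
    (hodd : Odd (Fintype.card G)) {χ : AddChar G ℂ} (hχ : χ ≠ 0) : χ + χ ≠ 0 := by
  intro h
  have h1 : addOrderOf χ ∣ 2 := addOrderOf_dvd_of_nsmul_eq_zero (by rw [two_nsmul, h])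
  have h2 : addOrderOf χ ∣ Fintype.card (AddChar G ℂ) := addOrderOf_dvd_card
  have h3 : Fintype.card (AddChar G ℂ) = Fintype.card G := by
    simp
  rw [h3] at h2
  have h4 : addOrderOf χ ∣ 1 := by
    have := Nat.dvd_gcd h1 h2
    rwa [(Nat.coprime_two_left.2 hodd)] at this
  exact hχ (AddMonoid.addOrderOf_eq_one_iff.1 (Nat.dvd_one.1 h4))

open Complex in
lemma norm_three_four_one_le {a : ℝ} (ha₀ : 0 ≤ a) (ha₁ : a < 1) {z : ℂ} (hz : ‖z‖ = 1) :
    ‖1 - (a : ℂ)‖ ^ 3 * ‖1 - z * a‖ ^ 4 * ‖1 - z ^ 2 * a‖ ≤ 1 := by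
  have h : 0 ≤ 3 * (-log (1 - a)).re + 4 * (-log (1 - a * z)).re + (-log (1 - a * z ^ 2)).re := by
    have hac₀ : ‖(a : ℂ)‖ < 1 := by
      simp only [Complex.norm_of_nonneg ha₀, ha₁]
    have hac₁ : ‖a * z‖ < 1 := by rwa [norm_mul, hz, mul_one]
    have hac₂ : ‖a * z ^ 2‖ < 1 := by rwa [norm_mul, norm_pow, hz, one_pow, mul_one]
    rw [← ((hasSum_re <| hasSum_taylorSeries_neg_log hac₀).mul_left 3).add
      ((hasSum_re <| hasSum_taylorSeries_neg_log hac₁).mul_left 4) |>.add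
      (hasSum_re <| hasSum_taylorSeries_neg_log hac₂) |>.tsum_eq]
    refine tsum_nonneg fun n ↦ ?_
    simp only [← ofReal_pow, div_natCast_re, ofReal_re, mul_pow, mul_re, ofReal_im, zero_mul,
      sub_zero]
    rcases n.eq_zero_or_pos with rfl | hn
    · simp
    · simp only [← mul_div_assoc, ← add_div]
      refine div_nonneg ?_ n.cast_nonneg
      rw [← pow_mul, pow_mul', sq, mul_re, ← sq, ← sq, ← sq_norm_sub_sq_re, norm_pow, hz]
      convert! (show 0 ≤ 2 * a ^ n * ((z ^ n).re + 1) ^ 2 by positivity) using 1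
      ring
  have hn : ∀ u : ℂ, ‖u‖ = 1 → 0 < ‖1 - u * a‖ := fun u hu => by
    have : ‖u * a‖ < 1 := by rwa [norm_mul, hu, one_mul, Complex.norm_of_nonneg ha₀]
    have := norm_sub_norm_le (1 : ℂ) (u * a)
    rw [norm_one] at this
    linarith
  have h1 := hn 1 norm_one
  rw [one_mul] at h1
  have h2 := hn z hz
  have h3 := hn (z ^ 2) (by rw [norm_pow, hz, one_pow])
  simp only [neg_re, log_re, mul_comm (a : ℂ)] at h
  have h4 : Real.log (‖1 - (a : ℂ)‖ ^ 3 * ‖1 - z * a‖ ^ 4 * ‖1 - z ^ 2 * a‖) ≤ 0 := by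
    rw [Real.log_mul (by positivity) h3.ne', Real.log_mul (by positivity) (by positivity),
      Real.log_pow, Real.log_pow]
    push_cast
    linarith
  exact (Real.log_nonpos_iff (by positivity)).1 h4

/-- A free abelian monoid on weighted primes with classes in a group, all of whose weights are at
least one and whose elements are equidistributed among the classes. -/
structure RoughSystem (P G : Type) [AddCommGroup G] (C α Ct : ℝ) where
  w : P → ℝ
  cl : P → G
  l : ℝ
  v : ℝ
  one_le_w : ∀ p, 1 ≤ w p
  one_le_l : 1 ≤ l
  v_pos : 0 < v
  fin : ∀ u, {m : Multiset P | (m.map w).sum ≤ u}.Finite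
  count : ∀ u, 1 ≤ u → ∀ g,
    |(({m : Multiset P | (m ≠ 0 ∧ (m.map cl).sum = g) ∧ (m.map w).sum ≤ u}.ncard : ℕ) : ℝ)
      - v * Real.exp (l * u)| ≤ C * v * Real.exp ((l - α) * u)
  tail : ∀ F : Finset P, ∑ p ∈ F, Real.exp (-(l * w p)) / w p ≤ Ct

lemma hasSum_class {X G : Type} [AddCommGroup G] [Fintype G] (Q : X → Prop) (κ : X → G)
    (ψ : G → ℂ) (φ : X → ℝ) (hs : ∀ g, Summable fun i : {x // Q x ∧ κ x = g} => φ i) :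
    HasSum (fun x => if Q x then ψ (κ x) * φ x else 0)
      (∑ g, ((∑' i : {x // Q x ∧ κ x = g}, φ i : ℝ) : ℂ) * ψ g) := by
  have h1 : ∀ g, HasSum (fun x => if Q x ∧ κ x = g then (φ x : ℂ) * ψ g else 0)
      (((∑' i : {x // Q x ∧ κ x = g}, φ i : ℝ) : ℂ) * ψ g) := fun g => by
    have h2 : HasSum (fun i : {x // Q x ∧ κ x = g} => (φ i : ℂ) * ψ g)
        (((∑' i : {x // Q x ∧ κ x = g}, φ i : ℝ) : ℂ) * ψ g) :=
      (Complex.hasSum_ofReal.2 (hs g).hasSum).mul_right _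
    have h3 := (hasSum_subtype_iff_indicator (f := fun x => (φ x : ℂ) * ψ g)
      (s := {x | Q x ∧ κ x = g})).1 h2
    refine h3.congr_fun ?_
    intro x
    simp [Set.indicator]
  refine (hasSum_sum fun g _ => h1 g).congr_fun fun x => ?_
  by_cases hQ : Q x
  · simp [hQ, mul_comm]
  · simp [hQ]

namespace RoughSystem

variable {P G : Type} [AddCommGroup G] {C α Ct : ℝ} (A : RoughSystem P G C α Ct)

/-- Total weight of a multiset. -/
noncomputable def W (m : Multiset P) : ℝ := (m.map A.w).sum

/-- Class of a multiset. -/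
noncomputable def clm (m : Multiset P) : G := (m.map A.cl).sum

/-- Dirichlet series of the nonzero elements in a class. -/
noncomputable def R (s : ℝ) (g : G) : ℝ :=
  ∑' i : {m : Multiset P // m ≠ 0 ∧ A.clm m = g}, Real.exp (-((A.l + s) * A.W i))

/-- Weighted Dirichlet series of the nonzero elements in a class. -/
noncomputable def Lw (s : ℝ) (g : G) : ℝ :=
  ∑' i : {m : Multiset P // m ≠ 0 ∧ A.clm m = g}, A.W i * Real.exp (-((A.l + s) * A.W i))

/-- The local parameter of a prime. -/
noncomputable def t (s : ℝ) (p : P) : ℝ := Real.exp (-((A.l + s) * A.w p))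

/-- Prime power series of a class. -/
noncomputable def F (s : ℝ) (g : G) : ℝ :=
  ∑' q : {q : P × ℕ // True ∧ (q.2 + 1) • A.cl q.1 = g}, A.w q.1.1 * A.t s q.1.1 ^ (q.1.2 + 1)

lemma card_le_W (m : Multiset P) : (m.card : ℝ) ≤ A.W m := by
  unfold W
  induction m using Multiset.induction_on with
  | empty => simp
  | cons p m ih =>
    have := A.one_le_w p
    simp only [Multiset.card_cons, Multiset.map_cons, Multiset.sum_cons]
    push_cast
    linarith

lemma one_le_W {m : Multiset P} (hm : m ≠ 0) : 1 ≤ A.W m := by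
  refine le_trans ?_ (A.card_le_W m)
  exact_mod_cast Multiset.card_pos.2 hm

lemma W_nonneg (m : Multiset P) : 0 ≤ A.W m := (Nat.cast_nonneg _).trans (A.card_le_W m)

lemma prod_t (s : ℝ) (m : Multiset P) : (m.map (A.t s)).prod = Real.exp (-((A.l + s) * A.W m)) := by
  unfold W t
  induction m using Multiset.induction_on with
  | empty => simp
  | cons p m ih =>
    simp only [Multiset.map_cons, Multiset.prod_cons, Multiset.sum_cons, ih, ← Real.exp_add]
    congr 1; ring

lemma t_pos (s : ℝ) (p : P) : 0 < A.t s p := Real.exp_pos _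

lemma t_le_half {s : ℝ} (hs : 0 < s) (p : P) : A.t s p ≤ 1 / 2 := by
  have h1 := A.one_le_w p
  have h2 := A.one_le_l
  have h3 : A.t s p ≤ Real.exp (-1) := by
    unfold t
    gcongr
    nlinarith
  have h4 : Real.exp (-1) ≤ 1 / 2 := by
    rw [Real.exp_neg, inv_le_comm₀ (Real.exp_pos _) (by norm_num)]
    have := Real.add_one_le_exp (1 : ℝ)
    norm_num
    linarith
  linarith

/-- The completely multiplicative function attached to a character. -/
noncomputable def chi (s : ℝ) (χ : AddChar G ℂ) (p : P) : ℂ := χ (A.cl p) * A.t s p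

lemma prod_chi (s : ℝ) (χ : AddChar G ℂ) (m : Multiset P) :
    (m.map (A.chi s χ)).prod = χ (A.clm m) * (Real.exp (-((A.l + s) * A.W m)) : ℝ) := by
  rw [← prod_t]
  unfold clm chi
  induction m using Multiset.induction_on with
  | empty => simp
  | cons p m ih =>
    simp only [Multiset.map_cons, Multiset.prod_cons, Multiset.sum_cons, ih, AddChar.map_add_eq_mul]
    push_cast
    ring

lemma norm_prod_chi [Finite G] (s : ℝ) (χ : AddChar G ℂ) (m : Multiset P) :
    ‖(m.map (A.chi s χ)).prod‖ = Real.exp (-((A.l + s) * A.W m)) := by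
  rw [prod_chi, norm_mul, AddChar.norm_apply, one_mul, Complex.norm_real, Real.norm_eq_abs,
    abs_of_pos (Real.exp_pos _)]

lemma R_nonneg (s : ℝ) (g : G) : 0 ≤ A.R s g := tsum_nonneg fun _ => (Real.exp_pos _).le

lemma hatSum_R_zero [Fintype G] (s : ℝ) : 1 + hatSum (A.R s) 0 = ((1 + ∑ g, A.R s g : ℝ) : ℂ) := by
  simp [hatSum]

section

lemma sum_exp_class_estimates (hC : 0 ≤ C) (hα : 0 < α) {s : ℝ} (hs : 0 < s)
    (g : G) :
    Summable (fun i : {m : Multiset P // m ≠ 0 ∧ A.clm m = g} =>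
      Real.exp (-((A.l + s) * A.W i))) ∧
    Summable (fun i : {m : Multiset P // m ≠ 0 ∧ A.clm m = g} =>
      A.W i * Real.exp (-((A.l + s) * A.W i))) ∧
    |A.R s g - A.v * (A.l + s) / s| ≤ A.v * (A.l + s) * (1 + C / α) ∧
    |A.Lw s g - A.v * ((A.l + s) / s ^ 2 - 1 / s)| ≤
      A.v * (A.l + s) * (2 + C * (1 / α + 1 / α ^ 2)) := by
  refine tsum_exp_estimates (fun i : {m : Multiset P // m ≠ 0 ∧ A.clm m = g} => A.W i)
    (fun i => A.one_le_W i.2.1) (fun u => ?_) A.one_le_l A.v_pos hC hα (fun u hu => ?_) hs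
  · exact Set.Finite.preimage Subtype.val_injective.injOn (A.fin u)
  · convert A.count u hu g using 4
    rw [← Set.ncard_image_of_injective _ Subtype.val_injective]
    congr 1
    ext m
    constructor
    · rintro ⟨i, hi, rfl⟩
      exact ⟨i.2, hi⟩
    · rintro ⟨h1, h2⟩
      exact ⟨⟨m, h1⟩, h2, rfl⟩

variable [Fintype G]

lemma hasSum_Z (hC : 0 ≤ C) (hα : 0 < α) {s : ℝ} (hs : 0 < s)
    (χ : AddChar G ℂ) :
    HasSum (fun m : Multiset P => (m.map (A.chi s χ)).prod) (1 + hatSum (A.R s) χ) := by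
  have h1 := hasSum_class (fun m : Multiset P => m ≠ 0) A.clm χ
    (fun m => Real.exp (-((A.l + s) * A.W m))) fun g => (A.sum_exp_class_estimates hC hα hs g).1
  have h2 := (hasSum_ite_eq (0 : Multiset P) (1 : ℂ)).add h1
  refine h2.congr_fun fun m => ?_
  rw [prod_chi]
  rcases eq_or_ne m 0 with rfl | hm
  · simp [clm, W]
  · simp [hm]

lemma hasSum_WZ (hC : 0 ≤ C) (hα : 0 < α) {s : ℝ} (hs : 0 < s)
    (χ : AddChar G ℂ) :
    HasSum (fun m : Multiset P => (A.W m : ℂ) * (m.map (A.chi s χ)).prod)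
      (hatSum (A.Lw s) χ) := by
  have h1 := hasSum_class (fun m : Multiset P => m ≠ 0) A.clm χ
    (fun m => A.W m * Real.exp (-((A.l + s) * A.W m))) fun g => (A.sum_exp_class_estimates hC hα hs g).2.1
  refine h1.congr_fun fun m => ?_
  rw [prod_chi]
  rcases eq_or_ne m 0 with rfl | hm
  · simp [W]
  · rw [if_pos hm]
    push_cast
    ring

lemma hasSum_E (hC : 0 ≤ C) (hα : 0 < α) {s : ℝ} (hs : 0 < s)
    : HasSum (fun m : Multiset P => Real.exp (-((A.l + s) * A.W m)))
    (1 + ∑ g, A.R s g) := by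
  have h := A.hasSum_Z hC hα hs 0
  simp only [prod_chi, hatSum, AddChar.zero_apply, one_mul, mul_one] at h
  exact_mod_cast h

lemma summable_norm_prod (hC : 0 ≤ C) (hα : 0 < α) {s : ℝ} (hs : 0 < s)
    (χ : AddChar G ℂ) :
    Summable fun m : Multiset P => ‖(m.map (A.chi s χ)).prod‖ := by
  simp_rw [A.norm_prod_chi s χ]
  exact (A.hasSum_E hC hα hs).summable

lemma summable_weight_norm_prod (hC : 0 ≤ C) (hα : 0 < α) {s : ℝ} (hs : 0 < s)
    (χ : AddChar G ℂ) :
    Summable fun m : Multiset P => (m.map A.w).sum * ‖(m.map (A.chi s χ)).prod‖ := by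
  have h := A.hasSum_WZ hC hα hs 0
  simp only [prod_chi, AddChar.zero_apply, one_mul] at h
  simp_rw [A.norm_prod_chi s χ]
  have h2 := h.summable
  simp_rw [← Complex.ofReal_mul] at h2
  exact Complex.summable_ofReal.1 h2

lemma summable_pp (hC : 0 ≤ C) (hα : 0 < α) {s : ℝ} (hs : 0 < s)
    : Summable fun q : P × ℕ => A.w q.1 * A.t s q.1 ^ (q.2 + 1) := by
  have h := summable_prime_powers (fun p => zero_le_one.trans (A.one_le_w p))
    (A.summable_weight_norm_prod hC hα hs 0)
  simpa [chi, abs_of_pos (A.t_pos s _)] using h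

lemma hasSum_F (hC : 0 ≤ C) (hα : 0 < α) {s : ℝ} (hs : 0 < s)
    (χ : AddChar G ℂ) :
    HasSum (fun q : P × ℕ => (A.w q.1 : ℂ) * (A.chi s χ q.1) ^ (q.2 + 1)) (hatSum (A.F s) χ) := by
  have h1 := hasSum_class (fun _ : P × ℕ => True) (fun q => (q.2 + 1) • A.cl q.1) χ
    (fun q => A.w q.1 * A.t s q.1 ^ (q.2 + 1)) fun g =>
      (A.summable_pp hC hα hs).comp_injective Subtype.val_injective
  refine h1.congr_fun fun q => ?_
  rw [if_pos trivial, chi, mul_pow, ← AddChar.map_nsmul_eq_pow]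
  push_cast
  ring

lemma hatSum_Lw (hC : 0 ≤ C) (hα : 0 < α) {s : ℝ} (hs : 0 < s)
    (χ : AddChar G ℂ) :
    hatSum (A.Lw s) χ = hatSum (A.F s) χ * (1 + hatSum (A.R s) χ) := by
  rw [← (A.hasSum_WZ hC hα hs χ).tsum_eq, ← (A.hasSum_Z hC hα hs χ).tsum_eq,
    ← (A.hasSum_F hC hα hs χ).tsum_eq]
  exact tsum_weight_mul (fun p => zero_le_one.trans (A.one_le_w p))
    (A.summable_weight_norm_prod hC hα hs χ)

open Filter Topology in
lemma tendsto_euler (hC : 0 ≤ C) (hα : 0 < α) {s : ℝ} (hs : 0 < s)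
    (χ : AddChar G ℂ) :
    Tendsto (fun T : Finset P => (∏ p ∈ T, (1 - A.chi s χ p)) * (1 + hatSum (A.R s) χ))
      atTop (𝓝 1) := by
  rw [← (A.hasSum_Z hC hα hs χ).tsum_eq]
  exact tendsto_prod_mul_tsum (A.summable_norm_prod hC hα hs χ)

open Filter Topology in
lemma three_four_one (hC : 0 ≤ C) (hα : 0 < α) {s : ℝ} (hs : 0 < s)
    (χ : AddChar G ℂ) :
    1 ≤ (1 + ∑ g, A.R s g) ^ 3 * ‖1 + hatSum (A.R s) χ‖ ^ 4 * ‖1 + hatSum (A.R s) (χ + χ)‖ := by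
  have h := (((A.tendsto_euler hC hα hs 0).norm.pow 3).mul
    ((A.tendsto_euler hC hα hs χ).norm.pow 4)).mul (A.tendsto_euler hC hα hs (χ + χ)).norm
  have hnorm : ‖1 + hatSum (A.R s) 0‖ = 1 + ∑ g, A.R s g := by
    rw [A.hatSum_R_zero s, Complex.norm_real, Real.norm_eq_abs, abs_of_nonneg]
    have := Finset.sum_nonneg fun g (_ : g ∈ Finset.univ) => A.R_nonneg s g
    linarith
  rw [norm_one, one_pow, one_pow, one_mul, one_mul] at h
  refine le_of_tendsto h (Eventually.of_forall fun T => ?_)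
  simp only [norm_mul, mul_pow, hnorm, norm_prod]
  have hle : (∏ p ∈ T, ‖1 - A.chi s 0 p‖) ^ 3 * (∏ p ∈ T, ‖1 - A.chi s χ p‖) ^ 4 *
      (∏ p ∈ T, ‖1 - A.chi s (χ + χ) p‖) ≤ 1 := by
    rw [← Finset.prod_pow, ← Finset.prod_pow, ← Finset.prod_mul_distrib,
      ← Finset.prod_mul_distrib]
    refine Finset.prod_le_one (fun p _ => by positivity) fun p _ => ?_
    have := norm_three_four_one_le (A.t_pos s p).le (by linarith [A.t_le_half hs p])
      (AddChar.norm_apply χ (A.cl p))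
    simpa [chi, sq] using this
  have h0 : 0 ≤ (1 + ∑ g, A.R s g) ^ 3 * ‖1 + hatSum (A.R s) χ‖ ^ 4 *
      ‖1 + hatSum (A.R s) (χ + χ)‖ := by
    rw [← hnorm]; positivity
  calc _ = ((∏ p ∈ T, ‖1 - A.chi s 0 p‖) ^ 3 * (∏ p ∈ T, ‖1 - A.chi s χ p‖) ^ 4 *
      (∏ p ∈ T, ‖1 - A.chi s (χ + χ) p‖)) * ((1 + ∑ g, A.R s g) ^ 3 *
        ‖1 + hatSum (A.R s) χ‖ ^ 4 * ‖1 + hatSum (A.R s) (χ + χ)‖) := by ring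
    _ ≤ _ := mul_le_of_le_one_left h0 hle

open Filter Topology in
lemma one_add_sum_R_le (hC : 0 ≤ C) (hα : 0 < α) {s : ℝ} (hs : 0 < s)
    : 1 + ∑ g, A.R s g ≤ Real.exp (2 * (Ct / s)) := by
  have h := (A.tendsto_euler hC hα hs 0).norm
  have hR0 : 0 ≤ ∑ g, A.R s g := Finset.sum_nonneg fun g _ => A.R_nonneg s g
  rw [norm_one] at h
  have h2 : Real.exp (-(2 * (Ct / s))) * (1 + ∑ g, A.R s g) ≤ 1 := by
    refine ge_of_tendsto h (Eventually.of_forall fun T => ?_)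
    rw [norm_mul, A.hatSum_R_zero s, Complex.norm_real, Real.norm_eq_abs,
      abs_of_nonneg (by linarith : 0 ≤ 1 + ∑ g, A.R s g), norm_prod]
    refine mul_le_mul_of_nonneg_right ?_ (by linarith)
    have h3 : ∑ p ∈ T, A.t s p ≤ Ct / s := by
      calc _ ≤ ∑ p ∈ T, 1 / s * (Real.exp (-(A.l * A.w p)) / A.w p) := by
            refine Finset.sum_le_sum fun p _ => ?_
            have hw := A.one_le_w p
            have h5 : A.t s p = Real.exp (-(A.l * A.w p)) * Real.exp (-(s * A.w p)) := by
              rw [← Real.exp_add, t]; congr 1; ring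
            have h6 : Real.exp (-(s * A.w p)) ≤ 1 / (s * A.w p) := by
              rw [Real.exp_neg, one_div]
              have := Real.add_one_le_exp (s * A.w p)
              have : 0 < s * A.w p := by positivity
              gcongr
              linarith
            rw [h5]
            calc _ ≤ Real.exp (-(A.l * A.w p)) * (1 / (s * A.w p)) := by gcongr
              _ = _ := by field_simp
        _ = 1 / s * ∑ p ∈ T, Real.exp (-(A.l * A.w p)) / A.w p := by rw [Finset.mul_sum]
        _ ≤ 1 / s * Ct := by
            have := A.tail T
            gcongr
        _ = _ := by ring
    calc Real.exp (-(2 * (Ct / s))) ≤ Real.exp (∑ p ∈ T, -(2 * A.t s p)) := by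
          rw [Finset.sum_neg_distrib, ← Finset.mul_sum]
          gcongr
      _ = ∏ p ∈ T, Real.exp (-(2 * A.t s p)) := Real.exp_sum _ _
      _ ≤ _ := by
          refine Finset.prod_le_prod (fun p _ => (Real.exp_pos _).le) fun p _ => ?_
          have e : 1 - A.chi s 0 p = ((1 - A.t s p : ℝ) : ℂ) := by simp [chi]
          have hh := A.t_le_half hs p
          rw [e, Complex.norm_real, Real.norm_eq_abs, abs_of_nonneg (by linarith)]
          exact exp_neg_two_mul_le (A.t_pos s p).le hh
  rw [Real.exp_neg, inv_mul_le_one₀ (Real.exp_pos _)] at h2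
  exact h2

end

end RoughSystem

namespace RoughSystem

lemma sum_R_bounds {P G : Type} [AddCommGroup G] {C α Ct : ℝ} (A : RoughSystem P G C α Ct)
    (hC : 0 ≤ C) (hα : 0 < α) {s : ℝ} (hs : 0 < s) [Fintype G] :
    |∑ g, A.R s g - Fintype.card G * A.v * (A.l + s) / s| ≤
      Fintype.card G * A.v * (A.l + s) * (1 + C / α) := by
  have h : ∑ g, A.R s g - Fintype.card G * A.v * (A.l + s) / s =
      ∑ g, (A.R s g - A.v * (A.l + s) / s) := by
    rw [Finset.sum_sub_distrib, Finset.sum_const, Finset.card_univ, nsmul_eq_mul]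
    ring
  rw [h]
  refine (Finset.abs_sum_le_sum_abs _ _).trans
    ((Finset.sum_le_sum fun g _ => (A.sum_exp_class_estimates hC hα hs g).2.2.1).trans (le_of_eq ?_))
  rw [Finset.sum_const, Finset.card_univ, nsmul_eq_mul]
  ring

lemma sum_Lw_bounds {P G : Type} [AddCommGroup G] {C α Ct : ℝ} (A : RoughSystem P G C α Ct)
    (hC : 0 ≤ C) (hα : 0 < α) {s : ℝ} (hs : 0 < s) [Fintype G] :
    |∑ g, A.Lw s g - Fintype.card G * A.v * ((A.l + s) / s ^ 2 - 1 / s)| ≤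
      Fintype.card G * A.v * (A.l + s) * (2 + C * (1 / α + 1 / α ^ 2)) := by
  have h : ∑ g, A.Lw s g - Fintype.card G * A.v * ((A.l + s) / s ^ 2 - 1 / s) =
      ∑ g, (A.Lw s g - A.v * ((A.l + s) / s ^ 2 - 1 / s)) := by
    rw [Finset.sum_sub_distrib, Finset.sum_const, Finset.card_univ, nsmul_eq_mul]
    ring
  rw [h]
  refine (Finset.abs_sum_le_sum_abs _ _).trans
    ((Finset.sum_le_sum fun g _ => (A.sum_exp_class_estimates hC hα hs g).2.2.2).trans (le_of_eq ?_))
  rw [Finset.sum_const, Finset.card_univ, nsmul_eq_mul]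
  ring

lemma card_mul_v_mul_l_le {P G : Type} [AddCommGroup G] {C α Ct : ℝ}
    (A : RoughSystem P G C α Ct) (hC : 0 ≤ C) (hα : 0 < α) [Fintype G] :
    Fintype.card G * A.v * A.l ≤ Real.exp (2 * Ct * (2 + C / α)) := by
  set K := 1 + C / α with hK
  have hK1 : 0 < K := by positivity
  set s : ℝ := 1 / (K + 1) with hs
  have hs0 : 0 < s := by positivity
  have h1 := (abs_le.1 (A.sum_R_bounds hC hα hs0)).1
  have h2 := A.one_add_sum_R_le hC hα hs0
  have e1 : 1 / s = K + 1 := by rw [hs, one_div_one_div]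
  have e2 : (2 : ℝ) * (Ct / s) = 2 * Ct * (2 + C / α) := by
    rw [div_eq_mul_one_div, e1, hK]; ring
  rw [e2] at h2
  have e3 : (Fintype.card G : ℝ) * A.v * (A.l + s) / s =
      Fintype.card G * A.v * (A.l + s) * (K + 1) := by rw [div_eq_mul_one_div, e1]
  rw [e3, ← hK] at h1
  have hv := A.v_pos
  have h3 : (Fintype.card G : ℝ) * A.v * A.l ≤ Fintype.card G * A.v * (A.l + s) := by
    gcongr; linarith
  linarith

lemma sum_F_bounds {P G : Type} [AddCommGroup G] {C α Ct : ℝ} (A : RoughSystem P G C α Ct)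
    (hC : 0 ≤ C) (hα : 0 < α) {s : ℝ} (hs : 0 < s) [Fintype G] {c K δ : ℝ} (hδ : 0 < δ)
    (hc : c = Fintype.card G * A.v * (A.l + s)) (hδc : δ ≤ c) (hK1 : 1 + C / α ≤ K)
    (hK2 : 2 + C * (1 / α + 1 / α ^ 2) ≤ K) (hs1 : s * (8 * (K + 1)) ≤ 1)
    (hs2 : s * (K + 1 / δ) ≤ 1) :
    1 + ∑ g, A.R s g ≤ 2 * c / s ∧ 1 / (4 * s) ≤ ∑ g, A.F s g ∧ ∑ g, A.F s g ≤ 4 / s := by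
  have hc0 : 0 < c := hδ.trans_le hδc
  have hv := A.v_pos
  have hK0 : 0 < K := lt_of_lt_of_le (by positivity) hK1
  have hs8 : s ≤ 1 / 8 := by nlinarith
  obtain ⟨r1, r2⟩ := abs_le.1 (A.sum_R_bounds hC hα hs)
  obtain ⟨l1, l2⟩ := abs_le.1 (A.sum_Lw_bounds hC hα hs)
  have hLc : (Fintype.card G : ℝ) * A.v * ((A.l + s) / s ^ 2 - 1 / s) =
      c / s ^ 2 - Fintype.card G * A.v / s := by rw [hc]; ring
  have hvc : (Fintype.card G : ℝ) * A.v / s ≤ c / s := by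
    have : 1 ≤ A.l + s := by linarith [A.one_le_l]
    rw [hc]
    exact div_le_div_of_nonneg_right (le_mul_of_one_le_right (by positivity) this) hs.le
  have hvc0 : 0 ≤ (Fintype.card G : ℝ) * A.v / s := by positivity
  rw [hLc, ← hc] at l1 l2
  rw [← hc] at r1 r2
  have hcK1 : c * (1 + C / α) ≤ c * K := by gcongr
  have hcK2 : c * (2 + C * (1 / α + 1 / α ^ 2)) ≤ c * K := by gcongr
  have hR : 1 + ∑ g, A.R s g ≤ 2 * c / s := by
    have h1 : 1 ≤ c * (1 / δ) := by rw [mul_one_div, le_div_iff₀ hδ]; linarith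
    have h2 : c * (K + 1 / δ) ≤ c / s := by
      rw [le_div_iff₀ hs]; nlinarith
    have h3 : 2 * c / s = c / s + c / s := by ring
    linarith
  have hR' : c / (2 * s) ≤ 1 + ∑ g, A.R s g := by
    have h2 : c * K ≤ c / (2 * s) := by
      rw [le_div_iff₀ (by positivity)]; nlinarith
    have h3 : c / s = c / (2 * s) + c / (2 * s) := by field_simp; ring
    linarith
  have hL1 : c / (2 * s ^ 2) ≤ ∑ g, A.Lw s g := by
    have h1 : c / s + c * K ≤ c / (2 * s ^ 2) := by
      rw [le_div_iff₀ (by positivity)]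
      have : (c / s + c * K) * (2 * s ^ 2) = c * (2 * s + 2 * s * (s * K)) := by field_simp
      rw [this]
      have h4 : s * K ≤ 1 / 8 := by nlinarith
      have h5 : s * (s * K) ≤ 1 / 8 * (1 / 8) := by gcongr
      exact mul_le_of_le_one_right hc0.le (by linarith)
    have h3 : c / s ^ 2 = c / (2 * s ^ 2) + c / (2 * s ^ 2) := by field_simp; ring
    linarith
  have hL2 : ∑ g, A.Lw s g ≤ 2 * c / s ^ 2 := by
    have h1 : c * K ≤ c / s ^ 2 := by
      rw [le_div_iff₀ (by positivity)]
      have h4 : s * K ≤ 1 / 8 := by nlinarith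
      have h5 : s * (s * K) ≤ 1 / 8 * (1 / 8) := by gcongr
      rw [mul_assoc]
      exact mul_le_of_le_one_right hc0.le (by linarith)
    have h3 : 2 * c / s ^ 2 = c / s ^ 2 + c / s ^ 2 := by ring
    linarith
  have hprod : ∑ g, A.Lw s g = (∑ g, A.F s g) * (1 + ∑ g, A.R s g) := by
    have := A.hatSum_Lw hC hα hs 0
    simp only [hatSum, AddChar.zero_apply, mul_one] at this
    exact_mod_cast this
  have hZ0 : 0 < 1 + ∑ g, A.R s g := lt_of_lt_of_le (by positivity) hR'
  have hF : ∑ g, A.F s g = (∑ g, A.Lw s g) / (1 + ∑ g, A.R s g) := by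
    rw [hprod]; field_simp
  refine ⟨hR, ?_, ?_⟩
  · rw [hF, le_div_iff₀ hZ0]
    calc 1 / (4 * s) * (1 + ∑ g, A.R s g) ≤ 1 / (4 * s) * (2 * c / s) :=
          mul_le_mul_of_nonneg_left hR (by positivity)
      _ = c / (2 * s ^ 2) := by ring
      _ ≤ _ := hL1
  · rw [hF, div_le_iff₀ hZ0]
    calc _ ≤ 2 * c / s ^ 2 := hL2
      _ = 4 / s * (c / (2 * s)) := by ring
      _ ≤ _ := mul_le_mul_of_nonneg_left hR' (by positivity)

set_option maxHeartbeats 1000000 in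
lemma exists_F_bounds (C α Ct δ : ℝ) (hC : 0 ≤ C) (hα : 0 < α) (hδ : 0 < δ) :
    ∃ s₀ : ℝ, 0 < s₀ ∧ s₀ ≤ 1 ∧ ∀ (P G : Type) [AddCommGroup G] [Fintype G]
      (A : RoughSystem P G C α Ct), Odd (Fintype.card G) → δ ≤ Fintype.card G * A.v * A.l →
      ∀ s, 0 < s → s ≤ s₀ → ∀ g,
        1 / (8 * s) ≤ Fintype.card G * A.F s g ∧ Fintype.card G * A.F s g ≤ 5 / s := by
  set K : ℝ := (1 + C / α) + (2 + C * (1 / α + 1 / α ^ 2)) with hK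
  have hK0 : 0 < K := by positivity
  set C₅ : ℝ := Real.exp (2 * Ct * (2 + C / α)) with hC₅
  have hC₅0 : 0 < C₅ := Real.exp_pos _
  set Q : ℝ := 2 * C₅ * K with hQ
  have hQ0 : 0 < Q := by positivity
  set B : ℝ := (4 * C₅) ^ 3 * (1 + Q) with hB
  have hB0 : 0 < B := by positivity
  set μ : ℝ := 1 / (16 * (Q + 1) ^ 2) with hμ
  have hμ0 : 0 < μ := by positivity
  have hμQ : μ * (Q * Q) ≤ 1 / 16 := by
    rw [hμ, div_mul_eq_mul_div, div_le_div_iff₀ (by positivity) (by norm_num)]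
    nlinarith
  refine ⟨min 1 (min (1 / (8 * (K + 1))) (min (1 / (K + 1 / δ)) (min (μ ^ 4 / B)
    (1 / (32 * (Q + 1)))))), by positivity, min_le_left _ _, ?_⟩
  intro P G _ _ A hodd hδA s hs hss g
  simp only [le_min_iff] at hss
  obtain ⟨hs1, hs2, hs3, hs4, hs5⟩ := hss
  rw [le_div_iff₀ (by positivity)] at hs2 hs3 hs4 hs5
  set c : ℝ := (Fintype.card G : ℝ) * A.v * (A.l + s) with hc
  have hv := A.v_pos
  have hl := A.one_le_l
  have hδc : δ ≤ c := hδA.trans (by rw [hc]; gcongr; linarith)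
  have hc0 : 0 < c := hδ.trans_le hδc
  have hcC : c ≤ 2 * C₅ := by
    have h1 := A.card_mul_v_mul_l_le hC hα
    have h2 : c ≤ Fintype.card G * A.v * (2 * A.l) := by rw [hc]; gcongr; linarith
    linarith
  have hK1 : 1 + C / α ≤ K := by
    have : 0 ≤ 2 + C * (1 / α + 1 / α ^ 2) := by positivity
    linarith
  have hK2 : 2 + C * (1 / α + 1 / α ^ 2) ≤ K := by
    have : 0 ≤ 1 + C / α := by positivity
    linarith
  obtain ⟨hZ, hF1, hF2⟩ := A.sum_F_bounds hC hα hs hδ hc hδc hK1 hK2 hs2 hs3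
  have hvl : 0 ≤ A.v * (A.l + s) := by positivity
  have hRe : ∀ a, |A.R s a - A.v * (A.l + s) / s| ≤ A.v * (A.l + s) * K := fun a =>
    (A.sum_exp_class_estimates hC hα hs a).2.2.1.trans (by gcongr)
  have hLe : ∀ a, |A.Lw s a - A.v * ((A.l + s) / s ^ 2 - 1 / s)| ≤ A.v * (A.l + s) * K := fun a =>
    (A.sum_exp_class_estimates hC hα hs a).2.2.2.trans (by gcongr)
  have hcK : (Fintype.card G : ℝ) * (A.v * (A.l + s) * K) ≤ Q := by
    calc _ = c * K := by rw [hc]; ring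
      _ ≤ _ := by rw [hQ]; gcongr
  have hcK0 : 0 ≤ (Fintype.card G : ℝ) * (A.v * (A.l + s) * K) := by positivity
  have hhat : ∀ χ : AddChar G ℂ, χ ≠ 0 → ‖1 + hatSum (A.R s) χ‖ ≤ 1 + Q := fun χ hχ => by
    have h1 := sum_norm_hatSum_sq_le (A.R s) hRe
    have h2 : ‖hatSum (A.R s) χ‖ ^ 2 ≤ ∑ χ : AddChar G ℂ with χ ≠ 0, ‖hatSum (A.R s) χ‖ ^ 2 :=
      Finset.single_le_sum (f := fun χ => ‖hatSum (A.R s) χ‖ ^ 2) (fun _ _ => by positivity)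
        (Finset.mem_filter.2 ⟨Finset.mem_univ _, hχ⟩)
    have h3 : ‖hatSum (A.R s) χ‖ ≤ (Fintype.card G : ℝ) * (A.v * (A.l + s) * K) :=
      (pow_le_pow_iff_left₀ (norm_nonneg _) hcK0 two_ne_zero).1 (h2.trans h1)
    calc _ ≤ ‖(1 : ℂ)‖ + ‖hatSum (A.R s) χ‖ := norm_add_le _ _
      _ ≤ _ := by rw [norm_one]; linarith
  have hZ' : 1 + ∑ g, A.R s g ≤ 4 * C₅ / s := hZ.trans
    (div_le_div_of_nonneg_right (by linarith) hs.le)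
  have hZ0 : 0 ≤ 1 + ∑ g, A.R s g := by
    have := Finset.sum_nonneg fun g (_ : g ∈ Finset.univ) => A.R_nonneg s g
    linarith
  have hne : ∀ χ : AddChar G ℂ, χ ≠ 0 → 1 ≤ μ / s * ‖1 + hatSum (A.R s) χ‖ := fun χ hχ => by
    have h1 := A.three_four_one hC hα hs χ
    have h2 := hhat _ (AddChar.add_self_ne_zero hodd hχ)
    have h3 : 1 ≤ (4 * C₅ / s) ^ 3 * ‖1 + hatSum (A.R s) χ‖ ^ 4 * (1 + Q) :=
      h1.trans (by gcongr)
    have h4 : (1 : ℝ) ^ 4 ≤ (μ / s * ‖1 + hatSum (A.R s) χ‖) ^ 4 := by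
      rw [one_pow]
      refine h3.trans ?_
      have e : (4 * C₅ / s) ^ 3 * ‖1 + hatSum (A.R s) χ‖ ^ 4 * (1 + Q) =
          (s * B) / s ^ 4 * ‖1 + hatSum (A.R s) χ‖ ^ 4 := by
        rw [hB]; field_simp
      rw [e, mul_pow, div_pow]
      gcongr
    exact (pow_le_pow_iff_left₀ zero_le_one (by positivity) four_ne_zero).1 h4
  have hmain := abs_card_mul_sub_le (A.R s) (A.Lw s) (A.F s) (M := μ / s) (by positivity) hRe hLe
    (A.hatSum_Lw hC hα hs) hne g
  have herr : 2 * ((Fintype.card G : ℝ) * (A.v * (A.l + s) * K)) + μ / s *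
      (((Fintype.card G : ℝ) * (A.v * (A.l + s) * K)) *
        ((Fintype.card G : ℝ) * (A.v * (A.l + s) * K))) ≤ 1 / (8 * s) := by
    calc _ ≤ 2 * Q + μ / s * (Q * Q) := by gcongr
      _ ≤ 1 / (16 * s) + 1 / (16 * s) := by
          refine add_le_add ?_ ?_
          · rw [le_div_iff₀ (by positivity)]; linarith
          · calc _ = μ * (Q * Q) / s := by ring
              _ ≤ (1 / 16) / s := by gcongr
              _ = _ := by rw [div_div]
      _ = _ := by ring
  obtain ⟨m1, m2⟩ := abs_le.1 (hmain.trans herr)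
  have q1 : 1 / (4 * s) = 1 / (8 * s) + 1 / (8 * s) := by ring
  have q2 : 5 / s = 4 / s + 8 * (1 / (8 * s)) := by ring
  have q3 : 0 < 1 / (8 * s) := by positivity
  constructor <;> linarith

end RoughSystem

namespace RoughSystem

variable {P G : Type} [AddCommGroup G] {C α Ct : ℝ} (A : RoughSystem P G C α Ct)

lemma finite_primes (u : ℝ) : {p : P | A.w p ≤ u}.Finite := by
  refine Set.Finite.of_finite_image (f := fun p => ({p} : Multiset P)) ((A.fin u).subset ?_)
    (fun a _ b _ h => Multiset.singleton_inj.1 h)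
  rintro _ ⟨p, hp, rfl⟩
  simpa using hp

lemma ncard_le (hC : 0 ≤ C) (hα : 0 < α) {u : ℝ} (hu : 1 ≤ u) (g : G) :
    (({m : Multiset P | (m ≠ 0 ∧ (m.map A.cl).sum = g) ∧ (m.map A.w).sum ≤ u}.ncard : ℕ) : ℝ) ≤
      (1 + C) * A.v * Real.exp (A.l * u) := by
  have h := (abs_le.1 (A.count u hu g)).2
  have hv := A.v_pos
  have h2 : C * A.v * Real.exp ((A.l - α) * u) ≤ C * A.v * Real.exp (A.l * u) := by
    gcongr
    linarith
  linarith

lemma sum_exp_primes_le [Fintype G] (hC : 0 ≤ C) (hα : 0 < α) (F : Finset P) :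
    ∑ p ∈ F, Real.exp (-((A.l + 1) * A.w p)) ≤
      2 * (2 + C / α) * (Fintype.card G * A.v * A.l) := by
  have h1 := A.hasSum_E hC hα (s := 1) one_pos
  have h2 := sum_le_hasSum (insert 0 (F.image fun p => ({p} : Multiset P))) (fun _ _ => (Real.exp_pos _).le) h1
  rw [Finset.sum_insert (by simp),
    Finset.sum_image fun a _ b _ h => Multiset.singleton_inj.1 h] at h2
  simp only [W, Multiset.map_singleton, Multiset.sum_singleton,
    Multiset.map_zero, Multiset.sum_zero, mul_zero, neg_zero, Real.exp_zero] at h2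
  have h3 := (abs_le.1 (A.sum_R_bounds hC hα (s := 1) one_pos)).2
  rw [div_one] at h3
  have hv := A.v_pos
  have hl := A.one_le_l
  have h4 : (Fintype.card G : ℝ) * A.v * (A.l + 1) ≤ 2 * (Fintype.card G * A.v * A.l) := by
    have : (0 : ℝ) ≤ Fintype.card G * A.v := by positivity
    nlinarith
  have h5 : 0 ≤ 2 + C / α := by positivity
  nlinarith

lemma exists_prime_of_small [Fintype G] (hC : 0 ≤ C) (hα : 0 < α) {u δ : ℝ} (hu : 2 ≤ u)
    (hCu : C * Real.exp (-(α * u)) ≤ 1 / 2)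
    (hδ : (1 + C) * Real.exp u * (2 * (2 + C / α) * δ) ≤ 1 / 8)
    (hA : Fintype.card G * A.v * A.l ≤ δ) (Bad : Set P)
    (hBad : ∀ F : Finset P, (∀ p ∈ F, p ∈ Bad) →
      ∑ p ∈ F, A.w p * Real.exp (-(A.l * A.w p)) ≤ 1 / 8 * A.v) (g : G) :
    ∃ p, p ∉ Bad ∧ A.cl p = g ∧ A.w p ≤ u := by
  by_contra! hno
  have hv := A.v_pos
  have hl := A.one_le_l
  set T : Finset P := (A.finite_primes u).toFinset with hT
  have hTm : ∀ p, p ∈ T ↔ A.w p ≤ u := fun p => by simp [hT]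
  set T' : Finset P := (A.finite_primes (u / 2)).toFinset with hT'
  have hTm' : ∀ p, p ∈ T' ↔ A.w p ≤ u / 2 := fun p => by simp [hT']
  set B : Finset P := T.filter (· ∈ Bad) with hB
  let S : ℝ → G → Set (Multiset P) := fun u g =>
    {m : Multiset P | (m ≠ 0 ∧ (m.map A.cl).sum = g) ∧ (m.map A.w).sum ≤ u}
  have hSfin : ∀ u g, (S u g).Finite := fun u g => (A.fin u).subset fun m hm => hm.2
  have hcover : S u g ⊆ (((B.image fun p => ({p} : Multiset P)) ∪
      T'.biUnion fun p => (hSfin (u - A.w p) (g - A.cl p)).toFinset.image fun m => p ::ₘ m :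
        Finset (Multiset P)) : Set (Multiset P)) := by
    rintro m ⟨⟨hm0, hmg⟩, hmu⟩
    obtain ⟨p, hpm, hpmin⟩ := Multiset.exists_min_image A.w hm0
    obtain ⟨m', rfl⟩ := Multiset.exists_cons_of_mem hpm
    simp only [Multiset.map_cons, Multiset.sum_cons] at hmg hmu
    simp only [Finset.coe_union, Finset.coe_image, Finset.coe_biUnion, Set.mem_union, Set.mem_image,
      Finset.mem_coe, Set.mem_iUnion, Set.Finite.mem_toFinset]
    by_cases hm' : m' = 0
    · left
      subst hm'
      simp only [Multiset.map_zero, Multiset.sum_zero, add_zero] at hmg hmu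
      refine ⟨p, ?_, rfl⟩
      rw [hB, Finset.mem_filter, hTm]
      refine ⟨hmu, ?_⟩
      by_contra hpB
      exact absurd (hno p hpB hmg) (not_lt.2 hmu)
    · right
      refine ⟨p, ?_, m', ⟨⟨hm', ?_⟩, ?_⟩, rfl⟩
      · rw [hTm']
        obtain ⟨q, hq⟩ := Multiset.exists_mem_of_ne_zero hm'
        have h1 := hpmin q (Multiset.mem_cons_of_mem hq)
        obtain ⟨m'', rfl⟩ := Multiset.exists_cons_of_mem hq
        have h2 := A.W_nonneg m''
        simp only [Multiset.map_cons, Multiset.sum_cons] at hmu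
        unfold W at h2
        linarith
      · rw [← hmg]; abel
      · linarith
  have hle : ((S u g).ncard : ℝ) ≤ B.card + ∑ p ∈ T', ((S (u - A.w p) (g - A.cl p)).ncard : ℝ) := by
    have h1 := Set.ncard_le_ncard hcover (Finset.finite_toSet _)
    rw [Set.ncard_coe_finset] at h1
    have h2 := h1.trans (Finset.card_union_le _ _)
    have h3 := Finset.card_image_le (s := B) (f := fun p => ({p} : Multiset P))
    have h4 : (T'.biUnion fun p => (hSfin (u - A.w p) (g - A.cl p)).toFinset.image
        fun m => p ::ₘ m).card ≤ ∑ p ∈ T', (S (u - A.w p) (g - A.cl p)).ncard := by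
      refine Finset.card_biUnion_le.trans (Finset.sum_le_sum fun p _ => ?_)
      rw [Set.ncard_eq_toFinset_card _ (hSfin _ _)]
      exact Finset.card_image_le
    exact_mod_cast h2.trans (add_le_add h3 h4)
  have hlow : A.v * Real.exp (A.l * u) / 2 ≤ ((S u g).ncard : ℝ) := by
    have h1 := (abs_le.1 (A.count u (by linarith) g)).1
    have h2 : C * A.v * Real.exp ((A.l - α) * u) ≤ A.v * Real.exp (A.l * u) / 2 := by
      have e : Real.exp ((A.l - α) * u) = Real.exp (A.l * u) * Real.exp (-(α * u)) := by
        rw [← Real.exp_add]; congr 1; ring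
      calc _ = (A.v * Real.exp (A.l * u)) * (C * Real.exp (-(α * u))) := by rw [e]; ring
        _ ≤ (A.v * Real.exp (A.l * u)) * (1 / 2) := by gcongr
        _ = _ := by ring
    change _ ≤ (({m : Multiset P | _}.ncard : ℕ) : ℝ) - _ at h1
    linarith
  have hBc : (B.card : ℝ) ≤ 1 / 8 * A.v * Real.exp (A.l * u) := by
    have h1 := hBad B fun p hp => (Finset.mem_filter.1 hp).2
    calc (B.card : ℝ) = ∑ p ∈ B, (1 : ℝ) := by simp
      _ ≤ ∑ p ∈ B, A.w p * Real.exp (-(A.l * A.w p)) * Real.exp (A.l * u) := by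
          refine Finset.sum_le_sum fun p hp => ?_
          have h2 := (hTm p).1 (Finset.mem_filter.1 hp).1
          rw [mul_assoc, ← Real.exp_add]
          have h3 : 1 ≤ Real.exp (-(A.l * A.w p) + A.l * u) := by
            apply Real.one_le_exp
            nlinarith
          have h4 := A.one_le_w p
          nlinarith
      _ = (∑ p ∈ B, A.w p * Real.exp (-(A.l * A.w p))) * Real.exp (A.l * u) := by
          rw [Finset.sum_mul]
      _ ≤ _ := by gcongr
  have hT'c : ∑ p ∈ T', ((S (u - A.w p) (g - A.cl p)).ncard : ℝ) ≤
      1 / 8 * A.v * Real.exp (A.l * u) := by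
    have h1 := A.sum_exp_primes_le hC hα T'
    have h2 : 0 ≤ 2 + C / α := by positivity
    calc _ ≤ ∑ p ∈ T', (1 + C) * A.v * Real.exp (A.l * u) *
          (Real.exp u * Real.exp (-((A.l + 1) * A.w p))) := by
          refine Finset.sum_le_sum fun p hp => ?_
          have hp' := (hTm' p).1 hp
          refine (A.ncard_le hC hα (by linarith) _).trans ?_
          rw [mul_assoc _ (Real.exp (A.l * u)), ← Real.exp_add, ← Real.exp_add]
          gcongr
          have := A.one_le_w p
          nlinarith
      _ = (A.v * Real.exp (A.l * u)) * ((1 + C) * Real.exp u *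
            ∑ p ∈ T', Real.exp (-((A.l + 1) * A.w p))) := by
          rw [← Finset.mul_sum, ← Finset.mul_sum]; ring
      _ ≤ (A.v * Real.exp (A.l * u)) * ((1 + C) * Real.exp u * (2 * (2 + C / α) * δ)) := by
          have h3 := h1.trans (mul_le_mul_of_nonneg_left hA (by positivity))
          gcongr
      _ ≤ (A.v * Real.exp (A.l * u)) * (1 / 8) := by gcongr
      _ = _ := by ring
  have : 0 < A.v * Real.exp (A.l * u) := by positivity
  linarith

lemma F_le_of_no_prime [Fintype G] (hC : 0 ≤ C) (hα : 0 < α) {s U η : ℝ} (hs : 0 < s)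
    (Bad : Set P)
    (hBad : ∀ F : Finset P, (∀ p ∈ F, p ∈ Bad) →
      ∑ p ∈ F, A.w p * Real.exp (-(A.l * A.w p)) ≤ η)
    (hsq : ∀ F : Finset P, ∑ p ∈ F, A.w p * Real.exp (-(2 * A.l * A.w p)) ≤ η) (g : G)
    (hno : ∀ p, p ∉ Bad → A.cl p = g → U < A.w p) :
    A.F s g ≤ Real.exp (-(s / 2 * U)) * A.F (s / 2) g + 5 * η := by
  have hsum : ∀ s, 0 < s → Summable fun q : {q : P × ℕ // True ∧ (q.2 + 1) • A.cl q.1 = g} =>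
      A.w q.1.1 * A.t s q.1.1 ^ (q.1.2 + 1) := fun s hs =>
    (A.summable_pp hC hα hs).subtype _
  let b : P × ℕ → ℝ := fun q => (if q.2 = 0 then
    (if q.1 ∈ Bad then A.w q.1 * Real.exp (-(A.l * A.w q.1)) else 0) else 0) +
      2 * (A.w q.1 * Real.exp (-(2 * A.l * A.w q.1))) * (1 / 2) ^ q.2
  have hw : ∀ p, 0 < A.w p := fun p => one_pos.trans_le (A.one_le_w p)
  have hl := A.one_le_l
  have hb0 : ∀ q, 0 ≤ b q := fun q => by
    have := hw q.1
    refine add_nonneg ?_ (by positivity)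
    split_ifs <;> positivity
  have hbsum : ∀ Q : Finset (P × ℕ), ∑ q ∈ Q, b q ≤ 5 * η := fun Q => by
    obtain ⟨n, hn⟩ : ∃ n, ∀ q ∈ Q, q.2 < n :=
      ⟨Q.sup Prod.snd + 1, fun q hq => Nat.lt_succ_of_le (Finset.le_sup (f := Prod.snd) hq)⟩
    have hsub : Q ⊆ Q.image Prod.fst ×ˢ Finset.range (n + 1) := fun q hq => by
      rw [Finset.mem_product, Finset.mem_range]
      exact ⟨Finset.mem_image_of_mem _ hq, (hn q hq).trans n.lt_succ_self⟩
    set F := Q.image Prod.fst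
    refine (Finset.sum_le_sum_of_subset_of_nonneg hsub fun q _ _ => hb0 q).trans ?_
    rw [Finset.sum_product]
    have h1 : ∀ p ∈ F, ∑ k ∈ Finset.range (n + 1), b (p, k) ≤
        (if p ∈ Bad then A.w p * Real.exp (-(A.l * A.w p)) else 0) +
          4 * (A.w p * Real.exp (-(2 * A.l * A.w p))) := fun p _ => by
      have := hw p
      simp only [b]
      rw [Finset.sum_add_distrib, ← Finset.mul_sum]
      refine add_le_add (le_of_eq ?_) ?_
      · rw [Finset.sum_ite_eq' (Finset.range (n + 1)) 0]
        simp
      · have h2 : ∑ k ∈ Finset.range (n + 1), (1 / 2 : ℝ) ^ k ≤ 2 := by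
          exact (summable_geometric_two.sum_le_tsum _ fun _ _ => by positivity).trans
            tsum_geometric_two.le
        have h3 : 0 ≤ A.w p * Real.exp (-(2 * A.l * A.w p)) := by positivity
        nlinarith
    refine (Finset.sum_le_sum h1).trans ?_
    rw [Finset.sum_add_distrib, ← Finset.mul_sum, ← Finset.sum_filter]
    have h2 := hBad (F.filter (· ∈ Bad)) fun p hp => (Finset.mem_filter.1 hp).2
    have h3 := hsq F
    linarith
  have hpt : ∀ q : {q : P × ℕ // True ∧ (q.2 + 1) • A.cl q.1 = g},
      A.w q.1.1 * A.t s q.1.1 ^ (q.1.2 + 1) ≤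
        Real.exp (-(s / 2 * U)) * (A.w q.1.1 * A.t (s / 2) q.1.1 ^ (q.1.2 + 1)) + b q.1 := by
    rintro ⟨⟨p, k⟩, -, hq⟩
    have hwp := A.one_le_w p
    have hwp0 := hw p
    have ht1 : A.t s p ≤ Real.exp (-(A.l * A.w p)) := by
      unfold t; gcongr; linarith
    have ht2 := A.t_pos s p
    have ht3 := A.t_pos (s / 2) p
    rcases Nat.eq_zero_or_pos k with rfl | hk
    · simp only [zero_add, one_smul] at hq
      simp only [zero_add, pow_one]
      by_cases hp : p ∈ Bad
      · have h1 : A.w p * A.t s p ≤ b (p, 0) := by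
          simp only [b, if_true, if_pos hp]
          have : A.w p * A.t s p ≤ A.w p * Real.exp (-(A.l * A.w p)) := by gcongr
          refine this.trans (le_add_of_nonneg_right (by positivity))
        refine h1.trans (le_add_of_nonneg_left (by positivity))
      · have h2 := hno p hp hq
        refine le_trans ?_ (le_add_of_nonneg_right (hb0 _))
        have : A.t s p ≤ Real.exp (-(s / 2 * U)) * A.t (s / 2) p := by
          unfold t
          rw [← Real.exp_add]
          gcongr
          nlinarith
        calc _ ≤ A.w p * (Real.exp (-(s / 2 * U)) * A.t (s / 2) p) := by gcongr
          _ = _ := by ring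
    · have h1 : A.w p * A.t s p ^ (k + 1) ≤ b (p, k) := by
        simp only [b, if_neg hk.ne', zero_add]
        obtain ⟨j, rfl⟩ : ∃ j, k = j + 1 := ⟨k - 1, by omega⟩
        have h3 : A.t s p ^ 2 ≤ Real.exp (-(2 * A.l * A.w p)) := by
          calc _ ≤ Real.exp (-(A.l * A.w p)) ^ 2 := by gcongr
            _ = _ := by rw [← Real.exp_nat_mul]; congr 1; push_cast; ring
        have h4 : A.t s p ^ j ≤ (1 / 2) ^ j := pow_le_pow_left₀ ht2.le (A.t_le_half hs p) j
        calc _ = A.w p * (A.t s p ^ 2 * A.t s p ^ j) := by ring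
          _ ≤ A.w p * (Real.exp (-(2 * A.l * A.w p)) * (1 / 2) ^ j) := by gcongr
          _ = _ := by ring
      refine h1.trans (le_add_of_nonneg_left (by positivity))
  unfold F
  have hs2 : 0 < s / 2 := by positivity
  refine (hsum s hs).tsum_le_of_sum_le fun Q => ?_
  refine (Finset.sum_le_sum fun q _ => hpt q).trans ?_
  rw [Finset.sum_add_distrib, ← Finset.mul_sum]
  refine add_le_add (mul_le_mul_of_nonneg_left ((hsum _ hs2).sum_le_tsum _ fun q _ => ?_)
    (Real.exp_pos _).le) ?_
  · have := hw q.1.1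
    have := A.t_pos (s / 2) q.1.1
    positivity
  · refine le_trans (le_of_eq ?_) (hbsum (Q.map (Function.Embedding.subtype _)))
    rw [Finset.sum_map]
    rfl

end RoughSystem

/-- Every class contains a good prime of bounded weight, provided that the bad primes and the
prime squares carry little mass. -/
theorem RoughSystem.exists_prime (C α Ct : ℝ) (hC : 0 ≤ C) (hα : 0 < α) :
    ∃ η U : ℝ, 0 < η ∧ 0 < U ∧ ∀ (P G : Type) [AddCommGroup G] [Fintype G]
      (A : RoughSystem P G C α Ct), Odd (Fintype.card G) → ∀ Bad : Set P,
      (∀ F : Finset P, (∀ p ∈ F, p ∈ Bad) →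
        ∑ p ∈ F, A.w p * Real.exp (-(A.l * A.w p)) ≤ η * A.v) →
      (∀ F : Finset P, ∑ p ∈ F, A.w p * Real.exp (-(2 * A.l * A.w p)) ≤ η * A.v) →
      ∀ g, ∃ p, p ∉ Bad ∧ A.cl p = g ∧ A.w p ≤ U := by
  obtain ⟨u, hu, hCu⟩ : ∃ u : ℝ, 2 ≤ u ∧ C * Real.exp (-(α * u)) ≤ 1 / 2 := by
    have h1 : Filter.Tendsto (fun u : ℝ => C * Real.exp (-(α * u))) Filter.atTop (nhds (C * 0)) :=
      (Real.tendsto_exp_neg_atTop_nhds_zero.comp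
        (Filter.tendsto_id.const_mul_atTop hα)).const_mul C
    rw [mul_zero] at h1
    exact ((Filter.eventually_ge_atTop 2).and (h1.eventually_le_const (by norm_num))).exists
  set E := (1 + C) * Real.exp u * (2 * (2 + C / α)) with hE
  have hE0 : 0 < E := by positivity
  obtain ⟨s, hs0, hs1, hs⟩ := RoughSystem.exists_F_bounds C α Ct (1 / (8 * E)) hC hα (by positivity)
  set C₅ := Real.exp (2 * Ct * (2 + C / α)) with hC₅
  have hC₅0 : 0 < C₅ := Real.exp_pos _
  refine ⟨min (1 / 8) (1 / (160 * C₅)), max u (2 * Real.log 320 / s), by positivity,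
    by positivity, ?_⟩
  intro P G _ _ A hodd Bad hBad hsq g
  have hv := A.v_pos
  by_cases hA : Fintype.card G * A.v * A.l ≤ 1 / (8 * E)
  · obtain ⟨p, h1, h2, h3⟩ := A.exists_prime_of_small hC hα hu hCu (δ := 1 / (8 * E))
      (by rw [hE]; exact le_of_eq (by field_simp)) hA Bad
      (fun F hF => (hBad F hF).trans (by gcongr; exact min_le_left _ _)) g
    exact ⟨p, h1, h2, h3.trans (le_max_left _ _)⟩
  · by_contra! hno
    obtain ⟨h1, -⟩ := hs P G A hodd (not_le.1 hA).le s hs0 le_rfl g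
    obtain ⟨-, h2⟩ := hs P G A hodd (not_le.1 hA).le (s / 2) (by positivity) (by linarith) g
    have h3 := A.F_le_of_no_prime hC hα hs0 (U := max u (2 * Real.log 320 / s)) Bad hBad hsq g hno
    set U := max u (2 * Real.log 320 / s)
    set η := min (1 / 8) (1 / (160 * C₅))
    have hexp : Real.exp (-(s / 2 * U)) ≤ 1 / 320 := by
      have : Real.log 320 ≤ s / 2 * U := by
        calc Real.log 320 = s / 2 * (2 * Real.log 320 / s) := by field_simp
          _ ≤ _ := mul_le_mul_of_nonneg_left (le_max_right _ _) (by positivity)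
      calc _ ≤ Real.exp (-Real.log 320) := by gcongr
        _ = _ := by rw [Real.exp_neg, Real.exp_log (by norm_num)]; norm_num
    have hη : η ≤ 1 / (160 * C₅) := min_le_right _ _
    have hη0 : 0 ≤ η := by positivity
    have hcv : Fintype.card G * A.v ≤ C₅ := by
      refine le_trans ?_ (A.card_mul_v_mul_l_le hC hα)
      exact le_mul_of_one_le_right (by positivity) A.one_le_l
    have e1 : Fintype.card G * (5 * (η * A.v)) ≤ 1 / 32 := by
      calc _ = 5 * η * (Fintype.card G * A.v) := by ring
        _ ≤ 5 * (1 / (160 * C₅)) * C₅ := by gcongr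
        _ = _ := by field_simp; norm_num
    have e2 : Fintype.card G * (Real.exp (-(s / 2 * U)) * A.F (s / 2) g) ≤ 1 / 32 * (1 / s) := by
      calc _ = Real.exp (-(s / 2 * U)) * (Fintype.card G * A.F (s / 2) g) := by ring
        _ ≤ Real.exp (-(s / 2 * U)) * (5 / (s / 2)) :=
            mul_le_mul_of_nonneg_left h2 (Real.exp_pos _).le
        _ ≤ 1 / 320 * (5 / (s / 2)) := by gcongr
        _ = _ := by field_simp; norm_num
    have h4 : (Fintype.card G : ℝ) * A.F s g ≤ Fintype.card G *
        (Real.exp (-(s / 2 * U)) * A.F (s / 2) g + 5 * (η * A.v)) :=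
      mul_le_mul_of_nonneg_left h3 (Nat.cast_nonneg _)
    rw [mul_add] at h4
    have e3 : 1 / (8 * s) = 1 / 8 * (1 / s) := by ring
    have e4 : 1 ≤ 1 / s := by rw [le_div_iff₀ hs0]; linarith
    linarith

/-- A free abelian monoid on primes with norms and classes in a group, whose elements of norm at
most `x` are equidistributed among the classes with a square root error term, together with a sparse
set of bad primes. -/
structure ArithSystem (P G : Type) [AddCommGroup G] (Ct Cb : ℝ) where
  N : P → ℝ
  cl : P → G
  κ : ℝ
  X₀ : ℝ
  Bad : Set P
  two_le_N : ∀ p, 2 ≤ N p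
  κ_pos : 0 < κ
  one_le_X₀ : 1 ≤ X₀
  one_le_κ_sq_mul : 1 ≤ κ ^ 2 * X₀
  fin : ∀ x, {m : Multiset P | (m.map N).prod ≤ x}.Finite
  count : ∀ x, X₀ ≤ x → ∀ g,
    |(({m : Multiset P | (m.map cl).sum = g ∧ (m.map N).prod ≤ x}.ncard : ℕ) : ℝ) - κ * x| ≤
      κ * √(X₀ * x)
  tail : ∀ (F : Finset P) (v : ℝ), 2 ≤ v → (∀ p ∈ F, v ≤ N p) →
    ∑ p ∈ F, 1 / (N p * Real.log (N p)) ≤ Ct / Real.log v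
  bad : ∀ F : Finset P, (∀ p ∈ F, p ∈ Bad) → ∑ p ∈ F, N p ^ (-(3 / 4) : ℝ) ≤ Cb

namespace ArithSystem

variable {P G : Type} [AddCommGroup G] {Ct Cb : ℝ} (A : ArithSystem P G Ct Cb)

/-- The elements of norm at most `x` in a class that are free of primes of `T`. -/
def sifted (T : Finset P) (x : ℝ) (g : G) : Set (Multiset P) :=
  {m | ((m.map A.cl).sum = g ∧ ∀ p ∈ m, p ∉ T) ∧ (m.map A.N).prod ≤ x}

lemma finite_sifted (T : Finset P) (x : ℝ) (g : G) : (A.sifted T x g).Finite :=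
  (A.fin x).subset fun _ hm => hm.2

lemma N_pos (p : P) : 0 < A.N p := two_pos.trans_le (A.two_le_N p)

lemma sifted_anti {T T' : Finset P} (h : T ⊆ T') (x : ℝ) (g : G) :
    A.sifted T' x g ⊆ A.sifted T x g :=
  fun _ hm => ⟨⟨hm.1.1, fun p hp hpT => hm.1.2 p hp (h hpT)⟩, hm.2⟩

lemma ncard_sifted_insert {T : Finset P} {p : P} (hp : p ∉ T) (x : ℝ) (g : G) :
    (A.sifted T x g).ncard =
      (A.sifted (insert p T) x g).ncard + (A.sifted T (x / A.N p) (g - A.cl p)).ncard := by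
  have hun : A.sifted T x g =
      A.sifted (insert p T) x g ∪ (fun m => p ::ₘ m) '' A.sifted T (x / A.N p) (g - A.cl p) := by
    ext m
    simp only [sifted, Set.mem_union, Set.mem_image, Set.mem_ofPred_eq, Finset.mem_insert, not_or]
    constructor
    · rintro ⟨⟨h1, h2⟩, h3⟩
      by_cases hpm : p ∈ m
      · right
        obtain ⟨m', rfl⟩ := Multiset.exists_cons_of_mem hpm
        simp only [Multiset.map_cons, Multiset.sum_cons, Multiset.prod_cons] at h1 h3
        refine ⟨m', ⟨⟨?_, fun q hq => h2 q (Multiset.mem_cons_of_mem hq)⟩, ?_⟩, rfl⟩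
        · rw [← h1]; abel
        · rw [le_div_iff₀ (A.N_pos p), mul_comm]; exact h3
      · left
        exact ⟨⟨h1, fun q hq => ⟨fun h => hpm (h ▸ hq), h2 q hq⟩⟩, h3⟩
    · rintro (⟨⟨h1, h2⟩, h3⟩ | ⟨m', ⟨⟨h1, h2⟩, h3⟩, rfl⟩)
      · exact ⟨⟨h1, fun q hq => (h2 q hq).2⟩, h3⟩
      · simp only [Multiset.map_cons, Multiset.sum_cons, Multiset.prod_cons, Multiset.mem_cons]
        refine ⟨⟨?_, ?_⟩, ?_⟩
        · rw [h1]; abel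
        · rintro q (rfl | hq)
          · exact hp
          · exact h2 q hq
        · rw [le_div_iff₀ (A.N_pos p), mul_comm] at h3; exact h3
  have hdis : Disjoint (A.sifted (insert p T) x g)
      ((fun m => p ::ₘ m) '' A.sifted T (x / A.N p) (g - A.cl p)) := by
    rw [Set.disjoint_left]
    rintro m hm ⟨m', -, rfl⟩
    exact hm.1.2 p (Multiset.mem_cons_self _ _) (Finset.mem_insert_self _ _)
  rw [hun, Set.ncard_union_eq hdis (A.finite_sifted _ _ _) ((A.finite_sifted _ _ _).image _),
    Set.ncard_image_of_injective _ fun a b h => (Multiset.cons_inj_right p).1 h]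

/-- The normalised number of sifted elements of norm at most `X₀ exp L`. -/
noncomputable def sieve (T : Finset P) (L : ℝ) (g : G) : ℝ :=
  (A.sifted T (A.X₀ * Real.exp L) g).ncard / (A.κ * (A.X₀ * Real.exp L))

lemma X₀_pos : 0 < A.X₀ := one_pos.trans_le A.one_le_X₀

lemma sieve_nonneg (T : Finset P) (L : ℝ) (g : G) : 0 ≤ A.sieve T L g := by
  have := A.κ_pos
  have := A.X₀_pos
  unfold sieve
  positivity

lemma sieve_anti (T T' : Finset P) (L : ℝ) (g : G) (h : T ⊆ T') :
    A.sieve T' L g ≤ A.sieve T L g := by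
  have := A.κ_pos
  have := A.X₀_pos
  unfold sieve
  have := Set.ncard_le_ncard (A.sifted_anti h (A.X₀ * Real.exp L) g) (A.finite_sifted _ _ _)
  gcongr

lemma sieve_insert (T : Finset P) (p : P) (L : ℝ) (g : G) (hp : p ∉ T) :
    A.sieve (insert p T) L g =
      A.sieve T L g - 1 / A.N p * A.sieve T (L - Real.log (A.N p)) (g - A.cl p) := by
  have h1 := A.κ_pos
  have h2 := A.X₀_pos
  have h3 := A.N_pos p
  have h4 : A.X₀ * Real.exp (L - Real.log (A.N p)) = A.X₀ * Real.exp L / A.N p := by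
    rw [Real.exp_sub, Real.exp_log h3, mul_div_assoc]
  unfold sieve
  rw [h4, A.ncard_sifted_insert hp]
  push_cast
  field_simp
  ring

lemma sieve_empty (L : ℝ) (g : G) (hL : 0 ≤ L) :
    |A.sieve ∅ L g - 1| ≤ Real.exp (-(L / 2)) := by
  have h1 := A.κ_pos
  have h2 := A.X₀_pos
  have h3 := A.count (A.X₀ * Real.exp L)
    (le_mul_of_one_le_right h2.le (Real.one_le_exp hL)) g
  have e1 : A.sifted ∅ (A.X₀ * Real.exp L) g =
      {m : Multiset P | (m.map A.cl).sum = g ∧ (m.map A.N).prod ≤ A.X₀ * Real.exp L} := by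
    simp [sifted]
  have e2 : √(A.X₀ * (A.X₀ * Real.exp L)) = A.X₀ * Real.exp (L / 2) := by
    rw [show A.X₀ * (A.X₀ * Real.exp L) = (A.X₀ * Real.exp (L / 2)) ^ 2 by
      rw [mul_pow, ← Real.exp_nat_mul]; push_cast; ring_nf]
    exact Real.sqrt_sq (by positivity)
  rw [← e1, e2] at h3
  unfold sieve
  have h4 : 0 < A.κ * (A.X₀ * Real.exp L) := by positivity
  have e3 : (A.sifted ∅ (A.X₀ * Real.exp L) g).ncard / (A.κ * (A.X₀ * Real.exp L)) - 1 =
      ((A.sifted ∅ (A.X₀ * Real.exp L) g).ncard - A.κ * (A.X₀ * Real.exp L)) /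
        (A.κ * (A.X₀ * Real.exp L)) := by field_simp
  rw [e3, abs_div, abs_of_pos h4, div_le_iff₀ h4]
  refine h3.trans (le_of_eq ?_)
  have : Real.exp (-(L / 2)) * Real.exp L = Real.exp (L / 2) := by
    rw [← Real.exp_add]; congr 1; ring
  rw [← this]; ring

lemma finite_primes (y : ℝ) : {p : P | A.N p < y}.Finite := by
  refine Set.Finite.of_finite_image (f := fun p => ({p} : Multiset P)) ((A.fin y).subset ?_)
    (fun a _ b _ h => Multiset.singleton_inj.1 h)
  rintro _ ⟨p, hp, rfl⟩
  have : A.N p ≤ y := le_of_lt hp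
  simpa using this

/-- The primes of norm less than `z`. -/
noncomputable def primesBelow (z : ℝ) : Finset P := (A.finite_primes z).toFinset

@[simp] lemma mem_primesBelow {z : ℝ} {p : P} : p ∈ A.primesBelow z ↔ A.N p < z := by
  simp [primesBelow]

lemma Ct_nonneg {Ct : ℝ} (A : ArithSystem P G Ct Cb) : 0 ≤ Ct := by
  have := A.tail ∅ 2 le_rfl (by simp)
  rw [Finset.sum_empty] at this
  by_contra! h
  exact absurd this (not_le.2 (div_neg_of_neg_of_pos h (Real.log_pos (by norm_num))))

lemma abs_sieve_sub_le {z L : ℝ} (hz : 2 ≤ z) (hL : (4 + 50 * Ct) * Real.log z ≤ L) (g : G) :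
    |A.sieve (A.primesBelow z) L g - siftDensity A.N (A.primesBelow z)| ≤
      siftDensity A.N (A.primesBelow z) * (4 * Real.exp (1 / 2 + 15 * Ct) *
        Real.exp (-(L / (10 * Real.log z)))) := by
  have h := fundamental_lemma_sieve A.N A.cl A.two_le_N A.finite_primes A.Ct_nonneg A.tail
    A.sieve A.sieve_nonneg A.sieve_anti A.sieve_insert A.sieve_empty (A.primesBelow z)
    (A.primesBelow z) le_rfl z hz (fun p hp => by simpa using hp)
    (fun p hp => (A.mem_primesBelow.1 hp).le) L g hL
  have e : logTail A.N (A.primesBelow z) (A.primesBelow z) = 0 := by simp [logTail]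
  rw [e] at h
  convert h using 5
  rw [mul_zero, add_zero, div_div, mul_one_div]

/-- The constant in the sieve asymptotic. -/
noncomputable def sieveConst (Ct : ℝ) : ℝ :=
  (Real.exp (4 * (4 + 50 * Ct) * Ct) * (1 + 4 * Real.exp (1 / 2 + 15 * Ct)) + 1) *
    Real.exp ((4 + 50 * Ct) / 10)

lemma abs_sieve_sub_le_sieveConst {z L : ℝ} (hz : A.X₀ ^ 2 ≤ z)
    (hz' : (4 + 50 * Ct) * Real.log 4 ≤ Real.log z) (hz1 : 2 ≤ z)
    (hL : Real.log z ≤ L + Real.log A.X₀) (g : G) :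
    |A.sieve (A.primesBelow z) L g - siftDensity A.N (A.primesBelow z)| ≤
      siftDensity A.N (A.primesBelow z) * (sieveConst Ct *
        Real.exp (-((L + Real.log A.X₀) / (20 * Real.log z)))) := by
  have hCt := A.Ct_nonneg
  have hX := A.X₀_pos
  set β : ℝ := 4 + 50 * Ct with hβ
  have hβ0 : 0 < β := by positivity
  set Q := 4 * Real.exp (1 / 2 + 15 * Ct) with hQ
  have hQ0 : 0 < Q := by positivity
  set V := siftDensity A.N (A.primesBelow z) with hV
  have hV0 : 0 < V := siftDensity_pos A.two_le_N _
  have hlz : 0 < Real.log z := Real.log_pos (by linarith)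
  have hlX : 0 ≤ Real.log A.X₀ := Real.log_nonneg A.one_le_X₀
  have hlX2 : 2 * Real.log A.X₀ ≤ Real.log z := by
    have := Real.log_le_log (by positivity) hz
    rwa [Real.log_pow, Nat.cast_ofNat] at this
  set x := L + Real.log A.X₀ with hx
  have hLx : x / 2 ≤ L := by linarith
  have hQc : Q ≤ sieveConst Ct := by
    unfold sieveConst
    rw [← hβ, ← hQ]
    have h1 : 1 ≤ Real.exp (4 * β * Ct) := Real.one_le_exp (by positivity)
    have h2 : 1 ≤ Real.exp (β / 10) := Real.one_le_exp (by positivity)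
    have h3 : Q ≤ Real.exp (4 * β * Ct) * (1 + Q) + 1 := by nlinarith
    exact h3.trans (le_mul_of_one_le_right (by positivity) h2)
  by_cases hc : 2 * β * Real.log z ≤ x
  · refine (A.abs_sieve_sub_le hz1 (by linarith) g).trans ?_
    refine mul_le_mul_of_nonneg_left ?_ hV0.le
    have : Real.exp (-(L / (10 * Real.log z))) ≤ Real.exp (-(x / (20 * Real.log z))) := by
      apply Real.exp_le_exp.2
      rw [neg_le_neg_iff, div_le_div_iff₀ (by positivity) (by positivity)]
      nlinarith
    exact mul_le_mul hQc this (Real.exp_pos _).le (hQ0.le.trans hQc)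
  · push Not at hc
    set y := Real.exp (x / (2 * β)) with hy
    have hly : Real.log y = x / (2 * β) := Real.log_exp _
    have hx0 : 0 < x := hlz.trans_le hL
    have hy2 : 2 ≤ y := by
      rw [hy, ← Real.log_le_iff_le_exp (by norm_num), le_div_iff₀ (by positivity)]
      have : Real.log 4 = 2 * Real.log 2 := by
        rw [show (4 : ℝ) = 2 ^ 2 by norm_num, Real.log_pow]; norm_num
      rw [this] at hz'
      linarith
    have hyz : y ≤ z := by
      rw [hy, ← Real.exp_log (show 0 < z by linarith)]
      apply Real.exp_le_exp.2
      rw [div_le_iff₀ (by positivity)]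
      linarith
    have hsub : A.primesBelow y ⊆ A.primesBelow z := fun p hp => by
      rw [mem_primesBelow] at *
      linarith
    have h1 := (abs_le.1 (A.abs_sieve_sub_le hy2 (L := L)
      (by rw [hly]; refine le_trans (le_of_eq ?_) hLx; rw [← hβ]; field_simp) g)).2
    have h2 := A.sieve_anti _ _ L g hsub
    have h3 := A.sieve_nonneg (A.primesBelow z) L g
    have h4 : siftDensity A.N (A.primesBelow y) ≤ Real.exp (4 * β * Ct) * V := by
      have h5 : ∑ p ∈ A.primesBelow z \ A.primesBelow y, 1 / A.N p ≤ 2 * β * Ct := by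
        refine (sum_one_div_le_of_tail A.two_le_N A.tail _ hy2 (y := z) (fun p hp => ?_)
          (by linarith)).trans ?_
        · rw [Finset.mem_sdiff, mem_primesBelow, mem_primesBelow] at hp
          exact ⟨not_lt.1 hp.2, hp.1.le⟩
        · rw [hly, div_div_eq_mul_div, mul_div_assoc', div_le_iff₀ hx0]
          nlinarith [mul_nonneg hCt hβ0.le]
      refine (siftDensity_le_exp_mul A.two_le_N hsub h5).trans (le_of_eq ?_)
      rw [hV]; ring_nf
    have hVy : 0 < siftDensity A.N (A.primesBelow y) := siftDensity_pos A.two_le_N _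
    have h6 : A.sieve (A.primesBelow z) L g ≤ Real.exp (4 * β * Ct) * V * (1 + Q) := by
      have h7 : Real.exp (-(L / (10 * Real.log y))) ≤ 1 := by
        have : 0 < Real.log y := by rw [hly]; positivity
        have : 0 ≤ L := by linarith
        apply Real.exp_le_one_iff.2
        rw [neg_nonpos]
        positivity
      calc _ ≤ siftDensity A.N (A.primesBelow y) *
            (1 + Q * Real.exp (-(L / (10 * Real.log y)))) := by
            rw [mul_add, mul_one]; linarith
        _ ≤ (Real.exp (4 * β * Ct) * V) * (1 + Q * 1) := by gcongr
        _ = _ := by ring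
    have h8 : 1 ≤ Real.exp (β / 10) * Real.exp (-(x / (20 * Real.log z))) := by
      rw [← Real.exp_add]
      apply Real.one_le_exp
      rw [← sub_eq_add_neg, sub_nonneg, div_le_div_iff₀ (by positivity) (by norm_num)]
      linarith
    have h9 : |A.sieve (A.primesBelow z) L g - V| ≤
        V * (Real.exp (4 * β * Ct) * (1 + Q) + 1) := by
      have h10 : 0 < Real.exp (4 * β * Ct) * V * (1 + Q) := by positivity
      rw [abs_le]
      constructor <;> linarith
    refine h9.trans ?_
    unfold sieveConst
    rw [← hβ, ← hQ, mul_assoc _ (Real.exp (β / 10))]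
    exact mul_le_mul_of_nonneg_left (le_mul_of_one_le_right (by positivity) h8) hV0.le

end ArithSystem

namespace ArithSystem

lemma exists_le_siftDensity (Ct : ℝ) : ∃ B : ℝ, 0 ≤ B ∧ ∀ (P G : Type) [AddCommGroup G] (Cb : ℝ)
    (A : ArithSystem P G Ct Cb) (z : ℝ), 1 ≤ z →
      Real.exp (-(Real.log z / 16 + B)) ≤ siftDensity A.N (A.primesBelow z) := by
  by_cases hCt : 0 ≤ Ct
  swap
  · exact ⟨0, le_rfl, fun P G _ Cb A => absurd A.Ct_nonneg hCt⟩
  refine ⟨2 * ((32 * Ct + 1) * (Ct / Real.log 2)), by positivity, ?_⟩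
  intro P G _ Cb A z hz
  have hlz : 0 ≤ Real.log z := Real.log_nonneg hz
  set y := Real.exp (32 * Ct + 1) with hy
  have hly : Real.log y = 32 * Ct + 1 := Real.log_exp _
  have hy2 : 2 ≤ y := by
    have := Real.add_one_le_exp (32 * Ct + 1)
    linarith
  have h1 : ∑ p ∈ A.primesBelow z, 1 / A.N p ≤
      Real.log z / 32 + (32 * Ct + 1) * (Ct / Real.log 2) := by
    rw [← Finset.sum_filter_add_sum_filter_not (A.primesBelow z) (fun p => y ≤ A.N p)]
    refine add_le_add ?_ ?_
    · refine (sum_one_div_le_of_tail A.two_le_N A.tail _ hy2 (y := z) (fun p hp => ?_) hz).trans ?_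
      · rw [Finset.mem_filter, mem_primesBelow] at hp
        exact ⟨hp.2, hp.1.le⟩
      · rw [hly, div_eq_mul_one_div (Real.log z)]
        refine mul_le_mul_of_nonneg_left ?_ hlz
        rw [div_le_div_iff₀ (by positivity) (by norm_num)]
        linarith
    · rw [← hly]
      refine sum_one_div_le_of_tail A.two_le_N A.tail _ le_rfl (fun p hp => ?_) (by linarith)
      rw [Finset.mem_filter] at hp
      exact ⟨A.two_le_N p, (not_le.1 hp.2).le⟩
  have h2 := siftDensity_le_exp_mul A.two_le_N (Finset.empty_subset (A.primesBelow z))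
    (c := Real.log z / 32 + (32 * Ct + 1) * (Ct / Real.log 2)) (by rwa [Finset.sdiff_empty])
  rw [show siftDensity A.N ∅ = 1 by simp [siftDensity]] at h2
  rw [Real.exp_neg, inv_le_iff_one_le_mul₀ (Real.exp_pos _), mul_comm]
  refine h2.trans (mul_le_mul_of_nonneg_right (Real.exp_le_exp.2 ?_)
    (siftDensity_pos A.two_le_N _).le)
  linarith

variable {P G : Type} [AddCommGroup G] {Ct Cb : ℝ} (A : ArithSystem P G Ct Cb)

lemma prod_map_N {z : ℝ} (hz : 1 < z) (m : Multiset {p : P // z ≤ A.N p}) :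
    ((m.map Subtype.val).map A.N).prod =
      Real.exp (Real.log z * (m.map fun p => Real.log (A.N p.1) / Real.log z).sum) := by
  have h : Real.log z ≠ 0 := (Real.log_pos hz).ne'
  induction m using Multiset.induction_on with
  | empty => simp
  | cons p m ih =>
    simp only [Multiset.map_cons, Multiset.prod_cons, Multiset.sum_cons, ih, mul_add, Real.exp_add]
    rw [mul_div_cancel₀ _ h, Real.exp_log (A.N_pos _)]

/-- The large primes of an arithmetic system form a rough system. -/
noncomputable def roughSystem (z : ℝ) (hz1 : Real.exp 1 ≤ z) (hz : A.X₀ ^ 2 ≤ z)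
    (hz' : (4 + 50 * Ct) * Real.log 4 ≤ Real.log z)
    (hv : 1 ≤ A.κ * siftDensity A.N (A.primesBelow z) * Real.exp (19 / 20 * Real.log z)) :
    RoughSystem {p : P // z ≤ A.N p} G (sieveConst Ct + 1) (1 / 20) Ct where
  w p := Real.log (A.N p.1) / Real.log z
  cl p := A.cl p.1
  l := Real.log z
  v := A.κ * siftDensity A.N (A.primesBelow z)
  one_le_w := by
    have h1 : 1 ≤ Real.log z := (Real.le_log_iff_exp_le (lt_of_lt_of_le (Real.exp_pos _) hz1)).2 hz1
    rintro ⟨p, hp⟩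
    rw [one_le_div (by linarith)]
    exact Real.log_le_log (lt_of_lt_of_le (Real.exp_pos _) hz1) hp
  one_le_l := (Real.le_log_iff_exp_le (lt_of_lt_of_le (Real.exp_pos _) hz1)).2 hz1
  v_pos := mul_pos A.κ_pos (siftDensity_pos A.two_le_N _)
  fin u := by
    have hz2 : 1 < z := lt_of_lt_of_le (by have := Real.add_one_le_exp (1 : ℝ); linarith) hz1
    refine Set.Finite.of_finite_image (f := Multiset.map Subtype.val)
      ((A.fin (Real.exp (Real.log z * u))).subset ?_)
      (Multiset.map_injective Subtype.val_injective).injOn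
    rintro _ ⟨m, hm, rfl⟩
    have h0 := (Real.log_pos hz2).le
    rw [Set.mem_ofPred_eq, A.prod_map_N hz2]
    exact Real.exp_le_exp.2 (mul_le_mul_of_nonneg_left hm h0)
  count u hu g := by
    have hz2 : 1 < z := lt_of_lt_of_le (by have := Real.add_one_le_exp (1 : ℝ); linarith) hz1
    have hl : 1 ≤ Real.log z := (Real.le_log_iff_exp_le (lt_of_lt_of_le (Real.exp_pos _) hz1)).2 hz1
    have hl0 : 0 < Real.log z := by linarith
    have hX := A.X₀_pos
    have hκ := A.κ_pos
    have hV : 0 < siftDensity A.N (A.primesBelow z) := siftDensity_pos A.two_le_N _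
    set V := siftDensity A.N (A.primesBelow z) with hVdef
    have h1 := A.abs_sieve_sub_le_sieveConst hz hz' (by have := Real.add_one_le_exp (1 : ℝ); linarith)
      (L := Real.log z * u - Real.log A.X₀) (by nlinarith) g
    have e1 : A.X₀ * Real.exp (Real.log z * u - Real.log A.X₀) = Real.exp (Real.log z * u) := by
      rw [Real.exp_sub, Real.exp_log hX]; field_simp
    have e2 : (Real.log z * u - Real.log A.X₀ + Real.log A.X₀) / (20 * Real.log z) = u / 20 := by
      field_simp; ring
    unfold sieve at h1
    rw [e1, e2, ← hVdef] at h1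
    set x := Real.exp (Real.log z * u) with hx
    have hx0 : 0 < x := Real.exp_pos _
    have e3 : Real.exp ((Real.log z - 1 / 20) * u) = x * Real.exp (-(u / 20)) := by
      rw [hx, ← Real.exp_add]; congr 1; ring
    have h2 : |((A.sifted (A.primesBelow z) x g).ncard : ℝ) - A.κ * V * x| ≤
        sieveConst Ct * (A.κ * V) * Real.exp ((Real.log z - 1 / 20) * u) := by
      have hκx : 0 < A.κ * x := by positivity
      have e4 : ((A.sifted (A.primesBelow z) x g).ncard : ℝ) - A.κ * V * x =
          (A.κ * x) * ((A.sifted (A.primesBelow z) x g).ncard / (A.κ * x) - V) := by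
        field_simp
      rw [e4, abs_mul, abs_of_pos hκx, e3]
      refine (mul_le_mul_of_nonneg_left h1 hκx.le).trans (le_of_eq ?_)
      ring
    set S : Set (Multiset {p : P // z ≤ A.N p}) := {m | (m ≠ 0 ∧ (m.map fun p => A.cl p.1).sum = g) ∧
      (m.map fun p => Real.log (A.N p.1) / Real.log z).sum ≤ u} with hS
    have hinj : Function.Injective
        (Multiset.map (Subtype.val : {p : P // z ≤ A.N p} → P)) :=
      Multiset.map_injective Subtype.val_injective
    have hmem : ∀ m : Multiset {p : P // z ≤ A.N p},
        m.map Subtype.val ∈ A.sifted (A.primesBelow z) x g ↔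
          (m.map fun p => A.cl p.1).sum = g ∧
          (m.map fun p => Real.log (A.N p.1) / Real.log z).sum ≤ u := fun m => by
      simp only [sifted, Set.mem_ofPred_eq]
      rw [A.prod_map_N hz2, hx, Real.exp_le_exp, mul_le_mul_iff_right₀ hl0, Multiset.map_map]
      have : ∀ p ∈ m.map Subtype.val, p ∉ A.primesBelow z := fun p hp => by
        obtain ⟨q, -, rfl⟩ := Multiset.mem_map.1 hp
        rw [mem_primesBelow]
        exact not_lt.2 q.2
      simp only [Function.comp_def]
      tauto
    have hle1 : S.ncard ≤ (A.sifted (A.primesBelow z) x g).ncard := by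
      rw [← Set.ncard_image_of_injective S hinj]
      refine Set.ncard_le_ncard ?_ (A.finite_sifted _ _ _)
      rintro _ ⟨m, hm, rfl⟩
      exact (hmem m).2 ⟨hm.1.2, hm.2⟩
    have hSfin : (Multiset.map Subtype.val '' S).Finite :=
      (A.finite_sifted (A.primesBelow z) x g).subset (by
        rintro _ ⟨m, hm, rfl⟩
        exact (hmem m).2 ⟨hm.1.2, hm.2⟩)
    have hle2 : (A.sifted (A.primesBelow z) x g).ncard ≤ S.ncard + 1 := by
      rw [← Set.ncard_image_of_injective S hinj]
      refine (Set.ncard_le_ncard (t := insert 0 (Multiset.map Subtype.val '' S)) ?_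
        (hSfin.insert _)).trans (Set.ncard_insert_le _ _)
      intro m hm
      by_cases hm0 : m = 0
      · exact Or.inl hm0
      · right
        obtain ⟨m', rfl⟩ : ∃ m' : Multiset {p : P // z ≤ A.N p}, m'.map Subtype.val = m := by
          have h3 : ∀ p ∈ m, z ≤ A.N p := fun p hp => by
            have := hm.1.2 p hp
            rwa [mem_primesBelow, not_lt] at this
          exact CanLift.prf m h3
        obtain ⟨h3, h4⟩ := (hmem m').1 hm
        exact ⟨m', ⟨⟨fun h => hm0 (by rw [h, Multiset.map_zero]), h3⟩, h4⟩, rfl⟩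
    have hle1' : (S.ncard : ℝ) ≤ (A.sifted (A.primesBelow z) x g).ncard := by exact_mod_cast hle1
    have hle2' : ((A.sifted (A.primesBelow z) x g).ncard : ℝ) ≤ S.ncard + 1 := by exact_mod_cast hle2
    have h1le : 1 ≤ A.κ * V * Real.exp ((Real.log z - 1 / 20) * u) := by
      refine hv.trans ?_
      have : 19 / 20 * Real.log z ≤ (Real.log z - 1 / 20) * u := by nlinarith
      gcongr
    obtain ⟨h3, h4⟩ := abs_le.1 h2
    rw [abs_le]
    constructor <;> linarith
  tail F := by
    have hz2 : 2 ≤ z := by have := Real.add_one_le_exp (1 : ℝ); linarith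
    have hl0 : 0 < Real.log z := Real.log_pos (by linarith)
    have h1 := A.tail (F.map (Function.Embedding.subtype _)) z hz2 (by
      intro p hp
      obtain ⟨q, -, rfl⟩ := Finset.mem_map.1 hp
      exact q.2)
    rw [Finset.sum_map, le_div_iff₀ hl0, Finset.sum_mul] at h1
    refine le_trans (le_of_eq (Finset.sum_congr rfl fun p _ => ?_)) h1
    rw [mul_div_cancel₀ _ hl0.ne', Real.exp_neg, Real.exp_log (A.N_pos _)]
    simp only [Function.Embedding.coe_subtype]
    field_simp

end ArithSystem

/-- Linnik's theorem for arithmetic systems with class group of odd order. -/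
theorem ArithSystem.exists_prime (Ct Cb : ℝ) : ∃ z₀ U : ℝ, 0 < z₀ ∧ 0 < U ∧
    ∀ (P G : Type) [AddCommGroup G] [Fintype G] (A : ArithSystem P G Ct Cb),
      Odd (Fintype.card G) → ∀ g, ∃ p, p ∉ A.Bad ∧ A.cl p = g ∧ A.X₀ < A.N p ∧
        A.N p ≤ (z₀ * A.X₀ ^ 8) ^ U := by
  by_cases hCt : 0 ≤ Ct
  swap
  · exact ⟨1, 1, one_pos, one_pos, fun P G _ _ A => absurd A.Ct_nonneg hCt⟩
  by_cases hCb : 0 ≤ Cb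
  swap
  · exact ⟨1, 1, one_pos, one_pos, fun P G _ _ A => absurd (by simpa using A.bad ∅ (by simp)) hCb⟩
  obtain ⟨η, U, hη, hU, hmain⟩ := RoughSystem.exists_prime (sieveConst Ct + 1) (1 / 20) Ct
    (by unfold sieveConst; positivity) (by norm_num)
  obtain ⟨B, hB, hV⟩ := exists_le_siftDensity Ct
  obtain ⟨E, hE⟩ : ∃ E, E = (32 * Cb + 64 * Ct + 1) / η := ⟨_, rfl⟩
  have hE0 : 0 < E := by rw [hE]; positivity
  obtain ⟨M, hM1, hM2, hM3, hM4⟩ : ∃ M : ℝ, 2 ≤ M ∧ (4 + 50 * Ct) * Real.log 4 ≤ M ∧ 16 * B ≤ M ∧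
      32 * Real.log E ≤ M :=
    ⟨max (max 2 ((4 + 50 * Ct) * Real.log 4)) (max (16 * B) (32 * Real.log E)), by simp, by simp,
      by simp, by simp⟩
  refine ⟨Real.exp M, U, Real.exp_pos _, hU, ?_⟩
  intro P G _ _ A hodd g
  have hX := A.X₀_pos
  have hX1 := A.one_le_X₀
  have hlX : 0 ≤ Real.log A.X₀ := Real.log_nonneg hX1
  obtain ⟨z, hz⟩ : ∃ z, z = Real.exp M * A.X₀ ^ 8 := ⟨_, rfl⟩
  rw [← hz]
  have hz0 : 0 < z := by rw [hz]; positivity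
  have hlz : Real.log z = M + 8 * Real.log A.X₀ := by
    rw [hz, Real.log_mul (Real.exp_pos _).ne' (by positivity), Real.log_exp, Real.log_pow]
    norm_num
  have hlz2 : 2 ≤ Real.log z := by linarith
  have hz1 : Real.exp 1 ≤ z := (Real.le_log_iff_exp_le hz0).1 (by linarith)
  have hze : z = Real.exp (Real.log z) := (Real.exp_log hz0).symm
  have hz2 : 2 ≤ z := by have := Real.add_one_le_exp (1 : ℝ); linarith
  have hXe : A.X₀ = Real.exp (Real.log A.X₀) := (Real.exp_log hX).symm
  have hXz : A.X₀ ^ 2 ≤ z := by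
    rw [hze, hXe, ← Real.exp_nat_mul]
    apply Real.exp_le_exp.2
    push_cast
    linarith
  have hκ := A.κ_pos
  have hκ1 : Real.exp (-(Real.log z / 16)) ≤ A.κ := by
    have h1 : Real.exp (-(Real.log z / 16)) ^ 2 * A.X₀ ≤ 1 := by
      conv_lhs => rw [hXe]
      rw [← Real.exp_nat_mul, ← Real.exp_add]
      apply Real.exp_le_one_iff.2
      push_cast
      linarith
    have h2 := h1.trans A.one_le_κ_sq_mul
    exact (pow_le_pow_iff_left₀ (Real.exp_pos _).le hκ.le two_ne_zero).1
      (le_of_mul_le_mul_right h2 hX)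
  have hv0 : z ^ (-(3 / 16) : ℝ) ≤ A.κ * siftDensity A.N (A.primesBelow z) := by
    have h1 := hV P G Cb A z (by linarith)
    calc z ^ (-(3 / 16) : ℝ) ≤
          Real.exp (-(Real.log z / 16)) * Real.exp (-(Real.log z / 16 + B)) := by
          rw [Real.rpow_def_of_pos hz0, ← Real.exp_add]
          apply Real.exp_le_exp.2
          linarith
      _ ≤ _ := by gcongr
  have hv1 : 1 ≤ A.κ * siftDensity A.N (A.primesBelow z) * Real.exp (19 / 20 * Real.log z) := by
    have h1 : z ^ (-(3 / 16) : ℝ) * Real.exp (19 / 20 * Real.log z) ≤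
        A.κ * siftDensity A.N (A.primesBelow z) * Real.exp (19 / 20 * Real.log z) := by gcongr
    refine le_trans ?_ h1
    rw [Real.rpow_def_of_pos hz0, ← Real.exp_add]
    apply Real.one_le_exp
    linarith
  have hEz : z ^ (-(7 / 32) : ℝ) * (32 * Cb + 64 * Ct + 1) ≤
      η * (A.κ * siftDensity A.N (A.primesBelow z)) := by
    have h1 : E ≤ z ^ (1 / 32 : ℝ) := by
      rw [Real.rpow_def_of_pos hz0, ← Real.log_le_iff_le_exp hE0]
      linarith
    calc z ^ (-(7 / 32) : ℝ) * (32 * Cb + 64 * Ct + 1) = η * (z ^ (-(7 / 32) : ℝ) * E) := by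
          rw [hE]; field_simp
      _ ≤ η * (z ^ (-(7 / 32) : ℝ) * z ^ (1 / 32 : ℝ)) := by gcongr
      _ = η * z ^ (-(3 / 16) : ℝ) := by rw [← Real.rpow_add hz0]; norm_num
      _ ≤ _ := by gcongr
  have hz7 : 0 < z ^ (-(7 / 32) : ℝ) := Real.rpow_pos_of_pos hz0 _
  set R := A.roughSystem z hz1 hXz (by linarith) hv1 with hR
  have hw : ∀ p : {p : P // z ≤ A.N p}, R.w p ≤ Real.log (A.N p.1) := fun p => by
    have : 0 ≤ Real.log (A.N p.1) := Real.log_nonneg (by linarith [A.two_le_N p.1])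
    exact div_le_self this (by linarith)
  have hlw : ∀ p : {p : P // z ≤ A.N p}, R.l * R.w p = Real.log (A.N p.1) := fun p =>
    mul_div_cancel₀ _ (by linarith : (0:ℝ) < Real.log z).ne'
  have hmap : ∀ (F : Finset {p : P // z ≤ A.N p}) (f : P → ℝ),
      ∑ p ∈ F, f p.1 = ∑ p ∈ F.map (Function.Embedding.subtype _), f p := fun F f => by
    rw [Finset.sum_map]; rfl
  refine (hmain _ G R hodd {p | p.1 ∈ A.Bad} ?_ ?_ g).elim ?_
  · intro F hF
    have h1 := A.bad (F.map (Function.Embedding.subtype _)) (by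
      intro p hp
      obtain ⟨q, hq, rfl⟩ := Finset.mem_map.1 hp
      exact hF q hq)
    rw [← hmap F] at h1
    calc _ ≤ ∑ p ∈ F, 32 * z ^ (-(7 / 32) : ℝ) * A.N p.1 ^ (-(3 / 4) : ℝ) := by
          refine Finset.sum_le_sum fun p _ => ?_
          have hN := A.N_pos p.1
          rw [hlw, Real.exp_neg, Real.exp_log hN]
          have h2 : Real.log (A.N p.1) ≤ A.N p.1 ^ (1 / 32 : ℝ) / (1 / 32) :=
            Real.log_le_rpow_div hN.le (by norm_num)
          have h3 : A.N p.1 ^ (-(7 / 32) : ℝ) ≤ z ^ (-(7 / 32) : ℝ) :=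
            Real.rpow_le_rpow_of_nonpos hz0 p.2 (by norm_num)
          calc _ ≤ A.N p.1 ^ (1 / 32 : ℝ) / (1 / 32) * (A.N p.1)⁻¹ :=
                mul_le_mul_of_nonneg_right ((hw p).trans h2) (by positivity)
            _ = 32 * A.N p.1 ^ (-(7 / 32) : ℝ) * A.N p.1 ^ (-(3 / 4) : ℝ) := by
                rw [mul_assoc, ← Real.rpow_add hN, ← Real.rpow_neg_one (A.N p.1), div_mul_eq_mul_div,
                  ← Real.rpow_add hN]
                norm_num
                ring
            _ ≤ _ := by gcongr
      _ = 32 * z ^ (-(7 / 32) : ℝ) * ∑ p ∈ F, A.N p.1 ^ (-(3 / 4) : ℝ) := by rw [Finset.mul_sum]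
      _ ≤ 32 * z ^ (-(7 / 32) : ℝ) * Cb := by gcongr
      _ ≤ z ^ (-(7 / 32) : ℝ) * (32 * Cb + 64 * Ct + 1) := by nlinarith
      _ ≤ _ := hEz
  · intro F
    have h1 := A.tail (F.map (Function.Embedding.subtype _)) z hz2 (by
      intro p hp
      obtain ⟨q, hq, rfl⟩ := Finset.mem_map.1 hp
      exact q.2)
    rw [← hmap F fun p => 1 / (A.N p * Real.log (A.N p))] at h1
    have h2 : Ct / Real.log z ≤ Ct := div_le_self hCt (by linarith)
    calc _ ≤ ∑ p ∈ F, 64 * z ^ (-(7 / 32) : ℝ) * (1 / (A.N p.1 * Real.log (A.N p.1))) := by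
          refine Finset.sum_le_sum fun p _ => ?_
          have hN := A.N_pos p.1
          have hlN : 0 < Real.log (A.N p.1) := Real.log_pos (by linarith [A.two_le_N p.1])
          have h3 : Real.log (A.N p.1) ≤ A.N p.1 ^ (1 / 8 : ℝ) / (1 / 8) :=
            Real.log_le_rpow_div hN.le (by norm_num)
          have h4 : A.N p.1 ^ (-(7 / 32) : ℝ) ≤ z ^ (-(7 / 32) : ℝ) :=
            Real.rpow_le_rpow_of_nonpos hz0 p.2 (by norm_num)
          have h5 : Real.log (A.N p.1) ^ 2 ≤ 64 * (z ^ (-(7 / 32) : ℝ) * A.N p.1) := by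
            calc _ ≤ (A.N p.1 ^ (1 / 8 : ℝ) / (1 / 8)) ^ 2 := by gcongr
              _ = 64 * A.N p.1 ^ (1 / 4 : ℝ) := by
                  rw [div_pow, ← Real.rpow_mul_natCast hN.le]; norm_num; ring
              _ ≤ 64 * A.N p.1 ^ (25 / 32 : ℝ) := by
                  exact mul_le_mul_of_nonneg_left (Real.rpow_le_rpow_of_exponent_le
                    (by linarith [A.two_le_N p.1]) (by norm_num)) (by norm_num)
              _ = 64 * (A.N p.1 ^ (-(7 / 32) : ℝ) * A.N p.1) := by
                  rw [← Real.rpow_add_one hN.ne']; norm_num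
              _ ≤ _ := by gcongr
          rw [mul_assoc 2, hlw, two_mul, neg_add, Real.exp_add, Real.exp_neg, Real.exp_log hN]
          calc _ ≤ Real.log (A.N p.1) * ((A.N p.1)⁻¹ * (A.N p.1)⁻¹) :=
                mul_le_mul_of_nonneg_right (hw p) (by positivity)
            _ = Real.log (A.N p.1) ^ 2 * ((A.N p.1)⁻¹ * (1 / (A.N p.1 * Real.log (A.N p.1)))) := by
                field_simp
            _ ≤ 64 * (z ^ (-(7 / 32) : ℝ) * A.N p.1) *
                  ((A.N p.1)⁻¹ * (1 / (A.N p.1 * Real.log (A.N p.1)))) := by gcongr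
            _ = _ := by field_simp
      _ = 64 * z ^ (-(7 / 32) : ℝ) * ∑ p ∈ F, 1 / (A.N p.1 * Real.log (A.N p.1)) := by
          rw [Finset.mul_sum]
      _ ≤ 64 * z ^ (-(7 / 32) : ℝ) * Ct := by
          have := h1.trans h2
          gcongr
      _ ≤ z ^ (-(7 / 32) : ℝ) * (32 * Cb + 64 * Ct + 1) := by nlinarith
      _ ≤ _ := hEz
  · rintro p ⟨hp1, hp2, hp3⟩
    refine ⟨p.1, hp1, hp2, ?_, ?_⟩
    · refine lt_of_lt_of_le ?_ p.2
      rw [hze, hXe]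
      apply Real.exp_lt_exp.2
      linarith
    · have h1 : Real.log (A.N p.1) ≤ Real.log z * U := by
        rw [← hlw p]
        exact mul_le_mul_of_nonneg_left hp3 (by change 0 ≤ Real.log z; linarith)
      rw [Real.rpow_def_of_pos hz0]
      exact (Real.log_le_iff_le_exp (A.N_pos _)).1 h1

namespace QuadraticAlgebra

lemma norm_pos_of_ne_zero {F : Type*} [Field F] [LinearOrder F] [IsStrictOrderedRing F] {m : F}
    (hm : 1 ≤ m) {z : QuadraticAlgebra F (-m) 1} (hz : z ≠ 0) : 0 < z.norm := by
  rw [norm_def]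
  by_cases h : z.im = 0
  · have : z.re ≠ 0 := fun h' => hz (by ext <;> simp [h, h'])
    simp only [h]
    have := mul_self_pos.2 this
    simpa
  · nlinarith [mul_self_pos.2 h, mul_self_nonneg (2 * z.re + z.im)]

lemma norm_ne_zero_int {m : ℤ} (hm : 1 ≤ m) {z : QuadraticAlgebra ℤ (-m) 1} (hz : z ≠ 0) :
    0 < z.norm := by
  rw [norm_def]
  by_cases h : z.im = 0
  · have : z.re ≠ 0 := fun h' => hz (by ext <;> simp [h, h'])
    simp only [h]
    have := mul_self_pos.2 this
    simpa
  · nlinarith [mul_self_pos.2 h, mul_self_nonneg (2 * z.re + z.im)]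

end QuadraticAlgebra

lemma Rat.exists_int_of_mul_sq {D : ℕ} (hD : D.Prime) {q : ℚ} {k : ℤ} (h : (D : ℚ) * q ^ 2 = k) :
    ∃ b : ℤ, q = b := by
  have hD0 : (D : ℚ) ≠ 0 := by exact_mod_cast hD.ne_zero
  have h1 : ((D : ℚ) * q) ^ 2 = ((D * k : ℤ) : ℚ) := by push_cast; rw [← h]; ring
  have h2 : IsIntegral ℤ ((D : ℚ) * q) := by
    refine IsIntegral.of_pow two_pos (n := 2) ?_
    rw [h1]
    exact isIntegral_algebraMap (R := ℤ) (A := ℚ)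
  obtain ⟨r, hr⟩ := IsIntegrallyClosed.isIntegral_iff.1 h2
  simp only [algebraMap_int_eq, eq_intCast] at hr
  rw [← hr] at h1
  have h3 : r ^ 2 = D * k := by exact_mod_cast h1
  have h4 : (D : ℤ) ∣ r := (Nat.prime_iff_prime_int.1 hD).dvd_of_dvd_pow ⟨k, h3⟩
  obtain ⟨b, rfl⟩ := h4
  refine ⟨b, ?_⟩
  push_cast at hr
  exact (mul_left_cancel₀ hD0 hr).symm

/-- The ring of integers of `ℚ(√-D)` for a prime `D = 4 m - 1` is `ℤ[(1 + √-D) / 2]`. -/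
theorem exists_ringEquiv_ringOfIntegers {D : ℕ} (hD : D.Prime) {m : ℤ} (hm : 1 ≤ m)
    (hDm : (D : ℤ) = 4 * m - 1) (K : Type) [Field K] [NumberField K]
    (hK : Module.finrank ℚ K = 2) {α : K} (hα : α ^ 2 = -(D : K)) :
    Nonempty (QuadraticAlgebra ℤ (-m) 1 ≃+* 𝓞 K) := by
  have hDK : (D : K) = 4 * (m : K) - 1 := by exact_mod_cast congrArg (Int.cast : ℤ → K) hDm
  have hω : ((1 + α) / 2) * ((1 + α) / 2) = -(m : K) + (1 + α) / 2 := by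
    linear_combination (hα - hDK) / 4
  obtain ⟨w, hw⟩ : ∃ w : K, w = (1 + α) / 2 := ⟨_, rfl⟩
  rw [← hw] at hω
  have hwi : IsIntegral ℤ w := by
    refine ⟨Polynomial.X ^ 2 - Polynomial.X + Polynomial.C m, by monicity!, ?_⟩
    rw [Polynomial.eval₂_add, Polynomial.eval₂_sub, Polynomial.eval₂_pow, Polynomial.eval₂_X,
      Polynomial.eval₂_C, algebraMap_int_eq, eq_intCast]
    linear_combination hω
  obtain ⟨W, hW⟩ : ∃ W : 𝓞 K, (W : K) = w := ⟨⟨w, hwi⟩, rfl⟩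
  have hWW : W * W = (-m) • 1 + (1 : ℤ) • W := by
    apply RingOfIntegers.ext
    simp [hW, hω]
  let f : QuadraticAlgebra ℤ (-m) 1 →ₐ[ℤ] 𝓞 K := QuadraticAlgebra.lift ⟨W, hWW⟩
  have hf : ∀ z, f z = z.re + z.im * W := fun z => by simp [f]
  let g : QuadraticAlgebra ℚ (-(m : ℚ)) 1 →ₐ[ℚ] K :=
    QuadraticAlgebra.lift ⟨w, by rw [hω]; simp [Algebra.smul_def]⟩
  have hg : ∀ z, g z = z.re + z.im * w := fun z => by simp [g, Algebra.smul_def]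
  have hm' : (1 : ℚ) ≤ m := by exact_mod_cast hm
  have hginj : Function.Injective g := by
    rw [injective_iff_map_eq_zero]
    intro z hz
    by_contra h0
    have h1 := QuadraticAlgebra.norm_pos_of_ne_zero hm' h0
    have h2 := congrArg g (QuadraticAlgebra.algebraMap_norm_eq_mul_star z)
    rw [map_mul, hz, zero_mul, AlgHom.commutes] at h2
    simp at h2
    exact h1.ne' h2
  have hgsurj : Function.Surjective g := by
    refine (LinearMap.injective_iff_surjective_of_finrank_eq_finrank (f := g.toLinearMap) ?_).1 hginj
    rw [hK, QuadraticAlgebra.finrank_eq_two]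
  refine ⟨RingEquiv.ofBijective f.toRingHom ⟨?_, ?_⟩⟩
  · rw [injective_iff_map_eq_zero]
    intro z hz
    by_contra h0
    have h1 := QuadraticAlgebra.norm_ne_zero_int hm h0
    have h2 := congrArg f (QuadraticAlgebra.algebraMap_norm_eq_mul_star z)
    change f z = 0 at hz
    rw [map_mul, hz, zero_mul, AlgHom.commutes] at h2
    simp at h2
    exact h1.ne' h2
  · intro x
    obtain ⟨z, hz⟩ := hgsurj (x : K)
    have hzi : IsIntegral ℤ z := by
      rw [← isIntegral_algHom_iff (g.restrictScalars ℤ) hginj]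
      change IsIntegral ℤ (g z)
      rw [hz]
      exact x.2
    have hsi : IsIntegral ℤ (star z) :=
      hzi.map (starRingEnd (QuadraticAlgebra ℚ (-(m : ℚ)) 1)).toIntAlgHom
    have hinj : Function.Injective
        ((Algebra.ofId ℚ (QuadraticAlgebra ℚ (-(m : ℚ)) 1)).restrictScalars ℤ) := by
      intro a b hab
      have := congrArg QuadraticAlgebra.re hab
      simpa using this
    have ht : IsIntegral ℤ z.trace := by
      rw [← isIntegral_algHom_iff _ hinj]
      change IsIntegral ℤ (algebraMap ℚ _ z.trace)
      rw [QuadraticAlgebra.algebraMap_trace_eq_add_star]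
      exact hzi.add hsi
    have hn : IsIntegral ℤ z.norm := by
      rw [← isIntegral_algHom_iff _ hinj]
      change IsIntegral ℤ (algebraMap ℚ _ z.norm)
      rw [QuadraticAlgebra.algebraMap_norm_eq_mul_star]
      exact hzi.mul hsi
    obtain ⟨t, ht⟩ := IsIntegrallyClosed.isIntegral_iff.1 ht
    obtain ⟨n, hn⟩ := IsIntegrallyClosed.isIntegral_iff.1 hn
    simp only [algebraMap_int_eq, eq_intCast, QuadraticAlgebra.trace_def,
      QuadraticAlgebra.norm_def] at ht hn
    have hDq : (D : ℚ) = 4 * (m : ℚ) - 1 := by exact_mod_cast congrArg (Int.cast : ℤ → ℚ) hDm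
    have hkey : (D : ℚ) * z.im ^ 2 = ((4 * n - t ^ 2 : ℤ) : ℚ) := by
      push_cast
      rw [ht, hn, hDq]; ring
    obtain ⟨b, hb⟩ := Rat.exists_int_of_mul_sq hD hkey
    rw [hb] at hkey ht
    have hkey' : (D : ℤ) * b ^ 2 = 4 * n - t ^ 2 := by exact_mod_cast hkey
    have hpar : Even (t - b) := by
      have h1 : Even ((t - b) ^ 2) :=
        ⟨2 * n - 2 * m * b ^ 2 + b ^ 2 - t * b, by rw [hDm] at hkey'; linear_combination hkey'⟩
      exact (Int.even_pow.1 h1).1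
    obtain ⟨a, ha⟩ := hpar
    refine ⟨⟨a, b⟩, RingOfIntegers.ext ?_⟩
    change ((f ⟨a, b⟩ : 𝓞 K) : K) = x
    have ha' : z.re = a := by
      have : (t : ℚ) - b = a + a := by exact_mod_cast ha
      linarith
    rw [hf, ← hz, hg, hb, ha']
    simp [hW]

namespace QuadraticAlgebra

variable {m : ℤ}

lemma sq_add_mul_sq_eq (z : QuadraticAlgebra ℤ (-m) 1) :
    (2 * z.re + z.im) ^ 2 + (4 * m - 1) * z.im ^ 2 = 4 * z.norm := by
  rw [norm_def]; ring

lemma algebraNorm_eq_norm (z : QuadraticAlgebra ℤ (-m) 1) : Algebra.norm ℤ z = z.norm := by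
  rw [← det_toLinearMap_eq_norm, Algebra.norm_apply]
  rfl

lemma eq_one_or_eq_neg_one_of_isUnit (hm : 2 ≤ m) {z : QuadraticAlgebra ℤ (-m) 1} (hz : IsUnit z) :
    z = 1 ∨ z = -1 := by
  have h1 := isUnit_iff_norm_isUnit.1 hz
  have h2 : 0 < z.norm := norm_ne_zero_int (by linarith) hz.ne_zero
  have h3 : z.norm = 1 := by
    rcases Int.isUnit_iff.1 h1 with h | h
    · exact h
    · omega
  have h4 := sq_add_mul_sq_eq z
  rw [h3] at h4
  have h5 : z.im = 0 := by
    by_contra h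
    have : 0 < z.im ^ 2 := by positivity
    nlinarith [sq_nonneg (2 * z.re + z.im)]
  rw [h5] at h4
  have h6 : z.re * z.re = 1 := by linarith
  rcases mul_self_eq_one_iff.1 h6 with h | h
  · left; ext <;> simp [h, h5]
  · right; ext <;> simp [h, h5]

/-- When `4 m - 1` is prime, every ideal of `ℤ[(1 + √(1 - 4 m)) / 2]` stable under conjugation is
principal. -/
theorem isPrincipal_of_star_mem {D : ℕ} (hD : D.Prime) (hDm : (D : ℤ) = 4 * m - 1)
    (B : Ideal (QuadraticAlgebra ℤ (-m) 1)) (hB : ∀ x ∈ B, star x ∈ B) :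
    ∃ x, B = Ideal.span {x} := by
  obtain ⟨k, hk⟩ : ∃ k, B.comap (algebraMap ℤ _) = Ideal.span {k} :=
    (IsPrincipalIdealRing.principal _).principal
  have hk' : ∀ a : ℤ, algebraMap ℤ (QuadraticAlgebra ℤ (-m) 1) a ∈ B ↔ k ∣ a := fun a => by
    rw [← Ideal.mem_span_singleton, ← hk, Ideal.mem_comap]
  have hkB : algebraMap ℤ (QuadraticAlgebra ℤ (-m) 1) k ∈ B := (hk' k).2 dvd_rfl
  obtain ⟨s, hs⟩ : ∃ s : QuadraticAlgebra ℤ (-m) 1, s = ⟨-1, 2⟩ := ⟨_, rfl⟩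
  have hss : s * s = algebraMap ℤ _ (-D) := by
    rw [hs, hDm]; ext <;> simp; ring
  have hsub : ∀ x : QuadraticAlgebra ℤ (-m) 1, x - star x = algebraMap ℤ _ x.im * s := fun x => by
    rw [hs]; ext <;> simp; ring
  by_cases hall : ∀ x ∈ B, k ∣ x.im
  · refine ⟨algebraMap ℤ _ k, le_antisymm ?_ ((Ideal.span_singleton_le_iff_mem _).2 hkB)⟩
    intro x hx
    obtain ⟨b, hb⟩ := hall x hx
    have h1 : x - algebraMap ℤ _ k * ⟨0, b⟩ = algebraMap ℤ _ x.re := by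
      ext <;> simp [hb]
    have h2 : algebraMap ℤ _ x.re ∈ B := by
      rw [← h1]; exact B.sub_mem hx (B.mul_mem_right _ hkB)
    obtain ⟨a, ha⟩ := (hk' _).1 h2
    rw [Ideal.mem_span_singleton]
    refine ⟨⟨a, b⟩, ?_⟩
    ext <;> simp [ha, hb]
  · push Not at hall
    obtain ⟨x₀, hx₀, hkx₀⟩ := hall
    obtain ⟨l, hl⟩ : ∃ l, Ideal.comap (algebraMap ℤ _) (Submodule.comap
        (LinearMap.toSpanSingleton (QuadraticAlgebra ℤ (-m) 1) _ s) B) = Ideal.span {l} :=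
      (IsPrincipalIdealRing.principal _).principal
    have hl' : ∀ a : ℤ, algebraMap ℤ (QuadraticAlgebra ℤ (-m) 1) a * s ∈ B ↔ l ∣ a := fun a => by
      rw [← Ideal.mem_span_singleton, ← hl, Ideal.mem_comap]
      rfl
    have him : ∀ x ∈ B, l ∣ x.im := fun x hx => by
      rw [← hl', ← hsub]
      exact B.sub_mem hx (hB x hx)
    obtain ⟨d, hd⟩ : l ∣ k := (hl' k).1 (B.mul_mem_right _ hkB)
    have hlB : algebraMap ℤ (QuadraticAlgebra ℤ (-m) 1) l * s ∈ B := (hl' l).2 dvd_rfl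
    have hkl : k ∣ l * D := by
      rw [← hk']
      have h1 := B.mul_mem_right (-s) hlB
      convert h1 using 1
      rw [mul_neg, mul_assoc, hss, map_mul]
      simp
    have hl0 : l ≠ 0 := by
      rintro rfl
      have h1 := him x₀ hx₀
      rw [zero_dvd_iff] at h1
      exact hkx₀ (h1 ▸ dvd_zero k)
    have hdD : d ∣ D := by
      rw [hd] at hkl
      exact (mul_dvd_mul_iff_left hl0).1 hkl
    have hDk : l * D ∣ k := by
      rcases (Int.natAbs_dvd_natAbs.2 hdD) with h
      rw [Int.natAbs_natCast] at h
      rcases (Nat.dvd_prime hD).1 h with h | h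
      · exfalso
        apply hkx₀
        have : IsUnit d := Int.isUnit_iff_natAbs_eq.2 h
        rw [hd, this.mul_right_dvd]
        exact him x₀ hx₀
      · rw [hd]
        apply mul_dvd_mul_left
        rw [← h]
        exact Int.natAbs_dvd.2 dvd_rfl
    refine ⟨algebraMap ℤ _ l * s, le_antisymm ?_ ((Ideal.span_singleton_le_iff_mem _).2 hlB)⟩
    intro x hx
    obtain ⟨b, hb⟩ := him x hx
    have h1 : x - algebraMap ℤ _ l * s * ⟨0, b⟩ = algebraMap ℤ _ (x.re + 2 * m * l * b) := by
      rw [hs]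
      ext
      · simp [-mul_eq_mul_left_iff, -mul_eq_mul_right_iff]
        ring
      · simp [hb]
        ring
    have h2 : algebraMap ℤ _ (x.re + 2 * m * l * b) ∈ B := by
      rw [← h1]; exact B.sub_mem hx (B.mul_mem_right _ hlB)
    obtain ⟨c, hc⟩ := hDk.trans ((hk' _).1 h2)
    rw [hc] at h1
    rw [Ideal.mem_span_singleton]
    refine ⟨⟨0, b⟩ - s * algebraMap ℤ _ c, ?_⟩
    rw [sub_eq_iff_eq_add] at h1
    rw [h1, mul_sub, map_mul, map_mul]
    have h3 : algebraMap ℤ (QuadraticAlgebra ℤ (-m) 1) (D : ℤ) = -(s * s) := by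
      rw [hss]; simp
    rw [h3]
    ring

end QuadraticAlgebra

section

variable {m : ℤ} {K : Type} [Field K]

lemma absNorm_span_ringEquiv [NumberField K] (e : QuadraticAlgebra ℤ (-m) 1 ≃+* 𝓞 K)
    (z : QuadraticAlgebra ℤ (-m) 1) :
    Ideal.absNorm (Ideal.span {e z}) = z.norm.natAbs := by
  rw [Ideal.absNorm_span_singleton, ← QuadraticAlgebra.algebraNorm_eq_norm]
  have := Algebra.norm_eq_of_algEquiv (R := ℤ) (RingEquiv.toIntAlgEquiv e) z
  rw [← this]
  rfl

/-- Conjugation of the ring of integers, transported from the quadratic algebra. -/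
noncomputable def ringConj (e : QuadraticAlgebra ℤ (-m) 1 ≃+* 𝓞 K) : 𝓞 K ≃+* 𝓞 K :=
  (e.symm.trans (starRingAut : RingAut (QuadraticAlgebra ℤ (-m) 1))).trans e

lemma ringConj_apply (e : QuadraticAlgebra ℤ (-m) 1 ≃+* 𝓞 K)
    (z : QuadraticAlgebra ℤ (-m) 1) : ringConj e (e z) = e (star z) := by
  simp [ringConj]

lemma ringConj_ringConj (e : QuadraticAlgebra ℤ (-m) 1 ≃+* 𝓞 K) (x : 𝓞 K) : ringConj e (ringConj e x) = x := by
  simp [ringConj]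

lemma mul_ringConj (e : QuadraticAlgebra ℤ (-m) 1 ≃+* 𝓞 K) (x : 𝓞 K) : x * ringConj e x = ((e.symm x).norm : ℤ) := by
  obtain ⟨z, rfl⟩ := e.surjective x
  rw [ringConj_apply, ← map_mul, ← QuadraticAlgebra.algebraMap_norm_eq_mul_star]
  simp

lemma mul_ringConj_eq_absNorm [NumberField K]
    (e : QuadraticAlgebra ℤ (-m) 1 ≃+* 𝓞 K) (hm : 1 ≤ m) (x : 𝓞 K) :
    x * ringConj e x = (Ideal.absNorm (Ideal.span {x}) : 𝓞 K) := by
  obtain ⟨z, rfl⟩ := e.surjective x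
  rw [mul_ringConj, e.symm_apply_apply, absNorm_span_ringEquiv]
  have : 0 ≤ z.norm := by
    rcases eq_or_ne z 0 with rfl | h
    · simp
    · exact (QuadraticAlgebra.norm_ne_zero_int hm h).le
  rw [← Int.cast_natCast, Int.natAbs_of_nonneg this]

lemma eq_one_or_eq_neg_one_of_isUnit_ringOfIntegers
    (e : QuadraticAlgebra ℤ (-m) 1 ≃+* 𝓞 K) (hm : 2 ≤ m) {u : 𝓞 K} (hu : IsUnit u) :
    u = 1 ∨ u = -1 := by
  rcases QuadraticAlgebra.eq_one_or_eq_neg_one_of_isUnit hm (hu.map e.symm) with h | h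
  · left; rw [← e.apply_symm_apply u, h, map_one]
  · right; rw [← e.apply_symm_apply u, h, map_neg, map_one]

lemma exists_eq_span_of_map_ringConj_eq [NumberField K]
    (e : QuadraticAlgebra ℤ (-m) 1 ≃+* 𝓞 K) {D : ℕ} (hD : D.Prime) (hDm : (D : ℤ) = 4 * m - 1)
    {I : Ideal (𝓞 K)} (hI : I.map (ringConj e) = I) : ∃ x, I = Ideal.span {x} := by
  obtain ⟨z, hz⟩ := QuadraticAlgebra.isPrincipal_of_star_mem hD hDm (I.comap e) (by
    intro x hx
    rw [Ideal.mem_comap] at hx ⊢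
    rw [← ringConj_apply, ← hI]
    exact Ideal.mem_map_of_mem _ hx)
  refine ⟨e z, ?_⟩
  rw [← Ideal.map_comap_of_surjective e e.surjective I, hz, Ideal.map_span]
  simp

/-- The class number of `ℚ(√-D)` is odd for prime `D ≡ 3 [MOD 4]`. -/
theorem odd_card_classGroup [NumberField K] (e : QuadraticAlgebra ℤ (-m) 1 ≃+* 𝓞 K) {D : ℕ} (hD : D.Prime) (hm : 1 ≤ m)
    (hDm : (D : ℤ) = 4 * m - 1) : Odd (Fintype.card (ClassGroup (𝓞 K))) := by
  by_contra hodd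
  rw [Nat.not_odd_iff_even, even_iff_two_dvd] at hodd
  obtain ⟨c, hc⟩ := exists_prime_orderOf_dvd_card 2 hodd
  obtain ⟨⟨I, hI⟩, rfl⟩ := ClassGroup.mk0_surjective c
  have hI0 : I ≠ ⊥ := nonZeroDivisors.ne_zero hI
  have hnp : ∀ x, I ≠ Ideal.span {x} := by
    intro x hx
    have h1 : ClassGroup.mk0 (⟨I, hI⟩ : nonZeroDivisors (Ideal (𝓞 K))) = 1 := by
      rw [ClassGroup.mk0_eq_one_iff]
      exact ⟨x, hx⟩
    rw [h1, orderOf_one] at hc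
    norm_num at hc
  have hsq : ∃ x, I ^ 2 = Ideal.span {x} := by
    have h1 := pow_orderOf_eq_one (ClassGroup.mk0 (⟨I, hI⟩ : nonZeroDivisors (Ideal (𝓞 K))))
    rw [hc, ← map_pow, ClassGroup.mk0_eq_one_iff] at h1
    exact h1.principal
  obtain ⟨a, ha⟩ := hsq
  set σ := ringConj e
  set n := Ideal.absNorm I
  have hn0 : (n : 𝓞 K) ≠ 0 := by
    exact_mod_cast fun h => hI0 (Ideal.absNorm_eq_zero_iff.1 h)
  have hna : a * σ a = (n : 𝓞 K) ^ 2 := by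
    rw [mul_ringConj_eq_absNorm e hm, ← ha, map_pow]; push_cast; rfl
  have hmapsq : (I.map σ) ^ 2 = Ideal.span {σ a} := by
    rw [← Ideal.map_pow, ha, Ideal.map_span]; simp
  have hmul : I * I.map σ = Ideal.span {(n : 𝓞 K)} := by
    have h1 : (I * I.map σ) ^ 2 = (Ideal.span {(n : 𝓞 K)}) ^ 2 := by
      rw [mul_pow, ha, hmapsq, Ideal.span_singleton_mul_span_singleton, hna,
        Ideal.span_singleton_pow]
    exact dvd_antisymm ((UniqueFactorizationMonoid.pow_dvd_pow_iff_dvd two_ne_zero).1 h1.dvd)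
      ((UniqueFactorizationMonoid.pow_dvd_pow_iff_dvd two_ne_zero).1 h1.symm.dvd)
  have hσσ : (I.map σ).map σ = I := by
    ext x
    constructor
    · intro hx
      obtain ⟨y, hy, rfl⟩ := (Ideal.mem_map_of_equiv σ x).1 hx
      obtain ⟨w, hw, rfl⟩ := (Ideal.mem_map_of_equiv σ y).1 hy
      rwa [ringConj_ringConj]
    · intro hx
      rw [← ringConj_ringConj e x]
      exact Ideal.mem_map_of_mem _ (Ideal.mem_map_of_mem _ hx)
  by_cases h0 : σ a + n = 0
  · have h1 : σ a = -(n : 𝓞 K) := eq_neg_of_add_eq_zero_left h0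
    have h2 : (I.map σ) * I.map σ = I * I.map σ := by
      rw [hmul, ← sq, hmapsq, h1, Ideal.span_singleton_neg]
    have h3 : I.map σ ≠ ⊥ := by
      intro h
      rw [h, Ideal.mul_bot, eq_comm, Ideal.span_singleton_eq_bot] at hmul
      exact hn0 hmul
    obtain ⟨x, hx⟩ := exists_eq_span_of_map_ringConj_eq e hD hDm (mul_right_cancel₀ h3 h2)
    exact hnp x hx
  · have h1 : (Ideal.span {σ a + n} * I).map σ = Ideal.span {σ a + n} * I := by
      have h2 : (Ideal.span {σ a + n} * I).map σ = Ideal.span {a + n} * I.map σ := by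
        rw [Ideal.map_mul, Ideal.map_span]
        simp [σ, ringConj_ringConj]
      rw [h2]
      apply mul_right_cancel₀ hI0
      rw [mul_assoc, mul_comm _ I, hmul, mul_assoc, ← sq, ha,
        Ideal.span_singleton_mul_span_singleton, Ideal.span_singleton_mul_span_singleton]
      congr 2
      linear_combination -hna
    obtain ⟨x, hx⟩ := exists_eq_span_of_map_ringConj_eq e hD hDm h1
    have h2 : σ a + n ∣ x := by
      rw [← Ideal.span_singleton_le_span_singleton, ← hx]
      exact Ideal.mul_le_left
    obtain ⟨y, rfl⟩ := h2
    rw [← Ideal.span_singleton_mul_span_singleton] at hx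
    exact hnp y (mul_left_cancel₀ (by simpa using h0) hx)

end

lemma Int.abs_card_Icc_sub_le {y t : ℝ} (hy : 0 ≤ y) :
    |((Finset.Icc ⌈-y - t⌉ ⌊y - t⌋).card : ℝ) - 2 * y| ≤ 1 := by
  have h1 := Int.lt_floor_add_one (y - t)
  have h2 := Int.ceil_lt_add_one (-y - t)
  have h3 := Int.floor_le (y - t)
  have h4 := Int.le_ceil (-y - t)
  have h5 : (-1 : ℝ) < ((⌊y - t⌋ + 1 - ⌈-y - t⌉ : ℤ) : ℝ) := by push_cast; linarith
  have h6 : 0 ≤ ⌊y - t⌋ + 1 - ⌈-y - t⌉ := by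
    have : (-1 : ℤ) < ⌊y - t⌋ + 1 - ⌈-y - t⌉ := by exact_mod_cast h5
    omega
  have h7 : ((Finset.Icc ⌈-y - t⌉ ⌊y - t⌋).card : ℝ) = ((⌊y - t⌋ + 1 - ⌈-y - t⌉ : ℤ) : ℝ) := by
    rw [Int.card_Icc, ← Int.cast_natCast, Int.toNat_of_nonneg h6]
  rw [h7, abs_le]
  push_cast
  constructor <;> linarith

lemma AntitoneOn.abs_sum_sub_integral_le {f : ℝ → ℝ} {v M : ℝ} (N : ℕ)
    (hf : AntitoneOn f (Set.Icc v (v + N))) (h0 : f (v + N) = 0) (hv : f v ≤ M) :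
    (∫ x in v..v + N, f x) ≤ ∑ i ∈ Finset.range N, f (v + i) ∧
      ∑ i ∈ Finset.range N, f (v + i) ≤ (∫ x in v..v + N, f x) + M := by
  refine ⟨hf.integral_le_sum, ?_⟩
  have h1 := hf.sum_le_integral
  have h2 := Finset.sum_range_succ (fun i : ℕ => f (v + i)) N
  have h3 := Finset.sum_range_succ' (fun i : ℕ => f (v + i)) N
  rw [h2] at h3
  simp only [h0, add_zero, Nat.cast_zero] at h3
  linarith

lemma integral_sqrt_sub_sq {c R A B : ℝ} (hc : 0 < c) (hR : 0 < R) (hA : R ≤ c * A) (hB : R ≤ c * B) :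
    ∫ x in -A..B, √(R ^ 2 - c ^ 2 * x ^ 2) = Real.pi * R ^ 2 / (2 * c) := by
  have h1 : ∀ x, √(R ^ 2 - c ^ 2 * x ^ 2) = R * √(1 - (c / R * x) ^ 2) := fun x => by
    rw [← Real.sqrt_sq hR.le, ← Real.sqrt_mul (sq_nonneg _), Real.sqrt_sq hR.le]
    congr 1
    field_simp
  simp_rw [h1]
  have hcR : 0 < c / R := by positivity
  rw [intervalIntegral.integral_const_mul,
    intervalIntegral.integral_comp_mul_left (fun x => √(1 - x ^ 2)) hcR.ne']
  have hInt : ∀ a b, IntervalIntegrable (fun x : ℝ => √(1 - x ^ 2)) MeasureTheory.volume a b :=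
    fun a b => (by fun_prop : Continuous fun x : ℝ => √(1 - x ^ 2)).intervalIntegrable a b
  have hz : ∀ a b : ℝ, (∀ x ∈ Set.uIcc a b, 1 ≤ x ^ 2) → ∫ x in a..b, √(1 - x ^ 2) = 0 :=
    fun a b h => intervalIntegral.integral_zero_ae (Filter.Eventually.of_forall fun x hx =>
      Real.sqrt_eq_zero_of_nonpos (by linarith [h x (Set.uIoc_subset_uIcc hx)]))
  have hA' : 1 ≤ c / R * A := by rw [div_mul_eq_mul_div, le_div_iff₀ hR]; linarith
  have hB' : 1 ≤ c / R * B := by rw [div_mul_eq_mul_div, le_div_iff₀ hR]; linarith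
  rw [← intervalIntegral.integral_add_adjacent_intervals (hInt _ (-1)) (hInt (-1) _),
    ← intervalIntegral.integral_add_adjacent_intervals (hInt (-1) 1) (hInt 1 _),
    integral_sqrt_one_sub_sq, hz _ (-1), hz 1]
  · simp
    field_simp
  · intro x hx
    rw [Set.uIcc_of_le hB'] at hx
    nlinarith [hx.1]
  · intro x hx
    rw [Set.uIcc_of_le (by linarith)] at hx
    nlinarith [hx.2]

lemma abs_sum_sqrt_sub_le_of_mem {v c R : ℝ} (hc : 0 < c) (hR : 0 < R) (hv0 : 0 ≤ v) (hv1 : v ≤ 1)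
    {N : ℕ} (hN : R ≤ c * N) :
    |∑ b ∈ Finset.Ico (-N : ℤ) N, √(R ^ 2 - c ^ 2 * (b + v) ^ 2) - Real.pi * R ^ 2 / (2 * c)| ≤
      2 * R := by
  set f : ℝ → ℝ := fun x => √(R ^ 2 - c ^ 2 * x ^ 2) with hf
  have hfR : ∀ x, f x ≤ R := fun x => by
    rw [hf, ← Real.sqrt_sq hR.le]
    refine (Real.sqrt_le_sqrt ?_).trans (by rw [Real.sqrt_sq hR.le])
    rw [Real.sqrt_sq hR.le]
    nlinarith [mul_nonneg (sq_nonneg c) (sq_nonneg x)]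
  have hf0 : ∀ x, 0 ≤ f x := fun x => Real.sqrt_nonneg _
  have hanti : ∀ w : ℝ, 0 ≤ w → AntitoneOn f (Set.Icc w (w + N)) := by
    intro w hw x hx y hy hxy
    apply Real.sqrt_le_sqrt
    have : x ^ 2 ≤ y ^ 2 := pow_le_pow_left₀ (hw.trans hx.1) hxy 2
    nlinarith [sq_nonneg c]
  have hzero : ∀ w : ℝ, 0 ≤ w → f (w + N) = 0 := fun w hw => by
    apply Real.sqrt_eq_zero_of_nonpos
    have h1 : R ≤ c * (w + N) := by nlinarith
    nlinarith [mul_self_le_mul_self hR.le h1]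
  obtain ⟨a1, a2⟩ := (hanti v hv0).abs_sum_sub_integral_le N (hzero v hv0) (hfR v)
  have hv' : 0 ≤ 1 - v := by linarith
  obtain ⟨b1, b2⟩ := (hanti (1 - v) hv').abs_sum_sub_integral_le N (hzero _ hv') (hfR _)
  have hInt : ∀ a b, IntervalIntegrable f MeasureTheory.volume a b :=
    fun a b => (by fun_prop : Continuous f).intervalIntegrable a b
  have hsplit : ∑ b ∈ Finset.Ico (-N : ℤ) N, f (b + v) =
      ∑ i ∈ Finset.range N, f (v + i) + ∑ i ∈ Finset.range N, f (1 - v + i) := by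
    rw [← Finset.Ico_union_Ico_eq_Ico (show (-N : ℤ) ≤ 0 by omega) (show (0 : ℤ) ≤ N by omega),
      Finset.sum_union (Finset.Ico_disjoint_Ico_consecutive _ _ _), add_comm]
    congr 1
    · symm
      refine Finset.sum_bij (fun (i : ℕ) _ => (i : ℤ)) ?_ ?_ ?_ ?_
      · intro i hi; simpa using hi
      · intro i _ j _ h; exact_mod_cast h
      · intro b hb
        rw [Finset.mem_Ico] at hb
        exact ⟨b.toNat, by simp; omega, by simp; omega⟩
      · intro i _; simp [add_comm]
    · symm
      refine Finset.sum_bij (fun (i : ℕ) _ => -1 - (i : ℤ)) ?_ ?_ ?_ ?_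
      · intro i hi; simp at hi ⊢; omega
      · intro i _ j _ h; simpa using h
      · intro b hb
        rw [Finset.mem_Ico] at hb
        exact ⟨(-1 - b).toNat, by simp; omega, by omega⟩
      · intro i _
        simp only [hf]
        push_cast
        congr 3
        ring
  have hneg : ∫ x in (1 - v)..(1 - v + N), f x = ∫ x in -(1 - v + N)..-(1 - v), f x := by
    rw [← intervalIntegral.integral_comp_neg]
    simp [hf]
  have htot := integral_sqrt_sub_sq hc hR (A := 1 - v + N) (B := v + N) (by nlinarith) (by nlinarith)
  change ∫ x in -(1 - v + N)..v + N, f x = _ at htot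
  rw [← intervalIntegral.integral_add_adjacent_intervals (hInt _ (-(1 - v))) (hInt (-(1 - v)) _),
    ← intervalIntegral.integral_add_adjacent_intervals (hInt (-(1 - v)) v) (hInt v _),
    ← hneg] at htot
  have hmid0 : 0 ≤ ∫ x in -(1 - v)..v, f x :=
    intervalIntegral.integral_nonneg (by linarith) fun x _ => hf0 x
  have hmid1 : ∫ x in -(1 - v)..v, f x ≤ R := by
    have h1 := intervalIntegral.integral_mono_on (a := -(1 - v)) (b := v) (by linarith)
      (hInt (-(1 - v)) v) (intervalIntegrable_const (c := R)) fun x _ => hfR x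
    rw [intervalIntegral.integral_const] at h1
    refine h1.trans (le_of_eq ?_)
    rw [smul_eq_mul]; ring
  change |∑ b ∈ Finset.Ico (-N : ℤ) N, f (b + v) - _| ≤ _
  rw [hsplit, ← htot, abs_le]
  constructor <;> linarith

lemma ncard_ellipse_of_mem (t : ℤ → ℝ) {v c R : ℝ} (hc : 1 ≤ c) (hR : 0 < R) (hv0 : 0 ≤ v)
    (hv1 : v ≤ 1) :
    {p : ℤ × ℤ | (p.2 + t p.1) ^ 2 + c ^ 2 * (p.1 + v) ^ 2 ≤ R ^ 2}.Finite ∧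
      |({p : ℤ × ℤ | (p.2 + t p.1) ^ 2 + c ^ 2 * (p.1 + v) ^ 2 ≤ R ^ 2}.ncard : ℝ) -
        Real.pi * R ^ 2 / c| ≤ 6 * R + 1 := by
  have hc0 : 0 < c := by linarith
  obtain ⟨N, hN1⟩ := exists_nat_ge (R + 1)
  have hN : R ≤ c * N := by nlinarith
  set f : ℝ → ℝ := fun x => √(R ^ 2 - c ^ 2 * x ^ 2) with hf
  have hmem : ∀ a b : ℤ, (a + t b) ^ 2 + c ^ 2 * (b + v) ^ 2 ≤ R ^ 2 ↔
      |(b : ℝ) + v| ≤ R / c ∧ |(a : ℝ) + t b| ≤ f (b + v) := by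
    intro a b
    have h0 : |(b : ℝ) + v| ≤ R / c ↔ 0 ≤ R ^ 2 - c ^ 2 * (b + v) ^ 2 := by
      rw [le_div_iff₀ hc0, ← abs_of_pos hc0, ← abs_mul, ← abs_of_pos hR, ← sq_le_sq, abs_of_pos hR,
        abs_of_pos hc0, sub_nonneg, mul_pow, mul_comm]
    rw [h0]
    constructor
    · intro h
      have h1 : 0 ≤ R ^ 2 - c ^ 2 * (b + v) ^ 2 := by nlinarith [sq_nonneg ((a : ℝ) + t b)]
      exact ⟨h1, Real.abs_le_sqrt (by linarith)⟩
    · rintro ⟨h1, h2⟩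
      have h3 := (Real.le_sqrt (abs_nonneg _) h1).1 h2
      rw [sq_abs] at h3
      linarith
  let A : ℤ → Finset ℤ := fun b =>
    if |(b : ℝ) + v| ≤ R / c then Finset.Icc ⌈-f (b + v) - t b⌉ ⌊f (b + v) - t b⌋ else ∅
  have hA : ∀ a b, a ∈ A b ↔ (a + t b) ^ 2 + c ^ 2 * (b + v) ^ 2 ≤ R ^ 2 := by
    intro a b
    rw [hmem]
    by_cases h : |(b : ℝ) + v| ≤ R / c
    · have h' : A b = Finset.Icc ⌈-f (b + v) - t b⌉ ⌊f (b + v) - t b⌋ := if_pos h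
      rw [h', Finset.mem_Icc, Int.ceil_le, Int.le_floor, and_iff_right h, abs_le]
      constructor <;> rintro ⟨h1, h2⟩ <;> constructor <;> linarith
    · simp [A, h]
  have hRc : R / c ≤ R := div_le_self hR.le hc
  let S : Finset (ℤ × ℤ) := ((Finset.Ico (-N : ℤ) N).sigma A).map
    (Equiv.sigmaEquivProd ℤ ℤ).toEmbedding
  have hS : {p : ℤ × ℤ | (p.2 + t p.1) ^ 2 + c ^ 2 * (p.1 + v) ^ 2 ≤ R ^ 2} = S := by
    ext ⟨b, a⟩
    have h1 : (b, a) ∈ S ↔ b ∈ Finset.Ico (-N : ℤ) N ∧ a ∈ A b := by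
      simp only [S, Finset.mem_map_equiv]
      simp
    rw [Finset.mem_coe, h1, hA, Set.mem_ofPred_eq]
    refine ⟨fun h => ⟨?_, h⟩, fun h => h.2⟩
    have h2 := abs_le.1 (((hmem a b).1 h).1.trans hRc)
    rw [Finset.mem_Ico]
    constructor
    · have : (-N : ℝ) ≤ b := by linarith
      exact_mod_cast this
    · have : (b : ℝ) < N := by linarith
      exact_mod_cast this
  rw [hS]
  refine ⟨S.finite_toSet, ?_⟩
  rw [Set.ncard_coe_finset, Finset.card_map, Finset.card_sigma]
  push_cast
  have h1 := abs_sum_sqrt_sub_le_of_mem hc0 hR hv0 hv1 hN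
  have h2 : |∑ b ∈ Finset.Ico (-N : ℤ) N, (((A b).card : ℝ) - 2 * f (b + v))| ≤ 2 * R + 1 := by
    refine (Finset.abs_sum_le_sum_abs _ _).trans ?_
    have h3 : ∀ b : ℤ, |((A b).card : ℝ) - 2 * f (b + v)| ≤
        if |(b : ℝ) + v| ≤ R / c then 1 else 0 := by
      intro b
      by_cases h : |(b : ℝ) + v| ≤ R / c
      · simp only [A, if_pos h]
        exact Int.abs_card_Icc_sub_le (Real.sqrt_nonneg _)
      · have h4 : f (b + v) = 0 := by
          apply Real.sqrt_eq_zero_of_nonpos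
          rw [not_le, div_lt_iff₀ hc0] at h
          have h5 := mul_self_le_mul_self hR.le h.le
          have h6 := sq_abs ((b : ℝ) + v)
          nlinarith
        simp [A, if_neg h, h4]
    refine (Finset.sum_le_sum fun b _ => h3 b).trans ?_
    rw [← Finset.sum_filter, Finset.sum_const, nsmul_eq_mul, mul_one]
    have h4 : (Finset.Ico (-N : ℤ) N).filter (fun b : ℤ => |(b : ℝ) + v| ≤ R / c) ⊆
        Finset.Icc ⌈-(R / c) - v⌉ ⌊R / c - v⌋ := by
      intro b hb
      have := abs_le.1 (Finset.mem_filter.1 hb).2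
      rw [Finset.mem_Icc, Int.ceil_le, Int.le_floor]
      constructor <;> linarith
    have h5 : (((Finset.Ico (-N : ℤ) N).filter (fun b : ℤ => |(b : ℝ) + v| ≤ R / c)).card : ℝ) ≤
        ((Finset.Icc ⌈-(R / c) - v⌉ ⌊R / c - v⌋).card : ℝ) := by
      exact_mod_cast Finset.card_le_card h4
    have h6 := abs_le.1 (Int.abs_card_Icc_sub_le (y := R / c) (t := v) (by positivity))
    linarith
  rw [Finset.sum_sub_distrib, ← Finset.mul_sum] at h2
  have h3 : Real.pi * R ^ 2 / c = 2 * (Real.pi * R ^ 2 / (2 * c)) := by field_simp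
  rw [h3]
  have h1' := abs_le.1 h1
  have h2' := abs_le.1 h2
  rw [abs_le]
  constructor <;> linarith

/-- Lattice points in a shifted, sheared ellipse. -/
theorem ncard_ellipse (t : ℤ → ℝ) (v : ℝ) {c R : ℝ} (hc : 1 ≤ c) (hR : 0 < R) :
    {p : ℤ × ℤ | (p.2 + t p.1) ^ 2 + c ^ 2 * (p.1 + v) ^ 2 ≤ R ^ 2}.Finite ∧
      |({p : ℤ × ℤ | (p.2 + t p.1) ^ 2 + c ^ 2 * (p.1 + v) ^ 2 ≤ R ^ 2}.ncard : ℝ) -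
        Real.pi * R ^ 2 / c| ≤ 6 * R + 1 := by
  have h := ncard_ellipse_of_mem (fun b => t (b - ⌊v⌋)) (v := Int.fract v) hc hR (Int.fract_nonneg v)
    (Int.fract_lt_one v).le
  have himg : {p : ℤ × ℤ | (p.2 + t p.1) ^ 2 + c ^ 2 * (p.1 + v) ^ 2 ≤ R ^ 2} =
      ((Equiv.subRight ⌊v⌋).prodCongr (Equiv.refl ℤ)) '' {p : ℤ × ℤ |
        (p.2 + t (p.1 - ⌊v⌋)) ^ 2 + c ^ 2 * (p.1 + Int.fract v) ^ 2 ≤ R ^ 2} := by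
    rw [Equiv.image_eq_preimage_symm]
    ext ⟨b, a⟩
    have h1 : ((b + ⌊v⌋ : ℤ) : ℝ) + Int.fract v = b + v := by
      push_cast
      linarith [Int.floor_add_fract v]
    have h2 : b + ⌊v⌋ - ⌊v⌋ = b := by ring
    simp only [Set.mem_preimage, Set.mem_ofPred_eq]
    change _ ↔ ((a : ℝ) + t (b + ⌊v⌋ - ⌊v⌋)) ^ 2 + c ^ 2 * (((b + ⌊v⌋ : ℤ) : ℝ) + Int.fract v) ^ 2
      ≤ R ^ 2
    rw [h1, h2]
  rw [himg, Set.ncard_image_of_injective _ (Equiv.injective _)]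
  exact ⟨h.1.image _, h.2⟩

lemma AddSubgroup.abs_ncard_sub_relIndex_mul_le {A : Type*} [AddCommGroup A] {H J : AddSubgroup A}
    (hHJ : H ≤ J) (hidx : H.relIndex J ≠ 0) {S : Set A} {a E : ℝ}
    (hfin : ∀ r ∈ J, {x ∈ S | x - r ∈ H}.Finite)
    (h : ∀ r ∈ J, |({x ∈ S | x - r ∈ H}.ncard : ℝ) - a| ≤ E) :
    {x ∈ S | x ∈ J}.Finite ∧
      |({x ∈ S | x ∈ J}.ncard : ℝ) - H.relIndex J * a| ≤ H.relIndex J * E := by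
  have hcard : Nat.card (J ⧸ H.addSubgroupOf J) = H.relIndex J := rfl
  have : Finite (J ⧸ H.addSubgroupOf J) := Nat.finite_of_card_ne_zero (hcard ▸ hidx)
  have := Fintype.ofFinite (J ⧸ H.addSubgroupOf J)
  rw [Nat.card_eq_fintype_card] at hcard
  let F : A → J ⧸ H.addSubgroupOf J := fun x =>
    if hx : x ∈ J then QuotientAddGroup.mk ⟨x, hx⟩ else 0
  have hF : ∀ r : J, {x ∈ S | x ∈ J ∧ F x = QuotientAddGroup.mk r} = {x ∈ S | x - r ∈ H} := by
    intro r
    ext x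
    simp only [Set.mem_ofPred_eq]
    refine and_congr_right fun _ => ⟨?_, ?_⟩
    · rintro ⟨h1, h2⟩
      simp only [F, dif_pos h1] at h2
      rw [eq_comm, QuotientAddGroup.eq, AddSubgroup.mem_addSubgroupOf] at h2
      simpa [sub_eq_neg_add] using h2
    · intro h1
      have h2 : x ∈ J := by
        have := J.add_mem (hHJ h1) r.2
        simpa using this
      refine ⟨h2, ?_⟩
      simp only [F, dif_pos h2]
      rw [eq_comm, QuotientAddGroup.eq, AddSubgroup.mem_addSubgroupOf]
      simpa [sub_eq_neg_add] using h1
  have hU : {x ∈ S | x ∈ J} = ⋃ q, {x ∈ S | x ∈ J ∧ F x = q} := by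
    ext x
    simp +contextual
  have hfin' : ∀ q, {x ∈ S | x ∈ J ∧ F x = q}.Finite := by
    intro q
    obtain ⟨r, rfl⟩ := QuotientAddGroup.mk_surjective q
    rw [hF]
    exact hfin r r.2
  have hT : {x ∈ S | x ∈ J}.Finite := by
    rw [hU]; exact Set.finite_iUnion hfin'
  refine ⟨hT, ?_⟩
  have hsum : {x ∈ S | x ∈ J}.ncard = ∑ q, {x ∈ S | x ∈ J ∧ F x = q}.ncard := by
    rw [Set.ncard_eq_toFinset_card _ hT,
      Finset.card_eq_sum_card_fiberwise (f := F) (t := Finset.univ) (fun _ _ => by simp)]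
    refine Finset.sum_congr rfl fun q _ => ?_
    rw [← Set.ncard_coe_finset]
    congr 1
    ext x
    simp [and_assoc]
  rw [hsum, ← hcard, ← nsmul_eq_mul, ← nsmul_eq_mul, ← Finset.card_univ, ← Finset.sum_const,
    ← Finset.sum_const]
  push_cast
  rw [← Finset.sum_sub_distrib]
  refine (Finset.abs_sum_le_sum_abs _ _).trans (Finset.sum_le_sum fun q _ => ?_)
  obtain ⟨r, rfl⟩ := QuotientAddGroup.mk_surjective q
  rw [hF]
  exact h r r.2

section

variable {m : ℤ} {K : Type} [Field K] [NumberField K]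

lemma absNorm_span_ringEquiv_real (e : QuadraticAlgebra ℤ (-m) 1 ≃+* 𝓞 K)
    (hm : 1 ≤ m) {D : ℕ} (hDm : (D : ℤ) = 4 * m - 1)
    (z : QuadraticAlgebra ℤ (-m) 1) : (Ideal.absNorm (Ideal.span {e z}) : ℝ) =
      (z.re + z.im / 2) ^ 2 + (√D / 2) ^ 2 * z.im ^ 2 := by
  have h0 : 0 ≤ z.norm := by
    rcases eq_or_ne z 0 with rfl | h
    · simp
    · exact (QuadraticAlgebra.norm_ne_zero_int hm h).le
  have hD : (D : ℝ) = 4 * (m : ℝ) - 1 := by exact_mod_cast congrArg (Int.cast : ℤ → ℝ) hDm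
  rw [absNorm_span_ringEquiv, Nat.cast_natAbs, abs_of_nonneg h0, QuadraticAlgebra.norm_def, div_pow,
    Real.sq_sqrt (Nat.cast_nonneg _), hD]
  push_cast
  ring

lemma relIndex_span_absNorm {J : Ideal (𝓞 K)} (hJ : J ≠ ⊥) (e : QuadraticAlgebra ℤ (-m) 1 ≃+* 𝓞 K) :
    (Ideal.span {(Ideal.absNorm J : 𝓞 K)}).toAddSubgroup.relIndex J.toAddSubgroup =
      Ideal.absNorm J := by
  have h1 : (Ideal.span {(Ideal.absNorm J : 𝓞 K)}).toAddSubgroup ≤ J.toAddSubgroup :=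
    (Ideal.span_singleton_le_iff_mem _).2 (Ideal.absNorm_mem J)
  have h2 := AddSubgroup.relIndex_mul_index h1
  have h3 : ∀ I : Ideal (𝓞 K), I.toAddSubgroup.index = Ideal.absNorm I := fun I => rfl
  have h4 : Ideal.absNorm (Ideal.span {(Ideal.absNorm J : 𝓞 K)}) = Ideal.absNorm J ^ 2 := by
    rw [← map_natCast e, absNorm_span_ringEquiv, QuadraticAlgebra.norm_natCast, Int.natAbs_pow,
      Int.natAbs_natCast]
  rw [h3, h3, h4, sq] at h2
  exact Nat.eq_of_mul_eq_mul_right (Nat.pos_of_ne_zero fun h => hJ (Ideal.absNorm_eq_zero_iff.1 h)) h2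

/-- Elements of bounded norm in an ideal of an imaginary quadratic field. -/
theorem ncard_mem_ideal_absNorm_le (e : QuadraticAlgebra ℤ (-m) 1 ≃+* 𝓞 K)
    (hm : 2 ≤ m) {D : ℕ} (hDm : (D : ℤ) = 4 * m - 1)
    {J : Ideal (𝓞 K)} (hJ : J ≠ ⊥) {R : ℝ} (hR : 0 < R) :
    {x ∈ {x : 𝓞 K | (Ideal.absNorm (Ideal.span {x}) : ℝ) ≤ (Ideal.absNorm J * R) ^ 2} |
        x ∈ J}.Finite ∧
      |({x ∈ {x : 𝓞 K | (Ideal.absNorm (Ideal.span {x}) : ℝ) ≤ (Ideal.absNorm J * R) ^ 2} |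
        x ∈ J}.ncard : ℝ) - Ideal.absNorm J * (Real.pi * R ^ 2 / (√D / 2))| ≤
        Ideal.absNorm J * (6 * R + 1) := by
  have hn : Ideal.absNorm J ≠ 0 := fun h => hJ (Ideal.absNorm_eq_zero_iff.1 h)
  have hn' : (0 : ℝ) < Ideal.absNorm J := by exact_mod_cast Nat.pos_of_ne_zero hn
  have hc : 1 ≤ √(D : ℝ) / 2 := by
    have h1 : (4 : ℝ) ≤ D := by
      have : (4 : ℤ) ≤ D := by omega
      exact_mod_cast this
    have h2 : (2 : ℝ) ≤ √D := Real.le_sqrt_of_sq_le (by linarith)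
    linarith
  have hle : (Ideal.span {(Ideal.absNorm J : 𝓞 K)}).toAddSubgroup ≤ J.toAddSubgroup :=
    (Ideal.span_singleton_le_iff_mem _).2 (Ideal.absNorm_mem J)
  have hidx := relIndex_span_absNorm hJ e
  set n := Ideal.absNorm J
  have key : ∀ r : 𝓞 K, ∃ (t : ℤ → ℝ) (v : ℝ) (g : ℤ × ℤ → 𝓞 K), Function.Injective g ∧
      {x ∈ {x : 𝓞 K | (Ideal.absNorm (Ideal.span {x}) : ℝ) ≤ (n * R) ^ 2} |
        x - r ∈ (Ideal.span {(n : 𝓞 K)}).toAddSubgroup} =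
      g '' {p : ℤ × ℤ | (p.2 + t p.1) ^ 2 + (√D / 2) ^ 2 * (p.1 + v) ^ 2 ≤ R ^ 2} := by
    intro r
    obtain ⟨w, rfl⟩ := e.surjective r
    refine ⟨fun b => b / 2 + (w.re + w.im / 2) / n, w.im / n,
      fun p => e (w + n * ⟨p.2, p.1⟩), ?_, ?_⟩
    · rintro ⟨b, a⟩ ⟨b', a'⟩ h
      have h1 := add_left_cancel (e.injective h)
      have h2 := congrArg QuadraticAlgebra.re h1
      have h3 := congrArg QuadraticAlgebra.im h1
      simp [hn] at h2 h3
      simp [h2, h3]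
    · have hiff : ∀ p : ℤ × ℤ, (Ideal.absNorm (Ideal.span {e (w + n * ⟨p.2, p.1⟩)}) : ℝ) ≤
          (n * R) ^ 2 ↔ (p.2 + (p.1 / 2 + (w.re + w.im / 2) / n)) ^ 2 +
            (√(D : ℝ) / 2) ^ 2 * (p.1 + w.im / n) ^ 2 ≤ R ^ 2 := by
        intro p
        rw [absNorm_span_ringEquiv_real e (by linarith) hDm]
        have h1 : (((w + n * ⟨p.2, p.1⟩ : QuadraticAlgebra ℤ (-m) 1).re : ℤ) : ℝ) =
            w.re + n * p.2 := by simp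
        have h2 : (((w + n * ⟨p.2, p.1⟩ : QuadraticAlgebra ℤ (-m) 1).im : ℤ) : ℝ) =
            w.im + n * p.1 := by simp
        have hX : ((w.re + n * p.2 : ℝ) + (w.im + n * p.1) / 2) ^ 2 +
            (√(D : ℝ) / 2) ^ 2 * (w.im + n * p.1) ^ 2 =
            n ^ 2 * ((p.2 + (p.1 / 2 + (w.re + w.im / 2) / n)) ^ 2 +
              (√(D : ℝ) / 2) ^ 2 * (p.1 + w.im / n) ^ 2) := by
          field_simp
          ring
        rw [h1, h2, hX, mul_pow]
        exact mul_le_mul_iff_right₀ (pow_pos hn' 2)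
      ext x
      simp only [Set.mem_ofPred_eq, Set.mem_image, Submodule.mem_toAddSubgroup]
      constructor
      · rintro ⟨h1, h2⟩
        obtain ⟨y, hy⟩ := Ideal.mem_span_singleton.1 h2
        obtain ⟨z, rfl⟩ := e.surjective y
        have h3 : x = e (w + n * ⟨z.re, z.im⟩) := by
          rw [map_add, map_mul, map_natCast, ← hy]; ring
        exact ⟨(z.im, z.re), (hiff _).1 (h3 ▸ h1), h3.symm⟩
      · rintro ⟨p, hp, rfl⟩
        refine ⟨(hiff p).2 hp, Ideal.mem_span_singleton.2 ⟨e ⟨p.2, p.1⟩, ?_⟩⟩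
        rw [map_add, map_mul, map_natCast]; ring
  have hmain := AddSubgroup.abs_ncard_sub_relIndex_mul_le
    (S := {x : 𝓞 K | (Ideal.absNorm (Ideal.span {x}) : ℝ) ≤ (n * R) ^ 2})
    (a := Real.pi * R ^ 2 / (√D / 2)) (E := 6 * R + 1) hle (by rw [hidx]; exact hn) ?_ ?_
  · rw [hidx] at hmain
    exact hmain
  · intro r _
    obtain ⟨t, v, g, hg, h⟩ := key r
    rw [h]
    exact (ncard_ellipse t v hc hR).1.image _
  · intro r _
    obtain ⟨t, v, g, hg, h⟩ := key r
    rw [h, Set.ncard_image_of_injective _ hg]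
    exact (ncard_ellipse t v hc hR).2

end

lemma ClassGroup.mk0_mul_mk0_eq_one_iff {R : Type*} [CommRing R] [IsDedekindDomain R]
    (I J : nonZeroDivisors (Ideal R)) : ClassGroup.mk0 I * ClassGroup.mk0 J = 1 ↔
      ∃ y, (I : Ideal R) * (J : Ideal R) = Ideal.span {y} := by
  rw [← map_mul, ClassGroup.mk0_eq_one_iff (I * J).2, Submodule.isPrincipal_iff]
  rfl

section

variable {m : ℤ} {K : Type} [Field K] [NumberField K]

lemma exists_mk0_eq_absNorm_le (e : QuadraticAlgebra ℤ (-m) 1 ≃+* 𝓞 K) (hm : 1 ≤ m)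
    (g : ClassGroup (𝓞 K)) :
    ∃ J : nonZeroDivisors (Ideal (𝓞 K)), ClassGroup.mk0 J = g ∧
      (Ideal.absNorm (J : Ideal (𝓞 K)) : ℤ) ≤ m + 2 := by
  obtain ⟨I, hI⟩ := ClassGroup.mk0_surjective g⁻¹
  have hI0 : (I : Ideal (𝓞 K)) ≠ ⊥ := nonZeroDivisors.coe_ne_zero I
  set n := Ideal.absNorm (I : Ideal (𝓞 K)) with hn
  have hn0 : n ≠ 0 := fun h => hI0 (Ideal.absNorm_eq_zero_iff.1 h)
  have hcard : Nat.card (𝓞 K ⧸ (I : Ideal (𝓞 K))) = n := rfl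
  have : Finite (𝓞 K ⧸ (I : Ideal (𝓞 K))) := Nat.finite_of_card_ne_zero (hcard ▸ hn0)
  have := Fintype.ofFinite (𝓞 K ⧸ (I : Ideal (𝓞 K)))
  set k := n.sqrt
  have hlt : Fintype.card (𝓞 K ⧸ (I : Ideal (𝓞 K))) < Fintype.card (Fin (k + 1) × Fin (k + 1)) := by
    rw [← Nat.card_eq_fintype_card, hcard, Fintype.card_prod, Fintype.card_fin]
    exact Nat.lt_succ_sqrt n
  obtain ⟨p, p', hpp, heq⟩ := Fintype.exists_ne_map_eq_of_card_lt
    (fun p : Fin (k + 1) × Fin (k + 1) => Ideal.Quotient.mk (I : Ideal (𝓞 K))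
      (e ⟨((p.1 : ℕ) : ℤ), ((p.2 : ℕ) : ℤ)⟩)) hlt
  rw [Ideal.Quotient.eq, ← map_sub] at heq
  set z : QuadraticAlgebra ℤ (-m) 1 := ⟨((p.1 : ℕ) : ℤ), ((p.2 : ℕ) : ℤ)⟩ -
    ⟨((p'.1 : ℕ) : ℤ), ((p'.2 : ℕ) : ℤ)⟩ with hz
  have hre : z.re = ((p.1 : ℕ) : ℤ) - ((p'.1 : ℕ) : ℤ) := by simp [hz]
  have him : z.im = ((p.2 : ℕ) : ℤ) - ((p'.2 : ℕ) : ℤ) := by simp [hz]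
  have hz0 : z ≠ 0 := by
    intro h
    rw [h] at hre him
    simp only [QuadraticAlgebra.re_zero, QuadraticAlgebra.im_zero] at hre him
    apply hpp
    ext <;> omega
  have h1 : |z.re| ≤ k := by rw [abs_le]; omega
  have h2 : |z.im| ≤ k := by rw [abs_le]; omega
  have hk : (k : ℤ) * k ≤ n := by exact_mod_cast Nat.sqrt_le n
  have hN : z.norm ≤ n * (m + 2) := by
    have h3 : z.re * z.re ≤ k * k := by rw [← abs_mul_abs_self]; gcongr
    have h4 : z.im * z.im ≤ k * k := by rw [← abs_mul_abs_self]; gcongr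
    rw [QuadraticAlgebra.norm_def]
    nlinarith [sq_nonneg (z.re - z.im)]
  obtain ⟨J, hJ⟩ := Ideal.dvd_span_singleton.2 heq
  have hez : Ideal.span {e z} ≠ (⊥ : Ideal (𝓞 K)) := by
    rw [Ne, Ideal.span_singleton_eq_bot]
    simpa using hz0
  have hJ0 : J ∈ nonZeroDivisors (Ideal (𝓞 K)) := by
    rw [mem_nonZeroDivisors_iff_ne_zero]
    rintro rfl
    exact hez (by simp [hJ])
  refine ⟨⟨J, hJ0⟩, ?_, ?_⟩
  · have h5 := (ClassGroup.mk0_mul_mk0_eq_one_iff I ⟨J, hJ0⟩).2 ⟨e z, hJ.symm⟩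
    rw [hI] at h5
    exact (inv_mul_eq_one.1 h5).symm
  · have h6 := congrArg Ideal.absNorm hJ
    rw [absNorm_span_ringEquiv, map_mul, ← hn] at h6
    have h7 : (n : ℤ) * (Ideal.absNorm J : ℤ) = z.norm := by
      rw [← Nat.cast_mul, ← h6, Int.natCast_natAbs,
        abs_of_nonneg (QuadraticAlgebra.norm_ne_zero_int hm hz0).le]
    rw [← h7] at hN
    exact le_of_mul_le_mul_left hN (by positivity)

lemma finite_mk0_eq_absNorm_le (g : ClassGroup (𝓞 K)) (x : ℝ) :
    {I : nonZeroDivisors (Ideal (𝓞 K)) | ClassGroup.mk0 I = g ∧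
      (Ideal.absNorm (I : Ideal (𝓞 K)) : ℝ) ≤ x}.Finite := by
  refine Set.Finite.of_finite_image (f := Subtype.val)
    ((Ideal.finite_setOfPred_absNorm_le ⌊x⌋₊).subset ?_) Subtype.val_injective.injOn
  rintro _ ⟨I, ⟨-, hI⟩, rfl⟩
  exact Nat.le_floor hI

lemma two_mul_ncard_mk0_add_one (e : QuadraticAlgebra ℤ (-m) 1 ≃+* 𝓞 K) (hm : 2 ≤ m)
    (J : nonZeroDivisors (Ideal (𝓞 K))) {x : ℝ} (hx : 0 ≤ x)
    (hfin : {y ∈ {y : 𝓞 K | (Ideal.absNorm (Ideal.span {y}) : ℝ) ≤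
      Ideal.absNorm (J : Ideal (𝓞 K)) * x} | y ∈ (J : Ideal (𝓞 K))}.Finite) :
    2 * {I : nonZeroDivisors (Ideal (𝓞 K)) | ClassGroup.mk0 I = (ClassGroup.mk0 J)⁻¹ ∧
      (Ideal.absNorm (I : Ideal (𝓞 K)) : ℝ) ≤ x}.ncard + 1 =
    {y ∈ {y : 𝓞 K | (Ideal.absNorm (Ideal.span {y}) : ℝ) ≤
      Ideal.absNorm (J : Ideal (𝓞 K)) * x} | y ∈ (J : Ideal (𝓞 K))}.ncard := by
  have hJ0 : (J : Ideal (𝓞 K)) ≠ ⊥ := nonZeroDivisors.coe_ne_zero J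
  have hn : (0 : ℝ) < Ideal.absNorm (J : Ideal (𝓞 K)) := by
    exact_mod_cast Nat.pos_of_ne_zero fun h => hJ0 (Ideal.absNorm_eq_zero_iff.1 h)
  set T := {y ∈ {y : 𝓞 K | (Ideal.absNorm (Ideal.span {y}) : ℝ) ≤
      Ideal.absNorm (J : Ideal (𝓞 K)) * x} | y ∈ (J : Ideal (𝓞 K))} with hT
  have hS := finite_mk0_eq_absNorm_le (ClassGroup.mk0 J)⁻¹ x
  set S := {I : nonZeroDivisors (Ideal (𝓞 K)) | ClassGroup.mk0 I = (ClassGroup.mk0 J)⁻¹ ∧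
      (Ideal.absNorm (I : Ideal (𝓞 K)) : ℝ) ≤ x} with hSdef
  have h0 : (0 : 𝓞 K) ∈ T := by
    refine ⟨?_, Ideal.zero_mem _⟩
    simp only [Set.mem_ofPred_eq, Ideal.span_singleton_eq_bot.2, Ideal.absNorm_bot, Nat.cast_zero]
    positivity
  rw [← Set.ncard_sdiff_singleton_add_one h0 hfin]
  congr 1
  have hex : ∀ y ∈ T \ {0}, ∃ I ∈ S, Ideal.span {y} = (J : Ideal (𝓞 K)) * (I : Ideal (𝓞 K)) := by
    rintro y ⟨⟨hy1, hy2⟩, hy0⟩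
    obtain ⟨I, hI⟩ := Ideal.dvd_span_singleton.2 hy2
    have hI0 : I ∈ nonZeroDivisors (Ideal (𝓞 K)) := by
      rw [mem_nonZeroDivisors_iff_ne_zero]
      rintro rfl
      apply hy0
      rw [mul_zero] at hI
      exact Ideal.span_singleton_eq_bot.1 hI
    refine ⟨⟨I, hI0⟩, ⟨?_, ?_⟩, hI⟩
    · have h5 := (ClassGroup.mk0_mul_mk0_eq_one_iff J ⟨I, hI0⟩).2 ⟨y, hI.symm⟩
      exact (inv_eq_of_mul_eq_one_right h5).symm
    · simp only [Set.mem_ofPred_eq] at hy1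
      rw [hI, map_mul, Nat.cast_mul] at hy1
      exact le_of_mul_le_mul_left hy1 hn
  choose! f hfS hf using hex
  have hfib : ∀ I ∈ S, ∃ y : 𝓞 K, y ≠ 0 ∧ {z ∈ T \ {0} | f z = I} = {y, -y} := by
    rintro I ⟨hI1, hI2⟩
    obtain ⟨y, hy⟩ := (ClassGroup.mk0_mul_mk0_eq_one_iff J I).1 (by rw [hI1, mul_inv_cancel])
    have hy0 : y ≠ 0 := by
      rintro rfl
      rw [Ideal.span_singleton_eq_bot.2 rfl] at hy
      rcases mul_eq_zero.1 hy with h | h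
      · exact hJ0 h
      · exact nonZeroDivisors.coe_ne_zero I h
    have hmem : ∀ z, Ideal.span {z} = Ideal.span {y} → z ∈ T \ {0} ∧ f z = I := by
      intro z hz
      have hzT : z ∈ T \ {0} := by
        refine ⟨⟨?_, ?_⟩, ?_⟩
        · simp only [Set.mem_ofPred_eq]
          rw [hz, ← hy, map_mul, Nat.cast_mul]
          gcongr
        · rw [← Ideal.dvd_span_singleton, hz, ← hy]
          exact dvd_mul_right _ _
        · rintro rfl
          rw [Ideal.span_singleton_eq_bot.2 rfl, eq_comm, Ideal.span_singleton_eq_bot] at hz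
          exact hy0 hz
      refine ⟨hzT, Subtype.ext (mul_left_cancel₀ (a := (J : Ideal (𝓞 K))) hJ0 ?_)⟩
      rw [← hf z hzT, hz, hy]
    refine ⟨y, hy0, ?_⟩
    ext z
    constructor
    · rintro ⟨hz, hzI⟩
      have h6 := hf z hz
      rw [hzI, hy, Ideal.span_singleton_eq_span_singleton] at h6
      obtain ⟨u, hu⟩ := h6.symm
      rcases eq_one_or_eq_neg_one_of_isUnit_ringOfIntegers e hm u.isUnit with h | h
      · left; rw [← hu, h, mul_one]
      · right; rw [Set.mem_singleton_iff, ← hu, h]; ring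
    · rintro (rfl | rfl)
      · exact hmem _ rfl
      · exact hmem _ (Ideal.span_singleton_neg y)
  rw [Set.ncard_eq_toFinset_card _ hS, Set.ncard_eq_toFinset_card _ (hfin.subset Set.sdiff_subset),
    Finset.card_eq_sum_card_fiberwise (f := f) (t := hS.toFinset)
      (fun z hz => by simpa using hfS z (by simpa using hz)),
    Finset.sum_congr rfl (g := fun _ => 2), Finset.sum_const, smul_eq_mul, mul_comm]
  intro I hI
  obtain ⟨y, hy0, hy⟩ := hfib I (by simpa using hI)
  have hne : y ≠ -y := fun h => hy0 (self_eq_neg.1 h)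
  rw [← Set.ncard_pair hne, ← hy, ← Set.ncard_coe_finset]
  congr 1
  ext z
  simp

/-- The ideals of bounded norm in a class of an imaginary quadratic field. -/
theorem abs_ncard_mk0_sub_le (e : QuadraticAlgebra ℤ (-m) 1 ≃+* 𝓞 K) (hm : 2 ≤ m)
    {D : ℕ} (hDm : (D : ℤ) = 4 * m - 1) (g : ClassGroup (𝓞 K)) {x : ℝ} (hx : (D : ℝ) ≤ x) :
    |({I : nonZeroDivisors (Ideal (𝓞 K)) | ClassGroup.mk0 I = g ∧
      (Ideal.absNorm (I : Ideal (𝓞 K)) : ℝ) ≤ x}.ncard : ℝ) - Real.pi / √D * x| ≤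
      4 * √(D * x) := by
  obtain ⟨J, hJ, hJn⟩ := exists_mk0_eq_absNorm_le e (by linarith) g⁻¹
  have hJ0 : (J : Ideal (𝓞 K)) ≠ ⊥ := nonZeroDivisors.coe_ne_zero J
  have hn : (0 : ℝ) < Ideal.absNorm (J : Ideal (𝓞 K)) := by
    exact_mod_cast Nat.pos_of_ne_zero fun h => hJ0 (Ideal.absNorm_eq_zero_iff.1 h)
  have hnD : (Ideal.absNorm (J : Ideal (𝓞 K)) : ℝ) ≤ D := by
    have : (Ideal.absNorm (J : Ideal (𝓞 K)) : ℤ) ≤ D := by linarith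
    exact_mod_cast this
  have hD : (7 : ℝ) ≤ D := by
    have : (7 : ℤ) ≤ D := by linarith
    exact_mod_cast this
  have hx0 : 0 < x := by linarith
  set n : ℝ := (Ideal.absNorm (J : Ideal (𝓞 K)) : ℝ)
  set R := √(x / n)
  have hR : 0 < R := Real.sqrt_pos.2 (by positivity)
  have hR2 : R ^ 2 = x / n := Real.sq_sqrt (by positivity)
  have hnR : (n * R) ^ 2 = n * x := by rw [mul_pow, hR2]; field_simp
  obtain ⟨hfin, hc⟩ := ncard_mem_ideal_absNorm_le e hm hDm hJ0 hR
  rw [hnR] at hfin hc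
  rw [← two_mul_ncard_mk0_add_one e hm J hx0.le hfin, hJ, inv_inv, hR2] at hc
  have h1 : n * R ≤ √(D * x) := by
    rw [← Real.sqrt_sq (by positivity : 0 ≤ n * R), hnR]
    gcongr
  have h2 : (D : ℝ) ≤ √(D * x) := by
    apply Real.le_sqrt_of_sq_le
    rw [sq]
    gcongr
  have h3 : n * (Real.pi * (x / n) / (√D / 2)) = 2 * (Real.pi / √D * x) := by
    field_simp
  rw [h3] at hc
  push_cast at hc
  rw [abs_le] at hc ⊢
  constructor <;> nlinarith

end

lemma sum_inv_mul_log_le_of_log_eq {j : ℕ} (hj : 1 ≤ j) {Q : Finset ℕ} (hQ : ∀ q ∈ Q, q.Prime)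
    (hQj : ∀ q ∈ Q, Nat.log 2 q = j) :
    ∑ q ∈ Q, 1 / ((q : ℝ) * Real.log q) ≤ 4 / Real.log 2 * ((j : ℝ) ^ 2)⁻¹ := by
  have hl : 0 < Real.log 2 := Real.log_pos (by norm_num)
  have hj0 : (0 : ℝ) < j := by exact_mod_cast hj
  have hterm : ∀ q ∈ Q, 1 / ((q : ℝ) * Real.log q) ≤
      Real.log q * (2 ^ j * (j * Real.log 2) ^ 2)⁻¹ := by
    intro q hq
    have hq0 : q ≠ 0 := (hQ q hq).ne_zero
    have h1 : (2 : ℝ) ^ j ≤ q := by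
      exact_mod_cast (hQj q hq) ▸ Nat.pow_log_le_self 2 hq0
    have h2 : j * Real.log 2 ≤ Real.log q := by
      rw [← Real.log_pow]
      exact Real.log_le_log (by positivity) h1
    have h3 : 0 < Real.log q := lt_of_lt_of_le (by positivity) h2
    rw [← div_eq_mul_inv, div_le_div_iff₀ (by positivity) (by positivity)]
    calc 1 * (2 ^ j * (j * Real.log 2) ^ 2) ≤ q * Real.log q ^ 2 := by
          rw [one_mul]; gcongr
      _ = Real.log q * (q * Real.log q) := by ring
  refine (Finset.sum_le_sum hterm).trans ?_
  rw [← Finset.sum_mul]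
  have hθ : ∑ q ∈ Q, Real.log q ≤ Real.log 4 * 2 ^ (j + 1) := by
    have h := Chebyshev.theta_le_log4_mul_x (x := ((2 ^ (j + 1) : ℕ) : ℝ)) (Nat.cast_nonneg _)
    rw [Chebyshev.theta_eq_sum_primesLE_log] at h
    push_cast at h
    refine le_trans (Finset.sum_le_sum_of_subset_of_nonneg ?_ ?_) h
    · intro q hq
      rw [Nat.mem_primesLE]
      exact ⟨(Nat.lt_pow_of_log_lt (by norm_num) (by rw [hQj q hq]; omega)).le, hQ q hq⟩
    · intro q _ _
      exact Real.log_natCast_nonneg q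
  have h4 : Real.log 4 = 2 * Real.log 2 := by
    rw [show (4 : ℝ) = 2 ^ 2 by norm_num, Real.log_pow]; norm_num
  rw [h4] at hθ
  calc (∑ q ∈ Q, Real.log q) * (2 ^ j * (j * Real.log 2) ^ 2)⁻¹
      ≤ 2 * Real.log 2 * 2 ^ (j + 1) * (2 ^ j * (j * Real.log 2) ^ 2)⁻¹ := by gcongr
    _ = 4 / Real.log 2 * ((j : ℝ) ^ 2)⁻¹ := by
      rw [pow_succ]
      field_simp
      norm_num

/-- The tail of the sum of `1 / (q log q)` over primes. -/
lemma sum_prime_inv_mul_log_le {Q : Finset ℕ} (hQ : ∀ q ∈ Q, q.Prime) {v : ℝ} (hv : 2 ≤ v)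
    (hQv : ∀ q ∈ Q, v ≤ q) :
    ∑ q ∈ Q, 1 / ((q : ℝ) * Real.log q) ≤ 16 / Real.log v := by
  have hl : 0 < Real.log 2 := Real.log_pos (by norm_num)
  have hlv : 0 < Real.log v := Real.log_pos (by linarith)
  set j₀ := Nat.log 2 ⌊v⌋₊
  have hfl : 2 ≤ ⌊v⌋₊ := Nat.le_floor (by exact_mod_cast hv)
  have hj₀ : 1 ≤ j₀ := Nat.log_pos (by norm_num) hfl
  have hj₀' : (1 : ℝ) ≤ j₀ := by exact_mod_cast hj₀
  have hlog : Real.log v ≤ 2 * j₀ * Real.log 2 := by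
    have h1 : v ≤ 2 ^ (j₀ + 1) := by
      have : ⌊v⌋₊ < 2 ^ (j₀ + 1) := Nat.lt_pow_succ_log_self (by norm_num) _
      rw [Nat.floor_lt (by linarith)] at this
      exact_mod_cast this.le
    have h2 : Real.log v ≤ (j₀ + 1) * Real.log 2 := by
      have := Real.log_le_log (by linarith) h1
      rw [Real.log_pow] at this
      exact_mod_cast this
    nlinarith
  set J := Q.image (Nat.log 2)
  have hJ : ∀ j ∈ J, j₀ ≤ j := by
    intro j hj
    obtain ⟨q, hq, rfl⟩ := Finset.mem_image.1 hj
    exact Nat.log_mono_right (Nat.floor_le_of_le (hQv q hq))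
  rw [← Finset.sum_fiberwise_of_maps_to (t := J) (g := Nat.log 2)
    (fun q hq => Finset.mem_image_of_mem _ hq)]
  calc ∑ j ∈ J, ∑ q ∈ Q with Nat.log 2 q = j, 1 / ((q : ℝ) * Real.log q)
      ≤ ∑ j ∈ J, 4 / Real.log 2 * ((j : ℝ) ^ 2)⁻¹ := by
        refine Finset.sum_le_sum fun j hj => ?_
        exact sum_inv_mul_log_le_of_log_eq (hj₀.trans (hJ j hj))
          (fun q hq => hQ q (Finset.mem_filter.1 hq).1) (fun q hq => (Finset.mem_filter.1 hq).2)
    _ ≤ 4 / Real.log 2 * (2 / j₀) := by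
        rw [← Finset.mul_sum]
        gcongr
        have h := sum_Ioo_inv_sq_le (α := ℝ) (j₀ - 1) (J.sup id + 1)
        rw [Nat.cast_sub hj₀, Nat.cast_one, sub_add_cancel] at h
        refine le_trans (Finset.sum_le_sum_of_subset_of_nonneg ?_ fun _ _ _ => by positivity) h
        intro j hj
        rw [Finset.mem_Ioo]
        have h1 := hJ j hj
        have h2 : j ≤ J.sup id := Finset.le_sup (f := id) hj
        omega
    _ ≤ 16 / Real.log v := by
        rw [div_mul_div_comm, div_le_div_iff₀ (by positivity) hlv]
        nlinarith

section

variable {m : ℤ} {K : Type} [Field K] [NumberField K]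

lemma absNorm_span_natCast_ringEquiv (e : QuadraticAlgebra ℤ (-m) 1 ≃+* 𝓞 K) (q : ℕ) :
    Ideal.absNorm (Ideal.span {(q : 𝓞 K)}) = q ^ 2 := by
  rw [← map_natCast e, absNorm_span_ringEquiv, QuadraticAlgebra.norm_natCast, Int.natAbs_pow,
    Int.natAbs_natCast]

lemma exists_prime_dvd_span_natCast (e : QuadraticAlgebra ℤ (-m) 1 ≃+* 𝓞 K)
    (p : IsDedekindDomain.HeightOneSpectrum (𝓞 K)) :
    ∃ q : ℕ, q.Prime ∧ p.asIdeal ∣ Ideal.span {(q : 𝓞 K)} ∧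
      (Ideal.absNorm p.asIdeal = q ∨ Ideal.absNorm p.asIdeal = q ^ 2) := by
  have : NeZero p.asIdeal := ⟨p.ne_bot⟩
  have hq := Nat.absNorm_under_prime p.asIdeal
  set q := Ideal.absNorm (Ideal.under ℤ p.asIdeal)
  have hdvd : p.asIdeal ∣ Ideal.span {(q : 𝓞 K)} := by
    rw [Ideal.dvd_span_singleton]
    have h := Ideal.absNorm_mem (Ideal.under ℤ p.asIdeal)
    rw [Ideal.mem_comap] at h
    simpa using h
  refine ⟨q, hq, hdvd, ?_⟩
  have h := map_dvd Ideal.absNorm hdvd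
  rw [absNorm_span_natCast_ringEquiv e, Nat.dvd_prime_pow hq] at h
  obtain ⟨k, hk, h⟩ := h
  interval_cases k
  · exact absurd (Ideal.absNorm_eq_one_iff.1 (by simpa using h)) p.isPrime.ne_top
  · left; simpa using h
  · right; exact h

lemma card_le_two_of_dvd_span_natCast (e : QuadraticAlgebra ℤ (-m) 1 ≃+* 𝓞 K) {q : ℕ}
    (hq : q.Prime) {F : Finset (IsDedekindDomain.HeightOneSpectrum (𝓞 K))}
    (hF : ∀ p ∈ F, p.asIdeal ∣ Ideal.span {(q : 𝓞 K)})
    (hFq : ∀ p ∈ F, q ≤ Ideal.absNorm p.asIdeal) : F.card ≤ 2 := by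
  have h1 : ∏ p ∈ F, p.asIdeal ∣ Ideal.span {(q : 𝓞 K)} := by
    rw [← Finset.prod_image (s := F) (g := fun p => p.asIdeal) (f := fun I => I)
      (fun p _ p' _ h => IsDedekindDomain.HeightOneSpectrum.ext h)]
    refine Finset.prod_primes_dvd _ ?_ ?_
    · simp only [Finset.mem_image]
      rintro _ ⟨p, -, rfl⟩
      exact p.prime
    · simp only [Finset.mem_image]
      rintro _ ⟨p, hp, rfl⟩
      exact hF p hp
  have h2 := Nat.le_of_dvd (pow_pos hq.pos 2) (absNorm_span_natCast_ringEquiv e q ▸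
    map_dvd Ideal.absNorm h1)
  rw [map_prod] at h2
  have h3 := (Finset.pow_card_le_prod F _ q hFq).trans h2
  exact (Nat.pow_le_pow_iff_right hq.one_lt).1 h3

lemma sum_comp_le_two_mul_sum_image {ι : Type*} {F : Finset ι} {f : ι → ℕ} {h : ℕ → ℝ}
    (h0 : ∀ q, 0 ≤ h q) (hf : ∀ q ∈ F.image f, {p ∈ F | f p = q}.card ≤ 2) :
    ∑ p ∈ F, h (f p) ≤ 2 * ∑ q ∈ F.image f, h q := by
  rw [Finset.sum_comp h f, Finset.mul_sum]
  refine Finset.sum_le_sum fun q hq => ?_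
  rw [nsmul_eq_mul]
  have : ({p ∈ F | f p = q}.card : ℝ) ≤ 2 := by exact_mod_cast hf q hq
  have := h0 q
  gcongr

lemma two_le_absNorm (p : IsDedekindDomain.HeightOneSpectrum (𝓞 K)) :
    2 ≤ Ideal.absNorm p.asIdeal := by
  have h0 : Ideal.absNorm p.asIdeal ≠ 0 := fun h => p.ne_bot (Ideal.absNorm_eq_zero_iff.1 h)
  have h1 : Ideal.absNorm p.asIdeal ≠ 1 := fun h =>
    p.isPrime.ne_top (Ideal.absNorm_eq_one_iff.1 h)
  omega

/-- The sum of `N 𝔭 ^ (-3/4)` over the inert primes of a quadratic field. -/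
lemma sum_absNorm_rpow_le (e : QuadraticAlgebra ℤ (-m) 1 ≃+* 𝓞 K)
    {F : Finset (IsDedekindDomain.HeightOneSpectrum (𝓞 K))}
    (hF : ∀ p ∈ F, ¬ (Ideal.absNorm p.asIdeal).Prime) :
    ∑ p ∈ F, (Ideal.absNorm p.asIdeal : ℝ) ^ (-(3 / 4) : ℝ) ≤
      2 * ∑' n : ℕ, (n : ℝ) ^ (-(3 / 2) : ℝ) := by
  choose f hf1 hf2 hf3 using exists_prime_dvd_span_natCast e
  have hN : ∀ p ∈ F, Ideal.absNorm p.asIdeal = f p ^ 2 := fun p hp =>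
    (hf3 p).resolve_left fun h => hF p hp (h ▸ hf1 p)
  have hterm : ∀ p ∈ F, (Ideal.absNorm p.asIdeal : ℝ) ^ (-(3 / 4) : ℝ) =
      (f p : ℝ) ^ (-(3 / 2) : ℝ) := by
    intro p hp
    rw [hN p hp, Nat.cast_pow, ← Real.rpow_natCast, ← Real.rpow_mul (Nat.cast_nonneg _)]
    norm_num
  rw [Finset.sum_congr rfl hterm]
  refine (sum_comp_le_two_mul_sum_image (h := fun n => (n : ℝ) ^ (-(3 / 2) : ℝ))
    (fun n => by positivity) ?_).trans ?_
  · intro q hq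
    obtain ⟨p, hp, rfl⟩ := Finset.mem_image.1 hq
    refine card_le_two_of_dvd_span_natCast e (hf1 p) ?_ ?_
    · intro p' hp'
      rw [← (Finset.mem_filter.1 hp').2]
      exact hf2 p'
    · intro p' hp'
      rw [← (Finset.mem_filter.1 hp').2, hN p' (Finset.mem_filter.1 hp').1]
      exact Nat.le_self_pow two_ne_zero _
  · gcongr
    exact (Real.summable_nat_rpow.2 (by norm_num)).sum_le_tsum _ (fun n _ => by positivity)

/-- The tail of the sum of `1 / (N 𝔭 log N 𝔭)` over the primes of a quadratic field. -/
lemma sum_inv_absNorm_mul_log_le (e : QuadraticAlgebra ℤ (-m) 1 ≃+* 𝓞 K)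
    {F : Finset (IsDedekindDomain.HeightOneSpectrum (𝓞 K))} {v : ℝ} (hv : 2 ≤ v)
    (hF : ∀ p ∈ F, v ≤ Ideal.absNorm p.asIdeal) :
    ∑ p ∈ F, 1 / ((Ideal.absNorm p.asIdeal : ℝ) * Real.log (Ideal.absNorm p.asIdeal)) ≤
      (32 + 2 * ∑' n : ℕ, (n : ℝ) ^ (-2 : ℝ)) / Real.log v := by
  have hlv : 0 < Real.log v := Real.log_pos (by linarith)
  choose f hf1 hf2 hf3 using exists_prime_dvd_span_natCast e
  have hge : ∀ p, f p ≤ Ideal.absNorm p.asIdeal := by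
    intro p
    rcases hf3 p with h | h <;> rw [h]
    exact Nat.le_self_pow two_ne_zero _
  have hfib : ∀ F' : Finset (IsDedekindDomain.HeightOneSpectrum (𝓞 K)),
      ∀ q ∈ F'.image f, {p ∈ F' | f p = q}.card ≤ 2 := by
    intro F' q hq
    obtain ⟨p, hp, rfl⟩ := Finset.mem_image.1 hq
    refine card_le_two_of_dvd_span_natCast e (hf1 p) ?_ ?_
    · intro p' hp'
      rw [← (Finset.mem_filter.1 hp').2]
      exact hf2 p'
    · intro p' hp'
      rw [← (Finset.mem_filter.1 hp').2]
      exact hge p'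
  rw [← Finset.sum_filter_add_sum_filter_not F (fun p => Ideal.absNorm p.asIdeal = f p), add_div]
  gcongr ?_ + ?_
  · set F₁ := {p ∈ F | Ideal.absNorm p.asIdeal = f p}
    have hN : ∀ p ∈ F₁, Ideal.absNorm p.asIdeal = f p := fun p hp => (Finset.mem_filter.1 hp).2
    have hterm : ∀ p ∈ F₁, 1 / ((Ideal.absNorm p.asIdeal : ℝ) *
        Real.log (Ideal.absNorm p.asIdeal)) = 1 / ((f p : ℝ) * Real.log (f p)) := by
      intro p hp
      rw [hN p hp]
    rw [Finset.sum_congr rfl hterm]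
    refine (sum_comp_le_two_mul_sum_image (h := fun n => 1 / ((n : ℝ) * Real.log n))
      (fun n => ?_) (hfib F₁)).trans ?_
    · have := Real.log_natCast_nonneg n
      positivity
    · have h := sum_prime_inv_mul_log_le (Q := F₁.image f) (v := v) ?_ hv ?_
      · calc _ ≤ 2 * (16 / Real.log v) := by gcongr
          _ = 32 / Real.log v := by ring
      · intro q hq
        obtain ⟨p, hp, rfl⟩ := Finset.mem_image.1 hq
        exact hf1 p
      · intro q hq
        obtain ⟨p, hp, rfl⟩ := Finset.mem_image.1 hq
        rw [← hN p hp]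
        exact hF p (Finset.mem_filter.1 hp).1
  · set F₂ := {p ∈ F | ¬ Ideal.absNorm p.asIdeal = f p}
    have hN : ∀ p ∈ F₂, Ideal.absNorm p.asIdeal = f p ^ 2 := fun p hp =>
      (hf3 p).resolve_left (Finset.mem_filter.1 hp).2
    have hterm : ∀ p ∈ F₂, 1 / ((Ideal.absNorm p.asIdeal : ℝ) *
        Real.log (Ideal.absNorm p.asIdeal)) ≤ (f p : ℝ) ^ (-2 : ℝ) * (1 / Real.log v) := by
      intro p hp
      have h1 := hF p (Finset.mem_filter.1 hp).1
      have h2 : Real.log v ≤ Real.log (Ideal.absNorm p.asIdeal) :=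
        Real.log_le_log (by linarith) h1
      have h3 : (0 : ℝ) < Ideal.absNorm p.asIdeal := by linarith
      have h4 : (f p : ℝ) ^ (-2 : ℝ) = 1 / (Ideal.absNorm p.asIdeal : ℝ) := by
        rw [hN p hp, Nat.cast_pow, Real.rpow_neg (Nat.cast_nonneg _), one_div]
        norm_num
      rw [h4, one_div_mul_one_div]
      gcongr
    refine (Finset.sum_le_sum hterm).trans ?_
    rw [← Finset.sum_mul, mul_one_div]
    gcongr
    refine (sum_comp_le_two_mul_sum_image (h := fun n => (n : ℝ) ^ (-2 : ℝ))
      (fun n => by positivity) (hfib F₂)).trans ?_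
    gcongr
    exact (Real.summable_nat_rpow.2 (by norm_num)).sum_le_tsum _ (fun n _ => by positivity)

end

section

variable {K : Type} [Field K]

/-- The product of a multiset of primes. -/
noncomputable def primeMultisetProd (s : Multiset (IsDedekindDomain.HeightOneSpectrum (𝓞 K))) :
    nonZeroDivisors (Ideal (𝓞 K)) :=
  (s.map fun p => (⟨p.asIdeal, mem_nonZeroDivisors_of_ne_zero p.ne_bot⟩ :
    nonZeroDivisors (Ideal (𝓞 K)))).prod

lemma coe_primeMultisetProd (s : Multiset (IsDedekindDomain.HeightOneSpectrum (𝓞 K))) :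
    (primeMultisetProd s : Ideal (𝓞 K)) = (s.map fun p => p.asIdeal).prod := by
  rw [primeMultisetProd, ← Submonoid.coe_subtype, map_multiset_prod, Multiset.map_map]
  rfl

variable [NumberField K]

lemma primeMultisetProd_bijective :
    Function.Bijective (primeMultisetProd (K := K)) := by
  have hinj : Function.Injective fun p : IsDedekindDomain.HeightOneSpectrum (𝓞 K) => p.asIdeal :=
    fun _ _ h => IsDedekindDomain.HeightOneSpectrum.ext h
  constructor
  · intro s t h
    have h1 := congrArg (fun I : nonZeroDivisors (Ideal (𝓞 K)) => (I : Ideal (𝓞 K))) h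
    simp only [coe_primeMultisetProd] at h1
    have h2 : ∀ s : Multiset (IsDedekindDomain.HeightOneSpectrum (𝓞 K)),
        UniqueFactorizationMonoid.normalizedFactors (s.map fun p => p.asIdeal).prod =
          s.map fun p => p.asIdeal := by
      intro s
      refine UniqueFactorizationMonoid.normalizedFactors_prod_of_prime fun I hI => ?_
      obtain ⟨p, -, rfl⟩ := Multiset.mem_map.1 hI
      exact p.prime
    refine Multiset.map_injective hinj ?_
    rw [← h2 s, ← h2 t, h1]
  · intro I
    have hI0 : (I : Ideal (𝓞 K)) ≠ 0 := nonZeroDivisors.coe_ne_zero I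
    have hcan : CanLift (Ideal (𝓞 K)) (IsDedekindDomain.HeightOneSpectrum (𝓞 K))
        (fun p => p.asIdeal) Prime :=
      ⟨fun J hJ => ⟨⟨J, Ideal.isPrime_of_prime hJ, hJ.ne_zero⟩, rfl⟩⟩
    obtain ⟨s, hs⟩ : ∃ s : Multiset (IsDedekindDomain.HeightOneSpectrum (𝓞 K)),
        (s.map fun p => p.asIdeal) =
          UniqueFactorizationMonoid.normalizedFactors (I : Ideal (𝓞 K)) :=
      CanLift.prf (coe := Multiset.map fun p : IsDedekindDomain.HeightOneSpectrum (𝓞 K) =>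
        p.asIdeal) _ fun J hJ => UniqueFactorizationMonoid.prime_of_normalized_factor J hJ
    refine ⟨s, Subtype.ext ?_⟩
    rw [coe_primeMultisetProd, hs]
    exact associated_iff_eq.1 (UniqueFactorizationMonoid.prod_normalizedFactors hI0)

lemma prod_map_absNorm (s : Multiset (IsDedekindDomain.HeightOneSpectrum (𝓞 K))) :
    (s.map fun p => (Ideal.absNorm p.asIdeal : ℝ)).prod =
      Ideal.absNorm (primeMultisetProd s : Ideal (𝓞 K)) := by
  rw [coe_primeMultisetProd, map_multiset_prod, Multiset.map_map, Nat.cast_multiset_prod,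
    Multiset.map_map]
  rfl

lemma sum_map_mk0 (s : Multiset (IsDedekindDomain.HeightOneSpectrum (𝓞 K))) :
    (s.map fun p => Additive.ofMul (ClassGroup.mk0
      (⟨p.asIdeal, mem_nonZeroDivisors_of_ne_zero p.ne_bot⟩ :
        nonZeroDivisors (Ideal (𝓞 K))))).sum =
      Additive.ofMul (ClassGroup.mk0 (primeMultisetProd s)) := by
  rw [primeMultisetProd, map_multiset_prod, Multiset.map_map, ofMul_multiset_prod,
    Multiset.map_map]
  rfl

/-- The ideals of an imaginary quadratic field of discriminant `-D` as an arithmetic system. -/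
noncomputable def quadraticArithSystem {m : ℤ} (e : QuadraticAlgebra ℤ (-m) 1 ≃+* 𝓞 K) (hm : 2 ≤ m)
    {D : ℕ} (hDm : (D : ℤ) = 4 * m - 1) :
    ArithSystem (IsDedekindDomain.HeightOneSpectrum (𝓞 K)) (Additive (ClassGroup (𝓞 K)))
      (32 + 2 * ∑' n : ℕ, (n : ℝ) ^ (-2 : ℝ)) (2 * ∑' n : ℕ, (n : ℝ) ^ (-(3 / 2) : ℝ)) where
  N p := Ideal.absNorm p.asIdeal
  cl p := Additive.ofMul (ClassGroup.mk0 ⟨p.asIdeal, mem_nonZeroDivisors_of_ne_zero p.ne_bot⟩)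
  κ := Real.pi / √D
  X₀ := 4 * (D : ℝ) ^ 2
  Bad := {p | ¬ (Ideal.absNorm p.asIdeal).Prime}
  two_le_N p := by exact_mod_cast two_le_absNorm p
  κ_pos := by
    have : (0 : ℤ) < D := by linarith
    have : (0 : ℝ) < D := by exact_mod_cast this
    have := Real.pi_pos
    positivity
  one_le_X₀ := by
    have : (7 : ℤ) ≤ D := by linarith
    have : (7 : ℝ) ≤ D := by exact_mod_cast this
    nlinarith
  one_le_κ_sq_mul := by
    have : (7 : ℤ) ≤ D := by linarith
    have hD : (7 : ℝ) ≤ D := by exact_mod_cast this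
    have h : (Real.pi / √D) ^ 2 * (4 * (D : ℝ) ^ 2) = 4 * (Real.pi ^ 2 * D) := by
      rw [div_pow, Real.sq_sqrt (by linarith)]
      field_simp
    rw [h]
    have := Real.pi_gt_three
    nlinarith [mul_le_mul (by nlinarith : (9 : ℝ) ≤ Real.pi ^ 2) hD (by norm_num) (by positivity)]
  fin x := by
    simp only [prod_map_absNorm]
    have h := (Ideal.finite_setOfPred_absNorm_le (S := 𝓞 K) ⌊x⌋₊).preimage
      (f := Subtype.val ∘ primeMultisetProd)
      (Subtype.val_injective.comp primeMultisetProd_bijective.1).injOn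
    exact h.subset fun s hs => Nat.le_floor hs
  count x hx g := by
    have : (7 : ℤ) ≤ D := by linarith
    have hD : (7 : ℝ) ≤ D := by exact_mod_cast this
    have hDx : (D : ℝ) ≤ x := by nlinarith
    simp only [prod_map_absNorm, sum_map_mk0]
    have hset : {s : Multiset (IsDedekindDomain.HeightOneSpectrum (𝓞 K)) |
        Additive.ofMul (ClassGroup.mk0 (primeMultisetProd s)) = g ∧
          (Ideal.absNorm (primeMultisetProd s : Ideal (𝓞 K)) : ℝ) ≤ x}.ncard =
        {I : nonZeroDivisors (Ideal (𝓞 K)) | ClassGroup.mk0 I = g.toMul ∧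
          (Ideal.absNorm (I : Ideal (𝓞 K)) : ℝ) ≤ x}.ncard := by
      rw [← Set.ncard_image_of_injective _ (primeMultisetProd_bijective (K := K)).1]
      congr 1
      ext I
      obtain ⟨s, rfl⟩ := primeMultisetProd_bijective.2 I
      rw [primeMultisetProd_bijective.1.mem_set_image]
      rfl
    rw [hset]
    refine (abs_ncard_mk0_sub_le e hm hDm g.toMul hDx).trans ?_
    have h1 : √(4 * (D : ℝ) ^ 2 * x) = 2 * √D * √(D * x) := by
      rw [show 4 * (D : ℝ) ^ 2 * x = 2 ^ 2 * (D * (D * x)) by ring,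
        Real.sqrt_mul (by norm_num), Real.sqrt_sq (by norm_num), Real.sqrt_mul (by linarith)]
      ring
    have h2 : 0 < √(D : ℝ) := Real.sqrt_pos.2 (by linarith)
    have h3 : Real.pi / √D * √(4 * (D : ℝ) ^ 2 * x) = 2 * Real.pi * √(D * x) := by
      rw [h1]; field_simp
    rw [h3]
    have := Real.pi_gt_three
    gcongr
    linarith
  tail _ _ hv hF := sum_inv_absNorm_mul_log_le e hv hF
  bad _ hF := sum_absNorm_rpow_le e hF

end

theorem least_split_prime_in_class :
    ∃ L C : ℝ, 0 < L ∧ 0 < C ∧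
    ∀ (D : ℕ), Nat.Prime D → 3 < D → D % 4 = 3 →
    ∀ (K : Type) [Field K] [NumberField K], Module.finrank ℚ K = 2 →
      (∃ α : K, α ^ 2 = -(D : K)) →
    ∀ 𝒞 : ClassGroup (𝓞 K), ∃ P : Ideal (𝓞 K), P.IsPrime ∧
      idealClass K P = 𝒞 ∧ (Ideal.absNorm P).Prime ∧ Ideal.absNorm P ≠ D ∧
      (Ideal.absNorm P : ℝ) ≤ C * (D : ℝ) ^ L := by
  obtain ⟨z₀, U, hz, hU, hmain⟩ := ArithSystem.exists_prime
    (32 + 2 * ∑' n : ℕ, (n : ℝ) ^ (-2 : ℝ)) (2 * ∑' n : ℕ, (n : ℝ) ^ (-(3 / 2) : ℝ))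
  refine ⟨16 * U, (z₀ * 4 ^ 8) ^ U, by positivity, by positivity, ?_⟩
  rintro D hD hD3 hD4 K _ _ hK ⟨α, hα⟩ 𝒞
  obtain ⟨m, hm, hDm⟩ : ∃ m : ℤ, 2 ≤ m ∧ (D : ℤ) = 4 * m - 1 :=
    ⟨((D + 1) / 4 : ℕ), by omega, by omega⟩
  obtain ⟨e⟩ := exists_ringEquiv_ringOfIntegers hD (by linarith) hDm K hK hα
  have hodd : Odd (Fintype.card (Additive (ClassGroup (𝓞 K)))) := by
    rw [Fintype.card_additive]
    exact odd_card_classGroup e hD (by linarith) hDm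
  obtain ⟨p, hbad, hcl, hlt, hle⟩ := hmain _ _ (quadraticArithSystem e hm hDm) hodd
    (Additive.ofMul 𝒞)
  replace hlt : 4 * (D : ℝ) ^ 2 < Ideal.absNorm p.asIdeal := hlt
  replace hle : (Ideal.absNorm p.asIdeal : ℝ) ≤ (z₀ * (4 * (D : ℝ) ^ 2) ^ 8) ^ U := hle
  refine ⟨p.asIdeal, p.isPrime, ?_, not_not.1 hbad, ?_, hle.trans_eq ?_⟩
  · rw [idealClass, dif_pos (mem_nonZeroDivisors_of_ne_zero p.ne_bot)]
    exact hcl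
  · intro h
    rw [h] at hlt
    have : (3 : ℝ) < D := by exact_mod_cast hD3
    nlinarith
  · rw [mul_pow, ← mul_assoc, Real.mul_rpow (by positivity) (by positivity), ← pow_mul,
      ← Real.rpow_natCast (D : ℝ), ← Real.rpow_mul (Nat.cast_nonneg _)]
    norm_num
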